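/- Let 0<γ<1, let k ∈ C²(ℝⁿ∖{0};ℝⁿ) be homogeneous of degree 1−n, let ρ₀ ∈ C^γ_c(ℝⁿ;ℝ), and let (ρ,v) solve ρ_t + v·∇ρ = 0, v = k∗ρ, ρ(·,0)=ρ₀, with flow X(·,t) ∈ C^{1,γ}. Then the velocity gradient obeys the a priori bound ‖∇v(·,t)‖_{L^∞} ≤ c(n,ρ₀) exp(ct) for constants c, c(n,ρ₀); consequently ∫_0^t ‖∇v(·,s)‖_{L^∞} ds < ∞ and |X(·,t)|_{1,γ} is finite for every time t. -/

import Mathlib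

open MeasureTheory Metric Set intervalIntegral

noncomputable section

abbrev Euc (n : ℕ) := EuclideanSpace ℝ (Fin n)

/-- sup norm (as a real supremum) -/
def supR {n : ℕ} (f : Euc n → ℝ) : ℝ := ⨆ x, |f x|

/-- Hölder seminorm (as a real supremum) -/
def hSemiR {n : ℕ} (γ : ℝ) (f : Euc n → ℝ) : ℝ :=
  ⨆ p : {p : Euc n × Euc n // p.1 ≠ p.2}, |f p.1.1 - f p.1.2| / ‖p.1.1 - p.1.2‖ ^ γ

/-- partial derivative in the `j`-th coordinate direction -/
def pd {n : ℕ} (j : Fin n) (f : Euc n → ℝ) (x : Euc n) : ℝ :=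
  fderiv ℝ f x (EuclideanSpace.single j 1)

/-- `‖∇F‖_{L^∞}`: supremum over all entries `∂_j F_i` of their absolute values -/
def gradSupR {n : ℕ} (F : Euc n → Euc n) : ℝ :=
  ⨆ q : (Fin n × Fin n) × Euc n, |pd q.1.2 (fun y => F y q.1.1) q.2|

/-- `|∇F|_γ`: supremum over all entries `∂_j F_i` of their Hölder seminorms -/
def gradHSemiR {n : ℕ} (γ : ℝ) (F : Euc n → Euc n) : ℝ :=
  ⨆ q : (Fin n × Fin n) × {p : Euc n × Euc n // p.1 ≠ p.2},
    |pd q.1.2 (fun y => F y q.1.1) q.2.1.1 - pd q.1.2 (fun y => F y q.1.1) q.2.1.2| /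
      ‖q.2.1.1 - q.2.1.2‖ ^ γ

section

/-- the symmetric second difference of `f` at `x` with step `h` -/
def secDiff {E F : Type*} [AddCommGroup E] [AddCommGroup F] [Module ℝ F]
    (f : E → F) (h x : E) : F :=
  f (x + h) + f (x - h) - (2 : ℝ) • f x

theorem norm_secDiff_le_of_hasFDerivAt {E F : Type*} [NormedAddCommGroup E] [NormedSpace ℝ E]
    [NormedAddCommGroup F] [NormedSpace ℝ F] {f : E → F} {f' : E → E →L[ℝ] F} {z h : E} {M : ℝ}
    (hf : ∀ w ∈ closedBall z ‖h‖, HasFDerivAt f (f' w) w)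
    (hlip : ∀ a ∈ closedBall z ‖h‖, ∀ b ∈ closedBall z ‖h‖, ‖f' a - f' b‖ ≤ M * ‖a - b‖) :
    ‖secDiff f h z‖ ≤ (2 * M) * ‖h‖ ^ 2 := by
  rcases eq_or_ne h 0 with rfl | hh
  · simp [secDiff, two_smul]
  have hh0 : 0 < ‖h‖ := norm_pos_iff.2 hh
  have hp : ∀ u ∈ closedBall (0 : E) ‖h‖, z + u ∈ closedBall z ‖h‖ := by
    intro u hu; simpa using hu
  have hm : ∀ u ∈ closedBall (0 : E) ‖h‖, z - u ∈ closedBall z ‖h‖ := by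
    intro u hu; simpa [dist_eq_norm] using hu
  have e2 : ∀ u : E, z + u - (z - u) = (2 : ℝ) • u := fun u => by rw [two_smul]; abel
  have hM0 : 0 ≤ M := by
    have h1 := (norm_nonneg _).trans (hlip _ (hp h (by simp)) _ (hm h (by simp)))
    rw [e2, norm_smul, Real.norm_ofNat] at h1
    exact nonneg_of_mul_nonneg_left h1 (by positivity)
  have hMVT := (convex_closedBall (0 : E) ‖h‖).norm_image_sub_le_of_norm_hasFDerivWithin_le
    (𝕜 := ℝ) (f := fun u => f (z + u) + f (z - u)) (C := 2 * M * ‖h‖) (x := 0) (y := h)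
    (f' := fun u => f' (z + u) - f' (z - u))
    (fun u hu => by
      have h1 : HasFDerivAt (fun u => f (z + u)) ((f' (z + u)).comp (.id ℝ E)) u :=
        (hf _ (hp u hu)).comp u ((hasFDerivAt_id u).const_add z)
      have h2 : HasFDerivAt (fun u => f (z - u)) ((f' (z - u)).comp (-.id ℝ E)) u :=
        (hf _ (hm u hu)).comp u ((hasFDerivAt_id u).const_sub z)
      rw [ContinuousLinearMap.comp_id] at h1
      rw [ContinuousLinearMap.comp_neg, ContinuousLinearMap.comp_id] at h2
      rw [sub_eq_add_neg]
      exact (h1.add h2).hasFDerivWithinAt)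
    (fun u hu => by
      refine (hlip _ (hp u hu) _ (hm u hu)).trans ?_
      rw [e2, norm_smul, Real.norm_ofNat]
      have : ‖u‖ ≤ ‖h‖ := by simpa using hu
      calc M * (2 * ‖u‖) ≤ M * (2 * ‖h‖) := by gcongr
        _ = _ := by ring)
    (by simp) (by simp)
  have e : secDiff f h z = f (z + h) + f (z - h) - (f (z + 0) + f (z - 0)) := by
    simp [secDiff, two_smul]
  rw [e]
  refine hMVT.trans (le_of_eq ?_)
  rw [sub_zero]; ring

/-- a kernel of class `C²` away from the origin, homogeneous of degree `1 - n`,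
normalised to vanish at the origin -/
structure IsHomKernel {n : ℕ} (k : Euc n → Euc n) : Prop where
  pos : 0 < n
  smooth : ContDiffOn ℝ 2 k {(0 : Euc n)}ᶜ
  zero : k 0 = 0
  homog : ∀ c : ℝ, 0 < c → ∀ x : Euc n, x ≠ 0 → k (c • x) = c ^ ((1 : ℝ) - n) • k x

namespace IsHomKernel

variable {n : ℕ} {k : Euc n → Euc n}

theorem measurable (hk : IsHomKernel k) : Measurable k :=
  measurable_of_continuousOn_compl_singleton 0 hk.smooth.continuousOn

theorem map_smul (hk : IsHomKernel k) {c : ℝ} (hc : 0 < c) (x : Euc n) :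
    k (c • x) = c ^ ((1 : ℝ) - n) • k x := by
  rcases eq_or_ne x 0 with rfl | hx
  · simp [hk.zero]
  · exact hk.homog c hc x hx

theorem secDiff_smul (hk : IsHomKernel k) {c : ℝ} (hc : 0 < c) (h x : Euc n) :
    secDiff k (c • h) (c • x) = c ^ ((1 : ℝ) - n) • secDiff k h x := by
  unfold secDiff
  rw [← smul_add, ← smul_sub, hk.map_smul hc, hk.map_smul hc, hk.map_smul hc]
  module

theorem exists_norm_le (hk : IsHomKernel k) :
    ∃ C : ℝ, 0 < C ∧ ∀ z : Euc n, ‖k z‖ ≤ C * ‖z‖ ^ ((1 : ℝ) - n) := by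
  obtain ⟨C, hC⟩ := (isCompact_sphere (0 : Euc n) 1).exists_bound_of_continuousOn
    (hk.smooth.continuousOn.mono (fun x hx => by
      intro h; simp_all))
  refine ⟨max C 1, by positivity, fun z => ?_⟩
  rcases eq_or_ne z 0 with rfl | hz
  · rw [hk.zero, norm_zero]; positivity
  have hz' : 0 < ‖z‖ := norm_pos_iff.2 hz
  have h1 : z = ‖z‖ • (‖z‖⁻¹ • z) := by
    rw [smul_smul, mul_inv_cancel₀ hz'.ne', one_smul]
  have h2 : ‖‖z‖⁻¹ • z‖ = 1 := by
    rw [norm_smul, norm_inv, norm_norm, inv_mul_cancel₀ hz'.ne']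
  have h3 := hC (‖z‖⁻¹ • z) (by simpa using h2)
  rw [h1, hk.homog _ hz' _ (by rw [← norm_pos_iff, h2]; norm_num), norm_smul, ← h1, mul_comm,
    Real.norm_of_nonneg (by positivity)]
  gcongr
  exact h3.trans (le_max_left _ _)

theorem exists_norm_secDiff_le (hk : IsHomKernel k) :
    ∃ C : ℝ, 0 < C ∧ ∀ z h : Euc n, z ≠ 0 → ‖h‖ ≤ ‖z‖ / 2 →
      ‖secDiff k h z‖ ≤ C * (‖h‖ ^ 2 * ‖z‖ ^ (-(n : ℝ) - 1)) := by
  have hop : IsOpen ({(0 : Euc n)}ᶜ) := isOpen_compl_singleton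
  have hd1 : ContDiffOn ℝ 1 (fderiv ℝ k) {(0 : Euc n)}ᶜ :=
    hk.smooth.fderiv_of_isOpen hop (by norm_num)
  have hd2 : ContDiffOn ℝ 0 (fderiv ℝ (fderiv ℝ k)) {(0 : Euc n)}ᶜ :=
    hd1.fderiv_of_isOpen hop (by norm_num)
  have hcomp : IsCompact (closedBall (0 : Euc n) 2 ∩ {z | 1 / 2 ≤ ‖z‖}) :=
    (isCompact_closedBall _ _).inter_right (isClosed_le continuous_const continuous_norm)
  have hne : ∀ w : Euc n, 1 / 2 ≤ ‖w‖ → w ≠ 0 := by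
    rintro w hw rfl; rw [norm_zero] at hw; norm_num at hw
  obtain ⟨M, hM⟩ := hcomp.exists_bound_of_continuousOn (f := fderiv ℝ (fderiv ℝ k))
    (hd2.continuousOn.mono
      (fun x (hx : x ∈ closedBall (0 : Euc n) 2 ∩ {z | 1 / 2 ≤ ‖z‖}) => hne x hx.2))
  -- unit vectors first
  have key : ∀ z h : Euc n, ‖z‖ = 1 → ‖h‖ ≤ 1 / 2 → ‖secDiff k h z‖ ≤ (2 * M) * ‖h‖ ^ 2 := by
    intro z h hz hh
    have hin : ∀ w ∈ closedBall z (1 / 2), w ∈ closedBall (0 : Euc n) 2 ∩ {z | 1 / 2 ≤ ‖z‖} := by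
      intro w hw
      rw [mem_closedBall, dist_eq_norm] at hw
      have e1 := norm_sub_norm_le z w
      have e2 := norm_sub_norm_le w z
      rw [norm_sub_rev] at e1
      constructor
      · rw [mem_closedBall, dist_zero_right]; linarith
      · show 1 / 2 ≤ ‖w‖; linarith
    have hlip : ∀ a ∈ closedBall z (1 / 2), ∀ b ∈ closedBall z (1 / 2),
        ‖fderiv ℝ k a - fderiv ℝ k b‖ ≤ M * ‖a - b‖ := by
      intro a ha b hb
      refine (convex_closedBall z (1 / 2)).norm_image_sub_le_of_norm_fderiv_le (𝕜 := ℝ)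
        (fun w hw => ?_) (fun w hw => hM w (hin w hw)) hb ha
      exact (hd1.differentiableOn (by norm_num) w (hne w (hin w hw).2)).differentiableAt
        (hop.mem_nhds (hne w (hin w hw).2))
    have hdk : ∀ w ∈ closedBall z (1 / 2), HasFDerivAt k (fderiv ℝ k w) w := fun w hw =>
      ((hk.smooth.differentiableOn (by norm_num) w (hne w (hin w hw).2)).differentiableAt
        (hop.mem_nhds (hne w (hin w hw).2))).hasFDerivAt
    have hsub : closedBall z ‖h‖ ⊆ closedBall z (1 / 2) := closedBall_subset_closedBall hh
    exact norm_secDiff_le_of_hasFDerivAt (fun w hw => hdk w (hsub hw))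
      (fun a ha b hb => hlip a (hsub ha) b (hsub hb))
  refine ⟨max (2 * M) 1, by positivity, fun z h hz hh => ?_⟩
  have hz' : 0 < ‖z‖ := norm_pos_iff.2 hz
  set w := ‖z‖⁻¹ • z with hw
  set g := ‖z‖⁻¹ • h with hg
  have hw1 : ‖w‖ = 1 := by
    rw [hw, norm_smul, norm_inv, norm_norm, inv_mul_cancel₀ hz'.ne']
  have hg1 : ‖g‖ = ‖z‖⁻¹ * ‖h‖ := by rw [hg, norm_smul, norm_inv, norm_norm]
  have hg2 : ‖g‖ ≤ 1 / 2 := by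
    rw [hg1, inv_mul_le_iff₀ hz']; linarith
  have h1 : z = ‖z‖ • w := by
    rw [hw, smul_smul, mul_inv_cancel₀ hz'.ne', one_smul]
  have h2 : h = ‖z‖ • g := by
    rw [hg, smul_smul, mul_inv_cancel₀ hz'.ne', one_smul]
  have e : secDiff k h z = ‖z‖ ^ ((1 : ℝ) - n) • secDiff k g w := by
    rw [← hk.secDiff_smul hz', ← h1, ← h2]
  rw [e, norm_smul, Real.norm_of_nonneg (by positivity)]
  have h3 := key w g hw1 hg2
  have e4 : ‖z‖ ^ (-(n : ℝ) - 1) = ‖z‖ ^ ((1 : ℝ) - n) * (‖z‖⁻¹) ^ 2 := by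
    rw [← Real.rpow_natCast, ← Real.rpow_neg_one, ← Real.rpow_mul hz'.le, ← Real.rpow_add hz']
    congr 1; push_cast; ring
  rw [e4]
  calc ‖z‖ ^ ((1 : ℝ) - n) * ‖secDiff k g w‖ ≤ ‖z‖ ^ ((1 : ℝ) - n) * (max (2 * M) 1 * ‖g‖ ^ 2) := by
        gcongr
        exact h3.trans (by gcongr; exact le_max_left _ _)
    _ = _ := by rw [hg1]; ring

end IsHomKernel

end

section

namespace IsHomKernel

variable {n : ℕ} {k : Euc n → Euc n}

theorem integrableOn_ball (hk : IsHomKernel k) (R : ℝ) : IntegrableOn k (ball 0 R) := by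
  obtain ⟨C, -, hC⟩ := hk.exists_norm_le
  have hfr : Module.finrank ℝ (Euc n) = n := by simp
  refine integrableOn_ball_of_norm_le_rpow (α := (n : ℝ) - 1) (C := C) (by rw [hfr]; exact hk.pos)
    (by rw [hfr]; linarith) (Filter.Eventually.of_forall fun x => ?_)
    hk.measurable.aestronglyMeasurable
  rw [neg_sub]; exact hC x

theorem integral_ball_norm (hk : IsHomKernel k) {R : ℝ} (hR : 0 < R) :
    ∫ z in ball (0 : Euc n) R, ‖k z‖ = R * ∫ z in ball (0 : Euc n) 1, ‖k z‖ := by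
  have h1 := Measure.setIntegral_comp_smul_of_pos (volume : Measure (Euc n)) (fun z => ‖k z‖)
    (ball 0 1) hR
  have e : ∀ z, ‖k (R • z)‖ = R ^ ((1 : ℝ) - n) * ‖k z‖ := fun z => by
    rw [hk.map_smul hR, norm_smul, Real.norm_of_nonneg (by positivity)]
  simp only [e, MeasureTheory.integral_const_mul, smul_unitBall_of_pos hR, finrank_euclideanSpace,
    Fintype.card_fin, smul_eq_mul] at h1
  have h2 : R ^ n * (R ^ n)⁻¹ = 1 := mul_inv_cancel₀ (by positivity)
  have h3 : R ^ n * R ^ ((1 : ℝ) - n) = R := by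
    rw [← Real.rpow_natCast, ← Real.rpow_add hR]; simp
  calc ∫ z in ball (0 : Euc n) R, ‖k z‖ = (R ^ n * (R ^ n)⁻¹) * ∫ z in ball (0 : Euc n) R, ‖k z‖ := by
        rw [h2, one_mul]
    _ = R ^ n * R ^ ((1 : ℝ) - n) * ∫ z in ball (0 : Euc n) 1, ‖k z‖ := by
        rw [mul_assoc, ← h1]; ring
    _ = _ := by rw [h3]

/-- the kernel is integrable on every ball, with mass controlled by the radius alone -/
theorem exists_integral_closedBall_le (hk : IsHomKernel k) :
    ∃ C : ℝ, 0 < C ∧ ∀ (x c : Euc n) (R : ℝ), 0 < R →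
      IntegrableOn (fun y => k (x - y)) (closedBall c R) ∧
      ∫ y in closedBall c R, ‖k (x - y)‖ ≤ C * R := by
  obtain ⟨C, hC0, hC⟩ := hk.exists_norm_le
  set J := ∫ z in ball (0 : Euc n) 1, ‖k z‖ with hJ
  have hJ0 : 0 ≤ J := by positivity
  set m := (volume : Measure (Euc n)).real (ball 0 1) with hm
  refine ⟨J + C * m + 1, by positivity, fun x c R hR => ?_⟩
  set g : Euc n → ℝ := (ball (0 : Euc n) R).indicator (fun z => ‖k z‖) with hg
  have hgi : Integrable g := IntegrableOn.integrable_indicator (hk.integrableOn_ball R).norm measurableSet_ball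
  have hgx : Integrable (fun y => g (x - y)) := hgi.comp_sub_left x
  have hpt : ∀ y, ‖k (x - y)‖ ≤ g (x - y) + C * R ^ ((1 : ℝ) - n) := by
    intro y
    by_cases hy : x - y ∈ ball (0 : Euc n) R
    · rw [hg, indicator_of_mem hy]
      have : 0 ≤ C * R ^ ((1 : ℝ) - n) := by positivity
      linarith
    · rw [hg, indicator_of_notMem hy, zero_add]
      refine (hC _).trans ?_
      have hy' : R ≤ ‖x - y‖ := by simpa using hy
      have hn : ((1 : ℝ) - n) ≤ 0 := by
        have : (1 : ℝ) ≤ n := by exact_mod_cast hk.pos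
        linarith
      gcongr C * ?_
      exact Real.rpow_le_rpow_of_nonpos hR hy' hn
  have hdom : IntegrableOn (fun y => g (x - y) + C * R ^ ((1 : ℝ) - n)) (closedBall c R) :=
    hgx.integrableOn.add (integrableOn_const (by exact measure_closedBall_lt_top.ne))
  have hinte : IntegrableOn (fun y => k (x - y)) (closedBall c R) :=
    hdom.mono' (hk.measurable.comp (measurable_const.sub measurable_id)).aestronglyMeasurable
      (Filter.Eventually.of_forall hpt)
  refine ⟨hinte, ?_⟩
  have h3 : R ^ n * R ^ ((1 : ℝ) - n) = R := by
    rw [← Real.rpow_natCast, ← Real.rpow_add hR]; simp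
  have hvol : (volume : Measure (Euc n)).real (closedBall c R) = R ^ n * m := by
    rw [measureReal_def, Measure.addHaar_closedBall _ _ hR.le, ENNReal.toReal_mul,
      ENNReal.toReal_ofReal (by positivity), finrank_euclideanSpace, Fintype.card_fin]
    rfl
  calc ∫ y in closedBall c R, ‖k (x - y)‖
      ≤ ∫ y in closedBall c R, (g (x - y) + C * R ^ ((1 : ℝ) - n)) :=
        MeasureTheory.integral_mono hinte.norm hdom hpt
    _ = (∫ y in closedBall c R, g (x - y)) + (R ^ n * m) * (C * R ^ ((1 : ℝ) - n)) := by
        rw [MeasureTheory.integral_add hgx.integrableOn (integrableOn_const (by exact measure_closedBall_lt_top.ne)),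
          setIntegral_const, hvol, smul_eq_mul]
    _ ≤ (∫ y, g (x - y)) + (R ^ n * m) * (C * R ^ ((1 : ℝ) - n)) := by
        gcongr
        · exact Filter.Eventually.of_forall fun y => indicator_nonneg (fun _ _ => norm_nonneg _) _
        · exact Measure.restrict_le_self
    _ = R * J + R * m * C := by
        rw [integral_sub_left_eq_self (fun z => g z) volume x, hg,
          MeasureTheory.integral_indicator measurableSet_ball, hk.integral_ball_norm hR]
        have : R ^ n * m * (C * R ^ ((1 : ℝ) - n)) = (R ^ n * R ^ ((1 : ℝ) - n)) * m * C := by ring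
        rw [this, h3]
    _ ≤ (J + C * m + 1) * R := by nlinarith

theorem measurable_secDiff (hk : IsHomKernel k) (h : Euc n) : Measurable (secDiff k h) := by
  have := hk.measurable
  unfold secDiff
  fun_prop

/-- second differences of the kernel are integrable, with the natural scaling in the step -/
theorem exists_integral_secDiff_le (hk : IsHomKernel k) {γ : ℝ} (h0 : 0 ≤ γ) (h1 : γ < 1) :
    ∃ C : ℝ, 0 < C ∧ ∀ h : Euc n,
      Integrable (fun z => ‖z‖ ^ γ * ‖secDiff k h z‖) ∧
      ∫ z, ‖z‖ ^ γ * ‖secDiff k h z‖ ≤ C * ‖h‖ ^ (1 + γ) := by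
  obtain ⟨C2, hC20, hC2⟩ := hk.exists_norm_secDiff_le
  set g : Euc n → ℝ := (ball (0 : Euc n) 3).indicator (fun z => ‖k z‖) with hg
  have hg0 : ∀ z, 0 ≤ g z := fun z => indicator_nonneg (fun _ _ => norm_nonneg _) _
  have hgi : Integrable g := IntegrableOn.integrable_indicator (hk.integrableOn_ball 3).norm measurableSet_ball
  set p : ℝ := n + 1 - γ with hp
  have hJ : Integrable (fun z : Euc n => (1 + ‖z‖) ^ (-p)) :=
    integrable_one_add_norm (by rw [finrank_euclideanSpace, Fintype.card_fin]; linarith)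
  set K : ℝ := C2 * 2 ^ p with hK
  have hK0 : 0 < K := by positivity
  -- unit steps
  have hunit : ∀ h : Euc n, ‖h‖ = 1 → Integrable (fun z => ‖z‖ ^ γ * ‖secDiff k h z‖) ∧
      ∫ z, ‖z‖ ^ γ * ‖secDiff k h z‖ ≤ 2 ^ γ * (4 * ∫ z, g z) + K * ∫ z : Euc n, (1 + ‖z‖) ^ (-p) := by
    intro h hh
    have hi1 : Integrable (fun z => g (z + h)) := hgi.comp_add_right h
    have hi2 : Integrable (fun z => g (z - h)) := hgi.comp_sub_right h
    have hi12 : Integrable (fun z => g (z + h) + g (z - h)) := hi1.add hi2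
    have hi3 : Integrable (fun z => g (z + h) + g (z - h) + 2 * g z) :=
      hi12.add (hgi.const_mul 2)
    have hi : Integrable (fun z => 2 ^ γ * (g (z + h) + g (z - h) + 2 * g z) + K * (1 + ‖z‖) ^ (-p)) :=
      (hi3.const_mul _).add (hJ.const_mul _)
    have hpt : ∀ z, ‖z‖ ^ γ * ‖secDiff k h z‖ ≤
        2 ^ γ * (g (z + h) + g (z - h) + 2 * g z) + K * (1 + ‖z‖) ^ (-p) := by
      intro z
      rcases lt_or_ge ‖z‖ 2 with hz | hz
      · have a1 : g (z + h) = ‖k (z + h)‖ := indicator_of_mem (by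
          rw [mem_ball_zero_iff]; linarith [norm_add_le z h]) _
        have a2 : g (z - h) = ‖k (z - h)‖ := indicator_of_mem (by
          rw [mem_ball_zero_iff]; linarith [norm_sub_le z h]) _
        have a3 : g z = ‖k z‖ := indicator_of_mem (by
          rw [mem_ball_zero_iff]; linarith) _
        have a4 : ‖secDiff k h z‖ ≤ ‖k (z + h)‖ + ‖k (z - h)‖ + 2 * ‖k z‖ := by
          unfold secDiff
          refine (norm_sub_le _ _).trans ?_
          rw [norm_smul, Real.norm_ofNat]
          gcongr
          exact norm_add_le _ _
        have a5 : 0 ≤ K * (1 + ‖z‖) ^ (-p) := by positivity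
        rw [a1, a2, a3]
        have : ‖z‖ ^ γ * ‖secDiff k h z‖ ≤ 2 ^ γ * (‖k (z + h)‖ + ‖k (z - h)‖ + 2 * ‖k z‖) := by
          gcongr
        linarith
      · have hz0 : 0 < ‖z‖ := by linarith
        have b1 := hC2 z h (norm_pos_iff.1 hz0) (by linarith)
        rw [hh, one_pow, one_mul] at b1
        have b2 : 0 ≤ 2 ^ γ * (g (z + h) + g (z - h) + 2 * g z) := by
          have := hg0 (z + h); have := hg0 (z - h); have := hg0 z
          positivity
        have b3 : ‖z‖ ^ (-p) ≤ 2 ^ p * (1 + ‖z‖) ^ (-p) := by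
          have e : (2 : ℝ) ^ p * (1 + ‖z‖) ^ (-p) = ((1 + ‖z‖) / 2) ^ (-p) := by
            rw [Real.div_rpow (by positivity) (by norm_num), Real.rpow_neg (by norm_num : (0:ℝ) ≤ 2)]
            field_simp
          rw [e]
          refine Real.rpow_le_rpow_of_nonpos (by positivity) (by linarith) ?_
          have : (0 : ℝ) ≤ n := by positivity
          linarith
        have b4 : ‖z‖ ^ γ * ‖z‖ ^ (-(n : ℝ) - 1) = ‖z‖ ^ (-p) := by
          rw [← Real.rpow_add hz0]; congr 1; rw [hp]; ring
        calc ‖z‖ ^ γ * ‖secDiff k h z‖ ≤ ‖z‖ ^ γ * (C2 * ‖z‖ ^ (-(n : ℝ) - 1)) := by gcongr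
          _ = C2 * ‖z‖ ^ (-p) := by rw [← b4]; ring
          _ ≤ C2 * (2 ^ p * (1 + ‖z‖) ^ (-p)) := by gcongr
          _ = K * (1 + ‖z‖) ^ (-p) := by rw [hK]; ring
          _ ≤ _ := by linarith
    have hinte : Integrable (fun z => ‖z‖ ^ γ * ‖secDiff k h z‖) := by
      refine hi.mono' ?_ (Filter.Eventually.of_forall fun z => ?_)
      · have := hk.measurable_secDiff h
        exact Measurable.aestronglyMeasurable (by fun_prop)
      · rw [Real.norm_of_nonneg (by positivity)]; exact hpt z
    refine ⟨hinte, (MeasureTheory.integral_mono hinte hi hpt).trans (le_of_eq ?_)⟩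
    rw [MeasureTheory.integral_add (hi3.const_mul _) (hJ.const_mul _), MeasureTheory.integral_const_mul, MeasureTheory.integral_const_mul,
      MeasureTheory.integral_add hi12 (hgi.const_mul 2), MeasureTheory.integral_add hi1 hi2, MeasureTheory.integral_const_mul,
      integral_add_right_eq_self g h, integral_sub_right_eq_self g h]
    ring
  set C := 2 ^ γ * (4 * ∫ z, g z) + K * ∫ z : Euc n, (1 + ‖z‖) ^ (-p) with hCdef
  have hC : 0 ≤ C := by
    have e1 : 0 ≤ ∫ z, g z := integral_nonneg hg0
    have e2 : 0 ≤ ∫ z : Euc n, (1 + ‖z‖) ^ (-p) := integral_nonneg fun z => by positivity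
    positivity
  refine ⟨C + 1, by positivity, fun h => ?_⟩
  rcases eq_or_ne h 0 with rfl | hh
  · have : ∀ z, secDiff k 0 z = 0 := fun z => by simp [secDiff, two_smul]
    simp [this]
    positivity
  have hh0 : 0 < ‖h‖ := norm_pos_iff.2 hh
  set r := ‖h‖ with hr
  set u := r⁻¹ • h with hu
  have hu1 : ‖u‖ = 1 := by rw [hu, norm_smul, norm_inv, norm_norm, ← hr, inv_mul_cancel₀ hh0.ne']
  have hhu : h = r • u := by rw [hu, smul_smul, mul_inv_cancel₀ hh0.ne', one_smul]
  obtain ⟨hi, hle⟩ := hunit u hu1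
  have hs : ∀ z, ‖r • z‖ ^ γ * ‖secDiff k h (r • z)‖
      = (r ^ γ * r ^ ((1 : ℝ) - n)) * (‖z‖ ^ γ * ‖secDiff k u z‖) := by
    intro z
    conv_lhs => rw [hhu, hk.secDiff_smul hh0]
    rw [norm_smul, norm_smul, Real.norm_of_nonneg hh0.le, Real.norm_of_nonneg (by positivity),
      Real.mul_rpow hh0.le (norm_nonneg _)]
    ring
  constructor
  · rw [← integrable_comp_smul_iff volume _ hh0.ne']
    simp only [hs]
    exact hi.const_mul _
  · have h2 := Measure.integral_comp_smul_of_nonneg (volume : Measure (Euc n))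
      (fun z => ‖z‖ ^ γ * ‖secDiff k h z‖) r (hR := hh0.le)
    simp only [hs, MeasureTheory.integral_const_mul, finrank_euclideanSpace, Fintype.card_fin, smul_eq_mul] at h2
    have h3 : r ^ n * (r ^ n)⁻¹ = 1 := mul_inv_cancel₀ (by positivity)
    have h4 : r ^ n * (r ^ γ * r ^ ((1 : ℝ) - n)) = r ^ (1 + γ) := by
      rw [← Real.rpow_natCast, ← Real.rpow_add hh0, ← Real.rpow_add hh0]; congr 1; ring
    calc ∫ z, ‖z‖ ^ γ * ‖secDiff k h z‖ = r ^ n * ((r ^ n)⁻¹ * ∫ z, ‖z‖ ^ γ * ‖secDiff k h z‖) := by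
          rw [← mul_assoc, h3, one_mul]
      _ = r ^ (1 + γ) * ∫ z, ‖z‖ ^ γ * ‖secDiff k u z‖ := by rw [← h2, ← h4]; ring
      _ ≤ r ^ (1 + γ) * (C + 1) := by gcongr; linarith
      _ = _ := mul_comm _ _

theorem integrable_secDiff (hk : IsHomKernel k) (h : Euc n) : Integrable (secDiff k h) := by
  obtain ⟨C, -, hC⟩ := hk.exists_integral_secDiff_le le_rfl zero_lt_one
  have := (hC h).1
  simp only [Real.rpow_zero, one_mul] at this
  exact (integrable_norm_iff (hk.measurable_secDiff h).aestronglyMeasurable).1 this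

theorem integral_secDiff (hk : IsHomKernel k) (h : Euc n) : ∫ z, secDiff k h z = 0 := by
  have e1 : ∫ z, secDiff k ((2 : ℝ) • h) z = (2 : ℝ) • ∫ z, secDiff k h z := by
    have h2 := Measure.integral_comp_smul_of_nonneg (volume : Measure (Euc n))
      (secDiff k ((2 : ℝ) • h)) 2 (hR := zero_le_two)
    simp only [hk.secDiff_smul (zero_lt_two (α := ℝ)), MeasureTheory.integral_smul, finrank_euclideanSpace,
      Fintype.card_fin] at h2
    have h3 : (2 : ℝ) ^ n * (2 ^ n)⁻¹ = 1 := mul_inv_cancel₀ (by positivity)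
    have h4 : (2 : ℝ) ^ n * (2 : ℝ) ^ ((1 : ℝ) - n) = 2 := by
      rw [← Real.rpow_natCast, ← Real.rpow_add two_pos]; simp
    have h5 := congrArg (fun w => (2 : ℝ) ^ n • w) h2
    simp only [smul_smul, h3, h4, one_smul] at h5
    exact h5.symm
  have e2 : ∫ z, secDiff k ((2 : ℝ) • h) z = (4 : ℝ) • ∫ z, secDiff k h z := by
    have i0 := hk.integrable_secDiff h
    have i1 := i0.comp_add_right h
    have i2 := i0.comp_sub_right h
    have e : ∀ z, secDiff k ((2 : ℝ) • h) z
        = secDiff k h (z + h) + secDiff k h (z - h) + (2 : ℝ) • secDiff k h z := by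
      intro z
      unfold secDiff
      rw [two_smul ℝ h, add_assoc z h h, add_sub_cancel_right, sub_add_cancel, sub_sub z h h]
      module
    simp only [e]
    have i3 := MeasureTheory.integral_add (i1.add i2) (i0.smul (2 : ℝ))
    simp only [Pi.add_apply, Pi.smul_apply] at i3
    rw [i3, MeasureTheory.integral_add i1 i2, integral_add_right_eq_self (secDiff k h) h,
      integral_sub_right_eq_self (secDiff k h) h, MeasureTheory.integral_smul]
    module
  rw [e1] at e2
  have : (2 : ℝ) • ∫ z, secDiff k h z = 0 := by
    have := sub_eq_zero.2 e2.symm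
    rwa [← sub_smul, show (4 : ℝ) - 2 = 2 by norm_num] at this
  simpa using this

end IsHomKernel

end

section

/-- truncation of `a` at height `2 |d|`, with the sign of `d` -/
def signedClamp (a d : ℝ) : ℝ :=
  if 0 ≤ d then max (-(2 * d)) (min a (2 * d)) else -max (2 * d) (min a (-(2 * d)))

theorem abs_signedClamp_le (a d : ℝ) : |signedClamp a d| ≤ 2 * |d| := by
  unfold signedClamp
  rw [abs_le]
  split_ifs with h
  · rw [abs_of_nonneg h]; grind
  · rw [abs_of_neg (not_le.1 h)]; grind

theorem signedClamp_sub_le (a d d' : ℝ) : signedClamp a d - signedClamp a d' ≤ 2 * |d - d'| := by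
  unfold signedClamp
  rcases abs_cases (d - d') with ⟨h, _⟩ | ⟨h, _⟩ <;> rw [h] <;> split_ifs <;> grind

theorem indicator_le_signedClamp_sub (a d : ℝ) :
    (if |a| < |d| then |d| else 0) ≤ signedClamp (a + d) d - signedClamp a d := by
  unfold signedClamp
  rcases abs_cases a with ⟨h, _⟩ | ⟨h, _⟩ <;> rcases abs_cases d with ⟨h', _⟩ | ⟨h', _⟩ <;>
    rw [h, h'] <;> split_ifs <;> grind

theorem measurable_signedClamp : Measurable fun p : ℝ × ℝ => signedClamp p.1 p.2 := by
  unfold signedClamp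
  refine Measurable.ite (measurableSet_le measurable_const measurable_snd) ?_ ?_ <;> fun_prop

/-- a real function with the integrability properties of a component of a homogeneous kernel -/
structure IsKernelLike {n : ℕ} (f : Euc n → ℝ) (C : ℝ) : Prop where
  meas : Measurable f
  nonneg : 0 ≤ C
  integrableOn : ∀ (c : Euc n) (R : ℝ), 0 < R → IntegrableOn f (closedBall c R)
  integral_le : ∀ (c : Euc n) (R : ℝ), 0 < R → ∫ y in closedBall c R, |f y| ≤ C * R
  integrable_secDiff : ∀ h : Euc n, Integrable (secDiff f h)
  integral_secDiff_le : ∀ h : Euc n, ∫ z, |secDiff f h z| ≤ C * ‖h‖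

namespace IsKernelLike

variable {n : ℕ} {f : Euc n → ℝ} {C : ℝ}

/-- the part of an increment of `f` which dominates `f` itself -/
def largeIncr (f : Euc n → ℝ) (h y : Euc n) : ℝ :=
  if |f y| < |f (y + h) - f y| then |f (y + h) - f y| else 0

theorem largeIncr_nonneg (f : Euc n → ℝ) (h y : Euc n) : 0 ≤ largeIncr f h y := by
  unfold largeIncr; split_ifs <;> positivity

theorem measurable_largeIncr (hf : IsKernelLike f C) (h : Euc n) : Measurable (largeIncr f h) := by
  have := hf.meas
  unfold largeIncr
  exact Measurable.ite (measurableSet_lt (by fun_prop) (by fun_prop)) (by fun_prop) (by fun_prop)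

theorem integral_cutoff_le (hf : IsKernelLike f C) (h : Euc n) {R : ℝ} (hR : 0 < R)
    (hhR : ‖h‖ ≤ R) :
    Integrable (fun y => max 0 (1 - ‖y‖ / R) * largeIncr f h y) ∧
    ∫ y, max 0 (1 - ‖y‖ / R) * largeIncr f h y ≤ 12 * C * ‖h‖ := by
  have hfm := hf.meas
  set δ : Euc n → ℝ := fun y => f (y + h) - f y with hδ
  set Ψ : Euc n → ℝ := fun y => signedClamp (f y) (δ y) with hΨ
  set χ : Euc n → ℝ := fun y => max 0 (1 - ‖y‖ / R) with hχ
  have hδm : Measurable δ := by fun_prop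
  have hΨm : Measurable Ψ := measurable_signedClamp.comp (hfm.prodMk hδm)
  have hχm : Measurable χ := by fun_prop
  have hχ0 : ∀ y, 0 ≤ χ y := fun y => le_max_left _ _
  have hχ1 : ∀ y, χ y ≤ 1 := fun y => max_le zero_le_one (by
    have : 0 ≤ ‖y‖ / R := by positivity
    linarith)
  have hχs : ∀ y, R ≤ ‖y‖ → χ y = 0 := fun y hy => max_eq_left (by
    have : 1 ≤ ‖y‖ / R := by rwa [one_le_div hR]
    linarith)
  set B : Set (Euc n) := closedBall 0 (2 * R) with hB
  have hBm : MeasurableSet B := measurableSet_closedBall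
  have hnB : ∀ y, y ∉ B → 2 * R < ‖y‖ := fun y hy => by simpa [hB] using hy
  have hδi : IntegrableOn δ B := by
    refine IntegrableOn.sub ?_ (hf.integrableOn 0 _ (by positivity))
    have := (hf.integrableOn (0 + h) (2 * R) (by positivity))
    have e : (fun y => y + h) ⁻¹' closedBall (0 + h) (2 * R) = B := by
      ext y; simp [hB, dist_eq_norm]
    rw [← e]
    exact (measurePreserving_add_right volume h).integrableOn_comp_preimage
      (measurableEmbedding_addRight h) |>.2 this
  have hδle : ∫ y in B, |δ y| ≤ 4 * C * R := by
    have i1 : IntegrableOn (fun y => f (y + h)) B := by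
      have := hδi.add (hf.integrableOn 0 (2 * R) (by positivity))
      refine this.congr (Filter.Eventually.of_forall fun y => ?_)
      simp [hδ]
    have i2 := hf.integrableOn 0 (2 * R) (by positivity)
    calc ∫ y in B, |δ y| ≤ ∫ y in B, (|f (y + h)| + |f y|) :=
          MeasureTheory.integral_mono hδi.abs (i1.abs.add i2.abs) fun y => abs_sub _ _
      _ = (∫ y in B, |f (y + h)|) + ∫ y in B, |f y| := MeasureTheory.integral_add i1.abs i2.abs
      _ = (∫ y in closedBall (0 + h) (2 * R), |f y|) + ∫ y in B, |f y| := by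
          congr 1
          have e : (fun y => y + h) ⁻¹' closedBall (0 + h) (2 * R) = B := by
            ext y; simp [hB, dist_eq_norm]
          rw [← e]
          exact (measurePreserving_add_right volume h).setIntegral_preimage_emb
            (measurableEmbedding_addRight h) (fun y => |f y|) _
      _ ≤ C * (2 * R) + C * (2 * R) := add_le_add (hf.integral_le _ _ (by positivity))
          (hf.integral_le _ _ (by positivity))
      _ = _ := by ring
  have hΨle : ∀ y, |Ψ y| ≤ 2 * |δ y| := fun y => abs_signedClamp_le _ _
  -- integrability of products with functions supported in `B`
  have hprod : ∀ η : Euc n → ℝ, Measurable η → (∀ y, |η y| ≤ 1) → (∀ y, y ∉ B → η y = 0) →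
      Integrable (fun y => η y * Ψ y) := by
    intro η hηm hη1 hηB
    have : Integrable (B.indicator fun y => 2 * |δ y|) :=
      IntegrableOn.integrable_indicator (hδi.abs.const_mul 2) hBm
    refine this.mono' (hηm.mul hΨm).aestronglyMeasurable (Filter.Eventually.of_forall fun y => ?_)
    by_cases hy : y ∈ B
    · rw [indicator_of_mem hy, norm_mul, Real.norm_eq_abs, Real.norm_eq_abs]
      calc |η y| * |Ψ y| ≤ 1 * (2 * |δ y|) := by gcongr; exacts [hη1 y, hΨle y]
        _ = _ := one_mul _
    · rw [indicator_of_notMem hy, hηB y hy]; simp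
  have hχB : ∀ y, y ∉ B → χ y = 0 := fun y hy => hχs y (by linarith [hnB y hy])
  have hχB' : ∀ y, y ∉ B → χ (y - h) = 0 := fun y hy => hχs _ (by
    linarith [hnB y hy, norm_sub_norm_le y h])
  have iΨ : Integrable fun y => χ y * Ψ y :=
    hprod χ hχm (fun y => by rw [abs_of_nonneg (hχ0 y)]; exact hχ1 y) hχB
  have iΨ' : Integrable fun y => χ (y - h) * Ψ y :=
    hprod (fun y => χ (y - h)) (by fun_prop)
      (fun y => by rw [abs_of_nonneg (hχ0 _)]; exact hχ1 _) hχB'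
  have iΨ'' : Integrable fun y => χ y * Ψ (y + h) := by
    have := iΨ'.comp_add_right h
    simpa using this
  have isd : Integrable fun y => 2 * |secDiff f h (y + h)| :=
    ((hf.integrable_secDiff h).comp_add_right h).abs.const_mul 2
  have hpt : ∀ y, χ y * largeIncr f h y ≤
      χ y * Ψ (y + h) - χ y * Ψ y + 2 * |secDiff f h (y + h)| := by
    intro y
    have e1 := indicator_le_signedClamp_sub (f y) (δ y)
    have e2 := signedClamp_sub_le (f (y + h)) (δ y) (δ (y + h))
    have e3 : f y + δ y = f (y + h) := by simp [hδ]
    have e4 : |δ y - δ (y + h)| = |secDiff f h (y + h)| := by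
      rw [abs_sub_comm]; congr 1; simp only [hδ, secDiff, add_sub_cancel_right, smul_eq_mul]; ring
    rw [e3] at e1
    rw [e4] at e2
    have e5 : largeIncr f h y ≤ Ψ (y + h) - Ψ y + 2 * |secDiff f h (y + h)| := by
      show (if |f y| < |δ y| then |δ y| else 0) ≤ _
      simp only [hΨ]; linarith
    have e6 := mul_le_mul_of_nonneg_left e5 (hχ0 y)
    have e7 : χ y * (2 * |secDiff f h (y + h)|) ≤ 2 * |secDiff f h (y + h)| :=
      mul_le_of_le_one_left (by positivity) (hχ1 y)
    nlinarith
  have iR : Integrable fun y => χ y * Ψ (y + h) - χ y * Ψ y + 2 * |secDiff f h (y + h)| :=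
    (iΨ''.sub iΨ).add isd
  have iL : Integrable fun y => χ y * largeIncr f h y := by
    refine iR.mono' (hχm.mul (hf.measurable_largeIncr h)).aestronglyMeasurable
      (Filter.Eventually.of_forall fun y => ?_)
    rw [Real.norm_of_nonneg (mul_nonneg (hχ0 y) (largeIncr_nonneg f h y))]
    exact hpt y
  refine ⟨iL, ?_⟩
  have hχlip : ∀ y, |χ (y - h) - χ y| ≤ ‖h‖ / R := by
    intro y
    refine (abs_max_sub_max_le_max _ _ _ _).trans (max_le (by simp; positivity) ?_)
    have : 1 - ‖y - h‖ / R - (1 - ‖y‖ / R) = (‖y‖ - ‖y - h‖) / R := by ring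
    rw [this, abs_div, abs_of_pos hR]
    gcongr
    have := abs_norm_sub_norm_le y (y - h)
    simpa using this
  have iM : Integrable fun y => χ y * Ψ (y + h) - χ y * Ψ y := iΨ''.sub iΨ
  have hmain : ∫ y, (χ y * Ψ (y + h) - χ y * Ψ y) ≤ 8 * C * ‖h‖ := by
    have e1 : ∫ y, χ y * Ψ (y + h) = ∫ y, χ (y - h) * Ψ y := by
      rw [← integral_add_right_eq_self (fun y => χ (y - h) * Ψ y) h]
      simp
    rw [MeasureTheory.integral_sub iΨ'' iΨ, e1, ← MeasureTheory.integral_sub iΨ' iΨ]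
    have hid : Integrable (B.indicator fun y => ‖h‖ / R * (2 * |δ y|)) :=
      IntegrableOn.integrable_indicator ((hδi.abs.const_mul 2).const_mul _) hBm
    calc ∫ y, (χ (y - h) * Ψ y - χ y * Ψ y)
        ≤ ∫ y, B.indicator (fun y => ‖h‖ / R * (2 * |δ y|)) y := by
          refine MeasureTheory.integral_mono (iΨ'.sub iΨ) hid fun y => ?_
          by_cases hy : y ∈ B
          · rw [indicator_of_mem hy]
            calc χ (y - h) * Ψ y - χ y * Ψ y = (χ (y - h) - χ y) * Ψ y := by ring
              _ ≤ |(χ (y - h) - χ y) * Ψ y| := le_abs_self _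
              _ = |χ (y - h) - χ y| * |Ψ y| := abs_mul _ _
              _ ≤ _ := by gcongr; exacts [hχlip y, hΨle y]
          · rw [indicator_of_notMem hy, hχB y hy, hχB' y hy]; simp
      _ = ‖h‖ / R * (2 * ∫ y in B, |δ y|) := by
          rw [MeasureTheory.integral_indicator hBm, MeasureTheory.integral_const_mul,
            MeasureTheory.integral_const_mul]
      _ ≤ ‖h‖ / R * (2 * (4 * C * R)) := by gcongr
      _ = _ := by field_simp; ring
  calc ∫ y, χ y * largeIncr f h y
      ≤ ∫ y, (χ y * Ψ (y + h) - χ y * Ψ y + 2 * |secDiff f h (y + h)|) :=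
        MeasureTheory.integral_mono iL iR hpt
    _ = (∫ y, (χ y * Ψ (y + h) - χ y * Ψ y)) + 2 * ∫ y, |secDiff f h y| := by
        rw [MeasureTheory.integral_add iM isd, MeasureTheory.integral_const_mul,
          integral_add_right_eq_self (fun y => |secDiff f h y|) h]
    _ ≤ 8 * C * ‖h‖ + 2 * (C * ‖h‖) := by gcongr; exact hf.integral_secDiff_le h
    _ ≤ 12 * C * ‖h‖ := by
        have := mul_nonneg hf.nonneg (norm_nonneg h); linarith

theorem integral_largeIncr_le (hf : IsKernelLike f C) (h : Euc n) :
    Integrable (largeIncr f h) ∧ ∫ y, largeIncr f h y ≤ 24 * C * ‖h‖ := by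
  have hcov : AECover (volume : Measure (Euc n)) Filter.atTop (fun i : ℕ => closedBall (0 : Euc n) i) :=
    aecover_closedBall tendsto_natCast_atTop_atTop
  set R : ℕ → ℝ := fun i => 2 * (i + ‖h‖ + 1) with hRdef
  have hR0 : ∀ i, 0 < R i := fun i => by positivity
  have hRh : ∀ i, ‖h‖ ≤ R i := fun i => by
    have : 0 ≤ ‖h‖ := norm_nonneg _
    have : (0 : ℝ) ≤ i := by positivity
    simp only [hRdef]; linarith
  have hpt : ∀ (i : ℕ), ∀ y ∈ closedBall (0 : Euc n) i,
      largeIncr f h y ≤ 2 * (max 0 (1 - ‖y‖ / R i) * largeIncr f h y) := by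
    intro i y hy
    have hy' : ‖y‖ ≤ i := by simpa using hy
    have e1 : ‖y‖ / R i ≤ 1 / 2 := by
      rw [div_le_iff₀ (hR0 i)]
      have : 0 ≤ ‖h‖ := norm_nonneg _
      simp only [hRdef]; linarith
    have e2 : 1 / 2 ≤ max 0 (1 - ‖y‖ / R i) := le_max_of_le_right (by linarith)
    have := mul_le_mul_of_nonneg_right e2 (largeIncr_nonneg f h y)
    linarith
  have hion : ∀ i : ℕ, IntegrableOn (largeIncr f h) (closedBall (0 : Euc n) i) := fun i => by
    refine (((hf.integral_cutoff_le h (hR0 i) (hRh i)).1.const_mul 2).integrableOn (s := closedBall 0 i)).mono'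
      (hf.measurable_largeIncr h).aestronglyMeasurable ?_
    refine (ae_restrict_iff' measurableSet_closedBall).2 (Filter.Eventually.of_forall fun y hy => ?_)
    rw [Real.norm_of_nonneg (largeIncr_nonneg f h y)]
    exact hpt i y hy
  have hb : ∀ i : ℕ, ∫ y in closedBall (0 : Euc n) i, largeIncr f h y ≤ 24 * C * ‖h‖ := fun i => by
    obtain ⟨h1, h2⟩ := hf.integral_cutoff_le h (hR0 i) (hRh i)
    calc ∫ y in closedBall (0 : Euc n) i, largeIncr f h y
        ≤ ∫ y in closedBall (0 : Euc n) i, 2 * (max 0 (1 - ‖y‖ / R i) * largeIncr f h y) :=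
          setIntegral_mono_on (hion i) (h1.const_mul 2).integrableOn measurableSet_closedBall (hpt i)
      _ ≤ ∫ y, 2 * (max 0 (1 - ‖y‖ / R i) * largeIncr f h y) :=
          setIntegral_le_integral (h1.const_mul 2) (Filter.Eventually.of_forall fun y =>
            mul_nonneg zero_le_two (mul_nonneg (le_max_left _ _) (largeIncr_nonneg f h y)))
      _ ≤ _ := by rw [MeasureTheory.integral_const_mul]; linarith
  have hinte : Integrable (largeIncr f h) := by
    refine hcov.integrable_of_integral_norm_bounded (24 * C * ‖h‖) hion
      (Filter.Eventually.of_forall fun i => ?_)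
    simp only [Real.norm_of_nonneg (largeIncr_nonneg f h _)]
    exact hb i
  exact ⟨hinte, le_of_tendsto' (hcov.integral_tendsto_of_countably_generated hinte) hb⟩

theorem abs_add_le_largeIncr (f : Euc n → ℝ) (h y : Euc n) :
    |f (y + h)| ≤ 2 * |f y| + largeIncr f h y := by
  unfold largeIncr
  have e : |f (y + h)| ≤ |f y| + |f (y + h) - f y| := by
    have := abs_add_le (f y) (f (y + h) - f y)
    simpa using this
  split_ifs with hc <;> [skip; push Not at hc] <;> linarith [abs_nonneg (f y)]

end IsKernelLike

namespace IsHomKernel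

variable {n : ℕ} {k : Euc n → Euc n}

theorem exists_isKernelLike (hk : IsHomKernel k) :
    ∃ C, ∀ i, IsKernelLike (fun y => k y i) C := by
  obtain ⟨C1, hC1, h1⟩ := hk.exists_integral_closedBall_le
  obtain ⟨C2, hC2, h2⟩ := hk.exists_integral_secDiff_le le_rfl zero_lt_one
  simp only [Real.rpow_zero, one_mul, add_zero, Real.rpow_one] at h2
  have hsd : ∀ i h z, secDiff (fun y => k y i) h z = secDiff k h z i := fun i h z => by
    simp [secDiff]
  have hion : ∀ (c : Euc n) (R : ℝ), 0 < R → IntegrableOn k (closedBall c R) ∧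
      ∫ y in closedBall c R, ‖k y‖ ≤ C1 * R := by
    intro c R hR
    have e : (fun y : Euc n => -y) ⁻¹' closedBall (-c) R = closedBall c R := by
      ext y; simp [dist_eq_norm, ← norm_neg (y - c)]
    obtain ⟨a, b⟩ := h1 0 (-c) R hR
    simp only [zero_sub] at a b
    have hmp := Measure.measurePreserving_neg (volume : Measure (Euc n))
    have hme : MeasurableEmbedding (fun y : Euc n => -y) := (MeasurableEquiv.neg _).measurableEmbedding
    constructor
    · have := (hmp.integrableOn_comp_preimage hme (f := fun y => k (-y)) (s := closedBall (-c) R)).2 a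
      rw [e] at this
      simpa [Function.comp_def] using this
    · have := hmp.setIntegral_preimage_emb hme (fun y => ‖k (-y)‖) (closedBall (-c) R)
      rw [e] at this
      simp only [neg_neg] at this
      rwa [this]
  have hcomp : ∀ (w : Euc n) i, |w i| ≤ ‖w‖ := fun w i => by
    simpa using PiLp.norm_apply_le w i
  refine ⟨max C1 C2, fun i => ?_⟩
  have hm : Measurable fun y => k y i := by
    have := hk.measurable; fun_prop
  have i1 : ∀ (c : Euc n) (R : ℝ), 0 < R → IntegrableOn (fun y => k y i) (closedBall c R) :=
    fun c R hR => (hion c R hR).1.norm.mono' hm.aestronglyMeasurable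
      (Filter.Eventually.of_forall fun y => hcomp _ i)
  have i2 : ∀ h, Integrable (secDiff (fun y => k y i) h) := fun h => by
    refine (h2 h).1.mono' ?_ (Filter.Eventually.of_forall fun y => ?_)
    · have := hk.measurable_secDiff h
      simp only [funext (hsd i h)]
      exact Measurable.aestronglyMeasurable (by fun_prop)
    · rw [hsd]; exact hcomp _ i
  refine ⟨hm, by positivity, i1, fun c R hR => ?_, i2, fun h => ?_⟩
  · refine ((MeasureTheory.integral_mono (i1 c R hR).abs (hion c R hR).1.norm
      fun y => hcomp _ i).trans (hion c R hR).2).trans ?_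
    gcongr; exact le_max_left _ _
  · refine ((MeasureTheory.integral_mono (i2 h).abs (h2 h).1 fun y => ?_).trans (h2 h).2).trans ?_
    · simp only [hsd]; exact hcomp _ i
    · gcongr; exact le_max_right _ _

/-- translating the kernel costs a bounded factor and an integrable error -/
theorem exists_norm_add_le (hk : IsHomKernel k) :
    ∃ C : ℝ, 0 < C ∧ ∀ h : Euc n, ∃ φ : Euc n → ℝ, (∀ z, 0 ≤ φ z) ∧ Integrable φ ∧
      ∫ z, φ z ≤ C * ‖h‖ ∧ ∀ z, ‖k (z + h)‖ ≤ 2 * n * ‖k z‖ + φ z := by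
  obtain ⟨C, hC⟩ := hk.exists_isKernelLike
  have hC0 : 0 ≤ C := (hC ⟨0, hk.pos⟩).nonneg
  refine ⟨n * (24 * C) + 1, by positivity, fun h =>
    ⟨fun z => ∑ i, IsKernelLike.largeIncr (fun y => k y i) h z,
      fun z => Finset.sum_nonneg fun i _ => IsKernelLike.largeIncr_nonneg _ _ _,
      integrable_finsetSum _ fun i _ => ((hC i).integral_largeIncr_le h).1, ?_, fun z => ?_⟩⟩
  · rw [integral_finsetSum _ fun i _ => ((hC i).integral_largeIncr_le h).1]
    refine (Finset.sum_le_sum fun i _ => ((hC i).integral_largeIncr_le h).2).trans ?_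
    simp only [Finset.sum_const, Finset.card_univ, Fintype.card_fin, nsmul_eq_mul]
    have := norm_nonneg h
    nlinarith
  · have hn1 : ‖k (z + h)‖ ≤ ∑ i, |k (z + h) i| := by
      have := EuclideanSpace.norm_eq (k (z + h))
      rw [this]
      refine Real.sqrt_le_iff.2 ⟨Finset.sum_nonneg fun i _ => abs_nonneg _, ?_⟩
      exact Finset.sum_sq_le_sq_sum_of_nonneg fun i _ => abs_nonneg _
    calc ‖k (z + h)‖ ≤ ∑ i, |k (z + h) i| := hn1
      _ ≤ ∑ i, (2 * ‖k z‖ + IsKernelLike.largeIncr (fun y => k y i) h z) := by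
          refine Finset.sum_le_sum fun i _ => ?_
          refine (IsKernelLike.abs_add_le_largeIncr (fun y => k y i) h z).trans ?_
          gcongr
          simpa using PiLp.norm_apply_le (k z) i
      _ = _ := by
          rw [Finset.sum_add_distrib]; simp; ring

end IsHomKernel

end

section

/-- the convolution of the vector kernel `k` with the density `r` -/
def convVel {n : ℕ} (k : Euc n → Euc n) (r : Euc n → ℝ) (x : Euc n) : Euc n :=
  ∫ y, r y • k (x - y)

namespace IsHomKernel

variable {n : ℕ} {k : Euc n → Euc n}

theorem aestronglyMeasurable_smul (hk : IsHomKernel k) {r : Euc n → ℝ} (hr : AEMeasurable r)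
    (x : Euc n) : AEStronglyMeasurable (fun y => r y • k (x - y)) := by
  have := hk.measurable
  exact (hr.smul (f := r) (g := fun y => k (x - y)) (by fun_prop)).aestronglyMeasurable

theorem exists_integrable_of_integrable (hk : IsHomKernel k) :
    ∃ C : ℝ, 0 < C ∧ ∀ (r : Euc n → ℝ) (A : ℝ), AEMeasurable r → (∀ y, |r y| ≤ A) →
      ∀ x₀ : Euc n, Integrable (fun y => r y • k (x₀ - y)) → ∀ x,
        Integrable (fun y => r y • k (x - y)) ∧
        ‖convVel k r x‖ ≤ 2 * n * (∫ y, ‖r y • k (x₀ - y)‖) + C * A * ‖x - x₀‖ := by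
  obtain ⟨C, hC, hφ⟩ := hk.exists_norm_add_le
  refine ⟨C, hC, fun r A hr hA x₀ h0 x => ?_⟩
  have hA0 : 0 ≤ A := (abs_nonneg _).trans (hA 0)
  obtain ⟨φ, hφ0, hφi, hφC, hφk⟩ := hφ (x - x₀)
  have hdom : Integrable fun y => 2 * n * ‖r y • k (x₀ - y)‖ + A * φ (x₀ - y) :=
    (h0.norm.const_mul _).add ((hφi.comp_sub_left x₀).const_mul A)
  have hpt : ∀ y, ‖r y • k (x - y)‖ ≤ 2 * n * ‖r y • k (x₀ - y)‖ + A * φ (x₀ - y) := by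
    intro y
    have h1 := hφk (x₀ - y)
    rw [show x₀ - y + (x - x₀) = x - y by abel] at h1
    rw [norm_smul, norm_smul, Real.norm_eq_abs]
    calc |r y| * ‖k (x - y)‖ ≤ |r y| * (2 * n * ‖k (x₀ - y)‖ + φ (x₀ - y)) := by gcongr
      _ = 2 * n * (|r y| * ‖k (x₀ - y)‖) + |r y| * φ (x₀ - y) := by ring
      _ ≤ _ := by gcongr; exacts [hφ0 _, hA y]
  have hinte := hdom.mono' (hk.aestronglyMeasurable_smul hr x) (Filter.Eventually.of_forall hpt)
  refine ⟨hinte, ?_⟩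
  calc ‖convVel k r x‖ ≤ ∫ y, ‖r y • k (x - y)‖ := norm_integral_le_integral_norm _
    _ ≤ ∫ y, (2 * n * ‖r y • k (x₀ - y)‖ + A * φ (x₀ - y)) :=
        MeasureTheory.integral_mono hinte.norm hdom hpt
    _ = 2 * n * (∫ y, ‖r y • k (x₀ - y)‖) + A * ∫ y, φ y := by
        rw [MeasureTheory.integral_add (h0.norm.const_mul _) ((hφi.comp_sub_left x₀).const_mul A),
          MeasureTheory.integral_const_mul, MeasureTheory.integral_const_mul,
          integral_sub_left_eq_self φ volume x₀]
    _ ≤ 2 * n * (∫ y, ‖r y • k (x₀ - y)‖) + A * (C * ‖x - x₀‖) := by gcongr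
    _ = _ := by ring

theorem convVel_dichotomy (hk : IsHomKernel k) {r : Euc n → ℝ} {A : ℝ} (hr : AEMeasurable r)
    (hA : ∀ y, |r y| ≤ A) :
    (∀ x, Integrable (fun y => r y • k (x - y))) ∨ (∀ x, convVel k r x = 0) := by
  obtain ⟨C, -, hC⟩ := hk.exists_integrable_of_integrable
  by_cases h : ∃ x₀, Integrable (fun y => r y • k (x₀ - y))
  · obtain ⟨x₀, h0⟩ := h
    exact Or.inl fun x => (hC r A hr hA x₀ h0 x).1
  · push Not at h
    exact Or.inr fun x => integral_undef (h x)

theorem exists_norm_convVel_le_linear (hk : IsHomKernel k) {r : Euc n → ℝ} {A : ℝ}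
    (hr : AEMeasurable r) (hA : ∀ y, |r y| ≤ A) :
    ∃ a b : ℝ, 0 ≤ b ∧ ∀ x, ‖convVel k r x‖ ≤ a + b * ‖x‖ := by
  have hA0 : 0 ≤ A := (abs_nonneg _).trans (hA 0)
  rcases hk.convVel_dichotomy hr hA with h | h
  · obtain ⟨C, hC0, hC⟩ := hk.exists_integrable_of_integrable
    exact ⟨_, C * A, by positivity, fun x => by simpa using (hC r A hr hA 0 (h 0) x).2⟩
  · exact ⟨0, 0, le_rfl, fun x => by simp [h x]⟩

theorem secDiff_convVel {r : Euc n → ℝ}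
    (h : ∀ x, Integrable (fun y => r y • k (x - y))) (e x : Euc n) :
    Integrable (fun y => r y • secDiff k e (x - y)) ∧
    secDiff (convVel k r) e x = ∫ y, r y • secDiff k e (x - y) := by
  have e1 : ∀ y, r y • secDiff k e (x - y)
      = r y • k (x + e - y) + r y • k (x - e - y) - (2 : ℝ) • (r y • k (x - y)) := by
    intro y
    unfold secDiff
    rw [show x - y + e = x + e - y by abel, show x - y - e = x - e - y by abel]
    module
  have i1 : Integrable fun y => r y • k (x + e - y) + r y • k (x - e - y) :=
    (h (x + e)).add (h (x - e))
  have i2 : Integrable fun y => (2 : ℝ) • (r y • k (x - y)) := (h x).smul (2 : ℝ)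
  simp only [e1]
  refine ⟨i1.sub i2, ?_⟩
  rw [MeasureTheory.integral_sub i1 i2, MeasureTheory.integral_add (h (x + e)) (h (x - e)),
    MeasureTheory.integral_smul]
  rfl

/-- the velocity generated by a bounded density has the Zygmund property -/
theorem exists_norm_secDiff_convVel_le (hk : IsHomKernel k) :
    ∃ C : ℝ, 0 < C ∧ ∀ (r : Euc n → ℝ) (A : ℝ), AEMeasurable r → (∀ y, |r y| ≤ A) →
      ∀ h x, ‖secDiff (convVel k r) h x‖ ≤ C * A * ‖h‖ := by
  obtain ⟨C, hC0, hC⟩ := hk.exists_integral_secDiff_le le_rfl zero_lt_one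
  simp only [Real.rpow_zero, one_mul, add_zero, Real.rpow_one] at hC
  refine ⟨C, hC0, fun r A hr hA h x => ?_⟩
  have hA0 : 0 ≤ A := (abs_nonneg _).trans (hA 0)
  rcases hk.convVel_dichotomy hr hA with hi | hi
  · obtain ⟨h1, h2⟩ := secDiff_convVel hi h x
    have i1 : Integrable fun y => A * ‖secDiff k h (x - y)‖ :=
      ((hC h).1.comp_sub_left x).const_mul A
    rw [h2]
    calc ‖∫ y, r y • secDiff k h (x - y)‖ ≤ ∫ y, A * ‖secDiff k h (x - y)‖ := by
          refine norm_integral_le_of_norm_le i1 (Filter.Eventually.of_forall fun y => ?_)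
          rw [norm_smul]
          gcongr
          exact hA y
      _ = A * ∫ y, ‖secDiff k h y‖ := by
          rw [MeasureTheory.integral_const_mul,
            integral_sub_left_eq_self (fun z => ‖secDiff k h z‖) volume x]
      _ ≤ A * (C * ‖h‖) := by gcongr; exact (hC h).2
      _ = _ := by ring
  · have : secDiff (convVel k r) h x = 0 := by simp [secDiff, hi]
    rw [this, norm_zero]; positivity

/-- for Hölder densities the second differences of the velocity are superlinear -/
theorem exists_norm_secDiff_convVel_le_of_holder (hk : IsHomKernel k) {γ : ℝ} (h0 : 0 < γ)
    (h1 : γ < 1) :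
    ∃ C : ℝ, 0 < C ∧ ∀ (r : Euc n → ℝ) (A H : ℝ), AEMeasurable r → (∀ y, |r y| ≤ A) →
      (∀ y z, |r y - r z| ≤ H * ‖y - z‖ ^ γ) → 0 ≤ H →
      ∀ h x, ‖secDiff (convVel k r) h x‖ ≤ C * H * ‖h‖ ^ (1 + γ) := by
  obtain ⟨C, hC0, hC⟩ := hk.exists_integral_secDiff_le h0.le h1
  refine ⟨C, hC0, fun r A H hr hA hH hH0 h x => ?_⟩
  rcases hk.convVel_dichotomy hr hA with hi | hi
  · obtain ⟨h1, h2⟩ := secDiff_convVel hi h x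
    have i1 : Integrable fun y => H * (‖x - y‖ ^ γ * ‖secDiff k h (x - y)‖) :=
      ((hC h).1.comp_sub_left x).const_mul H
    have i2 : Integrable fun y => r x • secDiff k h (x - y) :=
      ((hk.integrable_secDiff h).comp_sub_left x).smul (r x)
    have e : ∫ y, r y • secDiff k h (x - y) = ∫ y, (r y - r x) • secDiff k h (x - y) := by
      simp only [sub_smul]
      rw [MeasureTheory.integral_sub h1 i2, MeasureTheory.integral_smul,
        integral_sub_left_eq_self (fun z => secDiff k h z) volume x, hk.integral_secDiff]
      simp
    rw [h2, e]
    calc ‖∫ y, (r y - r x) • secDiff k h (x - y)‖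
        ≤ ∫ y, H * (‖x - y‖ ^ γ * ‖secDiff k h (x - y)‖) := by
          refine norm_integral_le_of_norm_le i1 (Filter.Eventually.of_forall fun y => ?_)
          rw [norm_smul, ← mul_assoc, norm_sub_rev x y]
          gcongr
          exact hH y x
      _ = H * ∫ y, ‖y‖ ^ γ * ‖secDiff k h y‖ := by
          rw [MeasureTheory.integral_const_mul,
            integral_sub_left_eq_self (fun z => ‖z‖ ^ γ * ‖secDiff k h z‖) volume x]
      _ ≤ H * (C * ‖h‖ ^ (1 + γ)) := by gcongr; exact (hC h).2
      _ = _ := by ring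
  · have : secDiff (convVel k r) h x = 0 := by simp [secDiff, hi]
    rw [this, norm_zero]; positivity

/-- sup bound for the velocity of a density supported in a ball -/
theorem exists_norm_convVel_le (hk : IsHomKernel k) :
    ∃ C : ℝ, 0 < C ∧ ∀ (r : Euc n → ℝ) (A : ℝ), (∀ y, |r y| ≤ A) →
      ∀ (c : Euc n) (R : ℝ), 0 < R → (∀ y, r y ≠ 0 → y ∈ closedBall c R) →
      ∀ x, ‖convVel k r x‖ ≤ C * A * R := by
  obtain ⟨C, hC0, hC⟩ := hk.exists_integral_closedBall_le
  refine ⟨C, hC0, fun r A hA c R hR hs x => ?_⟩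
  have hA0 : 0 ≤ A := (abs_nonneg _).trans (hA 0)
  obtain ⟨h1, h2⟩ := hC x c R hR
  have e : ∀ y, y ∉ closedBall c R → r y • k (x - y) = 0 := fun y hy => by
    have : r y = 0 := by by_contra h; exact hy (hs y h)
    simp [this]
  have e1 : convVel k r x = ∫ y in closedBall c R, r y • k (x - y) :=
    (setIntegral_eq_integral_of_forall_compl_eq_zero e).symm
  rw [e1]
  calc ‖∫ y in closedBall c R, r y • k (x - y)‖ ≤ ∫ y in closedBall c R, A * ‖k (x - y)‖ := by
        refine norm_integral_le_of_norm_le (h1.norm.const_mul A)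
          (Filter.Eventually.of_forall fun y => ?_)
        rw [norm_smul]
        gcongr
        exact hA y
    _ ≤ A * (C * R) := by rw [MeasureTheory.integral_const_mul]; gcongr
    _ = _ := by ring

end IsHomKernel

end

section

section SecDiff

variable {E F : Type*} [NormedAddCommGroup E] [NormedSpace ℝ E] [NormedAddCommGroup F]
  [NormedSpace ℝ F] {f : E → F}

theorem parallelogram_eq_secDiff_sub (f : E → F) (x u w : E) :
    f (x + u + w) - f (x + u) - f (x + w) + f x =
      secDiff f ((1 / 2 : ℝ) • (u + w)) (x + (1 / 2 : ℝ) • (u + w)) -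
        secDiff f ((1 / 2 : ℝ) • (u - w)) (x + (1 / 2 : ℝ) • (u + w)) := by
  unfold secDiff
  have e1 : x + (1 / 2 : ℝ) • (u + w) + (1 / 2 : ℝ) • (u + w) = x + u + w := by module
  have e2 : x + (1 / 2 : ℝ) • (u + w) - (1 / 2 : ℝ) • (u + w) = x := by module
  have e3 : x + (1 / 2 : ℝ) • (u + w) + (1 / 2 : ℝ) • (u - w) = x + u := by module
  have e4 : x + (1 / 2 : ℝ) • (u + w) - (1 / 2 : ℝ) • (u - w) = x + w := by module
  rw [e1, e2, e3, e4]; abel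

theorem norm_half_add_le (u w : E) : ‖(1 / 2 : ℝ) • (u + w)‖ ≤ (‖u‖ + ‖w‖) / 2 := by
  rw [norm_smul, Real.norm_of_nonneg (by norm_num)]; linarith [norm_add_le u w]

theorem norm_half_sub_le (u w : E) : ‖(1 / 2 : ℝ) • (u - w)‖ ≤ (‖u‖ + ‖w‖) / 2 := by
  rw [norm_smul, Real.norm_of_nonneg (by norm_num)]; linarith [norm_sub_le u w]

/-- a function with the Zygmund property is almost additive -/
theorem norm_map_add_sub_le {K : ℝ} (hK : ∀ h x, ‖secDiff f h x‖ ≤ K * ‖h‖) (hK0 : 0 ≤ K)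
    (h0 : f 0 = 0) (u w : E) : ‖f (u + w) - f u - f w‖ ≤ K * (‖u‖ + ‖w‖) := by
  have e := parallelogram_eq_secDiff_sub f 0 u w
  simp only [zero_add, h0, add_zero] at e
  rw [e]
  refine (norm_sub_le _ _).trans ?_
  calc _ ≤ K * ((‖u‖ + ‖w‖) / 2) + K * ((‖u‖ + ‖w‖) / 2) := by
        gcongr
        · exact (hK _ _).trans (by gcongr; exact norm_half_add_le u w)
        · exact (hK _ _).trans (by gcongr; exact norm_half_sub_le u w)
    _ = _ := by ring

theorem norm_map_sum_sub_le {K : ℝ} (hK : ∀ h x, ‖secDiff f h x‖ ≤ K * ‖h‖) (hK0 : 0 ≤ K)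
    (h0 : f 0 = 0) {ι : Type*} (s : Finset ι) (a : ι → E) :
    ‖f (∑ i ∈ s, a i) - ∑ i ∈ s, f (a i)‖ ≤ K * s.card * ∑ i ∈ s, ‖a i‖ := by
  classical
  induction s using Finset.induction_on with
  | empty => simp [h0]
  | insert j s hj ih =>
    rw [Finset.sum_insert hj, Finset.sum_insert hj, Finset.sum_insert hj, Finset.card_insert_of_notMem hj]
    have e : f (a j + ∑ i ∈ s, a i) - (f (a j) + ∑ i ∈ s, f (a i)) =
      (f (a j + ∑ i ∈ s, a i) - f (a j) - f (∑ i ∈ s, a i)) +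
        (f (∑ i ∈ s, a i) - ∑ i ∈ s, f (a i)) := by abel
    rw [e]
    have h1 := norm_map_add_sub_le hK hK0 h0 (a j) (∑ i ∈ s, a i)
    have h2 : ‖∑ i ∈ s, a i‖ ≤ ∑ i ∈ s, ‖a i‖ := norm_sum_le _ _
    have h3 : K * (‖a j‖ + ‖∑ i ∈ s, a i‖) ≤ K * (‖a j‖ + ∑ i ∈ s, ‖a i‖) := by gcongr
    have h4 : 0 ≤ K * s.card * ‖a j‖ := by positivity
    push_cast
    calc _ ≤ _ := norm_add_le _ _
      _ ≤ K * (‖a j‖ + ∑ i ∈ s, ‖a i‖) + K * s.card * ∑ i ∈ s, ‖a i‖ := by linarith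
      _ ≤ _ := by linarith

/-- a Zygmund function on a line vanishing at `0` and `1` grows at most like `s log s` -/
theorem norm_le_of_zygmund_line {φ : ℝ → F} {K : ℝ}
    (hK : ∀ h s : ℝ, ‖secDiff φ h s‖ ≤ K * |h|) (hb : ∃ B, ∀ s ∈ Icc (0 : ℝ) 1, ‖φ s‖ ≤ B)
    (h0 : φ 0 = 0) (h1 : φ 1 = 0) (s : ℝ) :
    ‖φ s‖ ≤ 3 * K * ((1 + |s|) * (1 + Real.log (1 + |s|))) := by
  have hK0 : 0 ≤ K := by
    have := (norm_nonneg _).trans (hK 1 0); simpa using this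
  have hhalf : ∀ h s : ℝ, 2 * ‖φ s‖ ≤ ‖φ (s + h)‖ + ‖φ (s - h)‖ + K * |h| := by
    intro h s
    have e : (2 : ℝ) • φ s = φ (s + h) + φ (s - h) - secDiff φ h s := by unfold secDiff; abel
    have e1 : 2 * ‖φ s‖ = ‖(2 : ℝ) • φ s‖ := by rw [norm_smul, Real.norm_ofNat]
    rw [e1, e]
    have := norm_sub_le (φ (s + h) + φ (s - h)) (secDiff φ h s)
    have := norm_add_le (φ (s + h)) (φ (s - h))
    linarith [hK h s]
  -- on the unit interval
  have hunit : ∀ s ∈ Icc (0 : ℝ) 1, ‖φ s‖ ≤ K / 2 := by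
    have : Nonempty (Icc (0 : ℝ) 1) := ⟨⟨0, by simp⟩⟩
    obtain ⟨B, hB⟩ := hb
    have hbdd : BddAbove (range fun s : Icc (0 : ℝ) 1 => ‖φ s‖) :=
      ⟨B, by rintro _ ⟨s, rfl⟩; exact hB s s.2⟩
    set m := ⨆ s : Icc (0 : ℝ) 1, ‖φ s‖ with hm
    have hle : ∀ s ∈ Icc (0 : ℝ) 1, ‖φ s‖ ≤ m := fun s hs => le_ciSup hbdd ⟨s, hs⟩
    have hm2 : m ≤ (m + K / 2) / 2 := by
      refine ciSup_le fun s => ?_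
      obtain ⟨s, hs0, hs1⟩ := s
      show ‖φ s‖ ≤ _
      rcases le_total s (1 / 2) with h | h
      · have a := hhalf s s
        rw [sub_self, h0, norm_zero, abs_of_nonneg hs0] at a
        have b := hle (s + s) ⟨by linarith, by linarith⟩
        nlinarith
      · have a := hhalf (1 - s) s
        rw [add_sub_cancel, h1, norm_zero, abs_of_nonneg (by linarith)] at a
        have b := hle (s - (1 - s)) ⟨by linarith, by linarith⟩
        nlinarith
    intro s hs
    have := hle s hs
    linarith
  have hdy : ∀ j : ℕ, ∀ s ∈ Icc (0 : ℝ) (2 ^ j), ‖φ s‖ ≤ K * 2 ^ j * (1 + j) / 2 := by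
    intro j
    induction j with
    | zero => intro s hs; simpa using hunit s (by simpa using hs)
    | succ j ih =>
      intro s hs
      rw [pow_succ] at hs
      have a := ih (s / 2) ⟨by linarith [hs.1], by linarith [hs.2]⟩
      have b := hK (s / 2) (s / 2)
      unfold secDiff at b
      rw [add_halves, sub_self, h0, add_zero, abs_of_nonneg (by linarith [hs.1])] at b
      have c : ‖φ s‖ ≤ ‖φ s - (2 : ℝ) • φ (s / 2)‖ + 2 * ‖φ (s / 2)‖ := by
        have := norm_add_le (φ s - (2 : ℝ) • φ (s / 2)) ((2 : ℝ) • φ (s / 2))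
        rwa [sub_add_cancel, norm_smul, Real.norm_ofNat] at this
      have d : K * (s / 2) ≤ K * 2 ^ j := by gcongr; linarith [hs.2]
      rw [pow_succ]; push_cast
      linarith
  have hpos : ∀ s : ℝ, 0 ≤ s → ‖φ s‖ ≤ 2 * K * ((1 + s) * (1 + Real.log (1 + s))) := by
    intro s hs
    have hl : 0 ≤ Real.log (1 + s) := Real.log_nonneg (by linarith)
    rcases le_total s 1 with h | h
    · have a := hunit s ⟨hs, h⟩
      have : 1 ≤ (1 + s) * (1 + Real.log (1 + s)) := by nlinarith
      nlinarith
    · obtain ⟨m, hm1, hm2⟩ := exists_nat_pow_near h (one_lt_two)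
      have a := hdy (m + 1) s ⟨hs, hm2.le⟩
      have b : (m : ℝ) ≤ 2 * Real.log (1 + s) := by
        have h1 : Real.log (2 ^ m) ≤ Real.log (1 + s) :=
          Real.log_le_log (by positivity) (by linarith)
        rw [Real.log_pow] at h1
        have h2 := Real.log_two_gt_d9
        have h3 : (m : ℝ) * (1 / 2) ≤ m * Real.log 2 := by gcongr; linarith
        linarith
      push_cast at a
      rw [pow_succ] at a
      calc ‖φ s‖ ≤ K * (2 ^ m * 2) * (1 + (m + 1)) / 2 := a
        _ = K * 2 ^ m * (m + 2) := by ring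
        _ ≤ K * (1 + s) * (2 * Real.log (1 + s) + 2) := by gcongr; linarith
        _ = _ := by ring
  rcases le_total 0 s with h | h
  · rw [abs_of_nonneg h]
    refine (hpos s h).trans ?_
    have hl : 0 ≤ Real.log (1 + s) := Real.log_nonneg (by linarith)
    gcongr; norm_num
  · rw [abs_of_nonpos h]
    have hl : 0 ≤ Real.log (1 + -s) := Real.log_nonneg (by linarith)
    have a := hpos (-s) (by linarith)
    have b := hK (-s) 0
    unfold secDiff at b
    rw [h0, smul_zero, sub_zero, zero_add, zero_sub, neg_neg, abs_of_nonneg (by linarith)] at b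
    have c : ‖φ s‖ ≤ ‖φ (-s) + φ s‖ + ‖φ (-s)‖ := by
      have := norm_sub_le (φ (-s) + φ s) (φ (-s))
      rwa [add_sub_cancel_left] at this
    have d : K * -s ≤ K * ((1 + -s) * (1 + Real.log (1 + -s))) := by gcongr; nlinarith
    linarith

/-- one dyadic step of the increment of a function -/
theorem norm_incr_le_of_secDiff {ω : ℝ} (x h : E) (hω : ‖secDiff f h (x + h)‖ ≤ ω) :
    ‖f (x + h) - f x‖ ≤ ‖f (x + (2 : ℝ) • h) - f x‖ / 2 + ω / 2 := by
  have e : (2 : ℝ) • (f (x + h) - f x) = (f (x + (2 : ℝ) • h) - f x) - secDiff f h (x + h) := by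
    unfold secDiff
    rw [add_sub_cancel_right, two_smul ℝ h, ← add_assoc]; module
  have e1 : 2 * ‖f (x + h) - f x‖ = ‖(2 : ℝ) • (f (x + h) - f x)‖ := by
    rw [norm_smul, Real.norm_ofNat]
  have := norm_sub_le (f (x + (2 : ℝ) • h) - f x) (secDiff f h (x + h))
  rw [← e, ← e1] at this
  linarith

theorem norm_incr_le_iterate {K : ℝ} (hK : ∀ h x, ‖secDiff f h x‖ ≤ K * ‖h‖) (x h : E) (J : ℕ) :
    ‖f (x + h) - f x‖ ≤ ‖f (x + (2 : ℝ) ^ J • h) - f x‖ / 2 ^ J + J * (K * ‖h‖ / 2) := by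
  induction J with
  | zero => simp
  | succ J ih =>
    have a := norm_incr_le_of_secDiff x ((2 : ℝ) ^ J • h) (hK _ _)
    rw [norm_smul, Real.norm_of_nonneg (by positivity), smul_smul, ← pow_succ'] at a
    have b : ‖f (x + (2 : ℝ) ^ J • h) - f x‖ / 2 ^ J ≤
        (‖f (x + (2 : ℝ) ^ (J + 1) • h) - f x‖ / 2 + K * (2 ^ J * ‖h‖) / 2) / 2 ^ J := by
      gcongr
    have c : (‖f (x + (2 : ℝ) ^ (J + 1) • h) - f x‖ / 2 + K * (2 ^ J * ‖h‖) / 2) / 2 ^ J =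
        ‖f (x + (2 : ℝ) ^ (J + 1) • h) - f x‖ / 2 ^ (J + 1) + K * ‖h‖ / 2 := by
      rw [pow_succ (2 : ℝ) J]; field_simp
    push_cast
    linarith

/-- bounded Zygmund functions are log-Lipschitz -/
theorem norm_incr_le_log {K V D : ℝ} (hK : ∀ h x, ‖secDiff f h x‖ ≤ K * ‖h‖) (hK0 : 0 ≤ K)
    (hV : ∀ x, ‖f x‖ ≤ V) (hD : 0 < D) (x h : E) (hh : h ≠ 0) :
    ‖f (x + h) - f x‖ ≤ ‖h‖ * (2 * V / D + K * (1 / 2 + Real.log (1 + D / ‖h‖))) := by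
  have hh0 : 0 < ‖h‖ := norm_pos_iff.2 hh
  have hV0 : 0 ≤ V := (norm_nonneg _).trans (hV 0)
  have hl : 0 ≤ Real.log (1 + D / ‖h‖) := Real.log_nonneg (by
    have : 0 ≤ D / ‖h‖ := by positivity
    linarith)
  have htriv : ∀ u, ‖f u - f x‖ ≤ 2 * V := fun u => by
    linarith [norm_sub_le (f u) (f x), hV u, hV x]
  rcases le_total D ‖h‖ with h1 | h1
  · refine (htriv _).trans ?_
    have : 2 * V ≤ ‖h‖ * (2 * V / D) := by
      rw [mul_div_assoc', le_div_iff₀ hD]; nlinarith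
    have : 0 ≤ ‖h‖ * (K * (1 / 2 + Real.log (1 + D / ‖h‖))) := by positivity
    linarith
  · obtain ⟨m, hm1, hm2⟩ := exists_nat_pow_near (x := D / ‖h‖) (by rwa [one_le_div hh0]) one_lt_two
    have b : (m : ℝ) ≤ 2 * Real.log (1 + D / ‖h‖) := by
      have h1 : Real.log (2 ^ m) ≤ Real.log (1 + D / ‖h‖) :=
        Real.log_le_log (by positivity) (by linarith)
      rw [Real.log_pow] at h1
      have h2 := Real.log_two_gt_d9
      have h3 : (m : ℝ) * (1 / 2) ≤ m * Real.log 2 := by gcongr; linarith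
      linarith
    have a := norm_incr_le_iterate hK x h (m + 1)
    have c : ‖f (x + (2 : ℝ) ^ (m + 1) • h) - f x‖ / 2 ^ (m + 1) ≤ ‖h‖ * (2 * V / D) := by
      rw [div_lt_iff₀ hh0] at hm2
      have : 2 * V / 2 ^ (m + 1) ≤ ‖h‖ * (2 * V / D) := by
        rw [mul_div_assoc', div_le_div_iff₀ (by positivity) hD]
        nlinarith
      refine le_trans ?_ this
      gcongr
      exact htriv _
    have d : ((m + 1 : ℕ) : ℝ) * (K * ‖h‖ / 2) ≤ (2 * Real.log (1 + D / ‖h‖) + 1) * (K * ‖h‖ / 2) := by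
      push_cast; gcongr
    calc _ ≤ _ := a
      _ ≤ ‖h‖ * (2 * V / D) + (2 * Real.log (1 + D / ‖h‖) + 1) * (K * ‖h‖ / 2) := by linarith
      _ = _ := by ring

theorem norm_incr_le_iterate_rpow {H γ : ℝ} (hγ : 0 < γ) (hH0 : 0 ≤ H)
    (hH : ∀ h x, ‖secDiff f h x‖ ≤ H * ‖h‖ ^ (1 + γ)) (x h : E) (J : ℕ) :
    ‖f (x + h) - f x‖ ≤ ‖f (x + (2 : ℝ) ^ J • h) - f x‖ / 2 ^ J +
      H / (2 * (2 ^ γ - 1)) * ‖h‖ * (2 ^ J * ‖h‖) ^ γ := by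
  have hq : 0 < (2 : ℝ) ^ γ - 1 := by
    have := Real.one_lt_rpow (one_lt_two) hγ; linarith
  induction J with
  | zero =>
    have : 0 ≤ H / (2 * (2 ^ γ - 1)) * ‖h‖ * (2 ^ 0 * ‖h‖) ^ γ := by positivity
    simpa using this
  | succ J ih =>
    have a := norm_incr_le_of_secDiff x ((2 : ℝ) ^ J • h) (hH _ _)
    rw [norm_smul, Real.norm_of_nonneg (by positivity), smul_smul, ← pow_succ'] at a
    have b : ‖f (x + (2 : ℝ) ^ J • h) - f x‖ / 2 ^ J ≤
        (‖f (x + (2 : ℝ) ^ (J + 1) • h) - f x‖ / 2 + H * (2 ^ J * ‖h‖) ^ (1 + γ) / 2) / 2 ^ J := by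
      gcongr
    set P := (2 ^ J * ‖h‖) ^ γ with hP
    have e1 : (2 ^ J * ‖h‖) ^ (1 + γ) = 2 ^ J * ‖h‖ * P := by
      rw [Real.rpow_add' (by positivity) (by positivity), Real.rpow_one]
    have e2 : (2 ^ (J + 1) * ‖h‖) ^ γ = 2 ^ γ * P := by
      rw [hP, ← Real.mul_rpow (by norm_num) (by positivity)]; congr 1; ring
    rw [e1] at b
    rw [e2]
    have c : (‖f (x + (2 : ℝ) ^ (J + 1) • h) - f x‖ / 2 + H * (2 ^ J * ‖h‖ * P) / 2) / 2 ^ J =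
        ‖f (x + (2 : ℝ) ^ (J + 1) • h) - f x‖ / 2 ^ (J + 1) + H * ‖h‖ * P / 2 := by
      rw [pow_succ (2 : ℝ) J]; field_simp
    have d : H / (2 * (2 ^ γ - 1)) * ‖h‖ * (2 ^ γ * P) =
        H / (2 * (2 ^ γ - 1)) * ‖h‖ * P + H * ‖h‖ * P / 2 := by
      field_simp; ring
    linarith

/-- logarithmic interpolation: the Lipschitz bound depends on the Hölder bound logarithmically -/
theorem norm_incr_le_interpolate {K V D H γ δ : ℝ} (hγ : 0 < γ)
    (hK : ∀ h x, ‖secDiff f h x‖ ≤ K * ‖h‖) (hK0 : 0 ≤ K) (hV : ∀ x, ‖f x‖ ≤ V) (hD : 0 < D)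
    (hH0 : 0 ≤ H) (hH : ∀ h x, ‖secDiff f h x‖ ≤ H * ‖h‖ ^ (1 + γ)) (hδ : 0 < δ) (x h : E) :
    ‖f (x + h) - f x‖ ≤ ‖h‖ * (H / (2 * (2 ^ γ - 1)) * δ ^ γ + 2 * V / D +
      K * (1 / 2 + Real.log (1 + 2 * D / δ))) := by
  rcases eq_or_ne h 0 with rfl | hh
  · simp
  have hh0 : 0 < ‖h‖ := norm_pos_iff.2 hh
  have hq : 0 < (2 : ℝ) ^ γ - 1 := by
    have := Real.one_lt_rpow (one_lt_two) hγ; linarith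
  have hmono : ∀ r, δ / 2 ≤ r → Real.log (1 + D / r) ≤ Real.log (1 + 2 * D / δ) := by
    intro r hr
    have : 0 < r := by linarith
    refine Real.log_le_log (by positivity) ?_
    have : D / r ≤ D / (δ / 2) := by gcongr
    have e : D / (δ / 2) = 2 * D / δ := by field_simp
    linarith
  rcases le_total δ ‖h‖ with h1 | h1
  · refine (norm_incr_le_log hK hK0 hV hD x h hh).trans ?_
    have c := mul_le_mul_of_nonneg_left (hmono ‖h‖ (by linarith)) hK0
    have p : 0 ≤ H / (2 * (2 ^ γ - 1)) * δ ^ γ := by positivity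
    refine mul_le_mul_of_nonneg_left ?_ hh0.le
    linarith
  · obtain ⟨m, hm1, hm2⟩ := exists_nat_pow_near (x := δ / ‖h‖) (by rwa [one_le_div hh0]) one_lt_two
    rw [le_div_iff₀ hh0] at hm1
    rw [div_lt_iff₀ hh0, pow_succ] at hm2
    have a := norm_incr_le_iterate_rpow hγ hH0 hH x h m
    have hn : ‖(2 : ℝ) ^ m • h‖ = 2 ^ m * ‖h‖ := by
      rw [norm_smul, Real.norm_of_nonneg (by positivity)]
    have b := norm_incr_le_log hK hK0 hV hD x ((2 : ℝ) ^ m • h) (smul_ne_zero (by positivity) hh)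
    rw [hn] at b
    have c := hmono (2 ^ m * ‖h‖) (by linarith)
    have d : ‖f (x + (2 : ℝ) ^ m • h) - f x‖ / 2 ^ m ≤
        ‖h‖ * (2 * V / D + K * (1 / 2 + Real.log (1 + 2 * D / δ))) := by
      rw [div_le_iff₀ (by positivity)]
      refine b.trans ?_
      have c' := mul_le_mul_of_nonneg_left c hK0
      calc 2 ^ m * ‖h‖ * (2 * V / D + K * (1 / 2 + Real.log (1 + D / (2 ^ m * ‖h‖))))
          ≤ 2 ^ m * ‖h‖ * (2 * V / D + K * (1 / 2 + Real.log (1 + 2 * D / δ))) := by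
            refine mul_le_mul_of_nonneg_left ?_ (by positivity)
            linarith
        _ = _ := by ring
    have e : H / (2 * (2 ^ γ - 1)) * ‖h‖ * (2 ^ m * ‖h‖) ^ γ ≤
        H / (2 * (2 ^ γ - 1)) * ‖h‖ * δ ^ γ := by gcongr
    calc _ ≤ _ := a
      _ ≤ _ := add_le_add d e
      _ = _ := by ring

end SecDiff

end

section

open Filter Topology

/-- A map with the Zygmund property vanishing at the origin and on the standard basis grows at most
like `r log r`. -/
theorem norm_le_of_zygmund {n : ℕ} {F : Type*} [NormedAddCommGroup F] [NormedSpace ℝ F]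
    {f : Euc n → F} {K a b : ℝ} (hK0 : 0 ≤ K) (hb0 : 0 ≤ b)
    (hK : ∀ h x, ‖secDiff f h x‖ ≤ K * ‖h‖) (hab : ∀ x, ‖f x‖ ≤ a + b * ‖x‖)
    (h0 : f 0 = 0) (h1 : ∀ i, f (EuclideanSpace.single i 1) = 0) (Y : Euc n) :
    ‖f Y‖ ≤ (n ^ 2 + 3 * n) * K * ((1 + ‖Y‖) * (1 + Real.log (1 + ‖Y‖))) := by
  have hdec : Y = ∑ i, (Y i) • (EuclideanSpace.single i (1 : ℝ) : Euc n) := by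
    ext j
    simp [Finset.sum_apply, Pi.single_apply]
  have hcoord : ∀ i, |Y i| ≤ ‖Y‖ := fun i => by
    have := PiLp.norm_apply_le Y i
    simpa using this
  have hmono : ∀ i, (1 + |Y i|) * (1 + Real.log (1 + |Y i|)) ≤
      (1 + ‖Y‖) * (1 + Real.log (1 + ‖Y‖)) := by
    intro i
    have l0 : 0 ≤ Real.log (1 + |Y i|) := Real.log_nonneg (by linarith [abs_nonneg (Y i)])
    have l1 : Real.log (1 + |Y i|) ≤ Real.log (1 + ‖Y‖) :=
      Real.log_le_log (by positivity) (by linarith [hcoord i])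
    gcongr
    exact hcoord i
  set M := (1 + ‖Y‖) * (1 + Real.log (1 + ‖Y‖)) with hM
  have hYM : ‖Y‖ ≤ M := by
    have : 0 ≤ Real.log (1 + ‖Y‖) := Real.log_nonneg (by linarith [norm_nonneg Y])
    nlinarith [norm_nonneg Y]
  have hline : ∀ i, ‖f (Y i • (EuclideanSpace.single i (1 : ℝ) : Euc n))‖ ≤ 3 * K * M := by
    intro i
    have := norm_le_of_zygmund_line (K := K)
      (φ := fun s : ℝ => f (s • (EuclideanSpace.single i (1 : ℝ) : Euc n))) ?_ ?_ ?_ ?_ (Y i)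
    · exact this.trans (by gcongr; exact hmono i)
    · intro h s
      have := hK (h • (EuclideanSpace.single i (1 : ℝ) : Euc n)) (s • EuclideanSpace.single i (1 : ℝ))
      rw [norm_smul, PiLp.norm_single, norm_one, mul_one, Real.norm_eq_abs] at this
      simpa only [secDiff, add_smul, sub_smul] using this
    · refine ⟨a + b * 1, fun s hs => (hab _).trans ?_⟩
      rw [norm_smul, PiLp.norm_single, norm_one, mul_one, Real.norm_eq_abs,
        abs_of_nonneg hs.1]
      gcongr
      exact hs.2
    · simpa using h0
    · simpa using h1 i
  have hs := norm_map_sum_sub_le hK hK0 h0 Finset.univ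
    (fun i => Y i • (EuclideanSpace.single i (1 : ℝ) : Euc n))
  rw [← hdec] at hs
  have e1 : ∑ i, ‖Y i • (EuclideanSpace.single i (1 : ℝ) : Euc n)‖ ≤ n * M := by
    calc _ ≤ ∑ i : Fin n, M := by
          refine Finset.sum_le_sum fun i _ => ?_
          rw [norm_smul, PiLp.norm_single, norm_one, mul_one, Real.norm_eq_abs]
          exact (hcoord i).trans hYM
      _ = _ := by simp
  have e2 : ‖∑ i, f (Y i • (EuclideanSpace.single i (1 : ℝ) : Euc n))‖ ≤ n * (3 * K * M) := by
    refine (norm_sum_le _ _).trans ?_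
    calc _ ≤ ∑ i : Fin n, (3 * K * M) := Finset.sum_le_sum fun i _ => hline i
      _ = _ := by simp
  have e3 : K * (Finset.univ : Finset (Fin n)).card *
      ∑ i, ‖Y i • (EuclideanSpace.single i (1 : ℝ) : Euc n)‖ ≤ K * n * (n * M) := by
    rw [Finset.card_univ, Fintype.card_fin]
    gcongr
  have e4 := norm_le_norm_add_norm_sub' (f Y)
    (∑ i, f (Y i • (EuclideanSpace.single i (1 : ℝ) : Euc n)))
  calc ‖f Y‖ ≤ n * (3 * K * M) + K * n * (n * M) := by linarith
    _ = _ := by ring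

section Deriv
variable {E G : Type*} [NormedAddCommGroup E] [NormedSpace ℝ E]
  [NormedAddCommGroup G] [NormedSpace ℝ G]

theorem norm_parallelogram_le_of_secDiff {F : E → G} {C γ : ℝ} (hγ : 0 < γ) (hC : 0 ≤ C)
    (h2 : ∀ h x, ‖secDiff F h x‖ ≤ C * ‖h‖ ^ (1 + γ)) {r : ℝ} {u w : E} (hu : ‖u‖ ≤ r) (hw : ‖w‖ ≤ r)
    (x : E) : ‖F (x + u + w) - F (x + u) - F (x + w) + F x‖ ≤ 2 * C * r ^ (1 + γ) := by
  rw [parallelogram_eq_secDiff_sub]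
  refine (norm_sub_le _ _).trans ?_
  have a : ‖(1 / 2 : ℝ) • (u + w)‖ ≤ r := (norm_half_add_le u w).trans (by linarith)
  have b : ‖(1 / 2 : ℝ) • (u - w)‖ ≤ r := (norm_half_sub_le u w).trans (by linarith)
  calc _ ≤ C * r ^ (1 + γ) + C * r ^ (1 + γ) := by
        refine add_le_add ((h2 _ _).trans ?_) ((h2 _ _).trans ?_) <;> gcongr
    _ = _ := by ring

/-- A function whose second differences are `O(|h|^{1+γ})` has directional derivatives. -/
theorem exists_dirDeriv_of_secDiff [CompleteSpace G] {F : E → G} {C γ : ℝ} (hγ : 0 < γ)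
    (hC : 0 ≤ C) (h2 : ∀ h x, ‖secDiff F h x‖ ≤ C * ‖h‖ ^ (1 + γ)) :
    ∃ C' : ℝ, 0 ≤ C' ∧ ∀ x u, ∃ D : G,
      Tendsto (fun m : ℕ => (2 : ℝ) ^ m • (F (x + (2⁻¹ : ℝ) ^ m • u) - F x)) atTop (𝓝 D) ∧
      ‖F (x + u) - F x - D‖ ≤ C' * ‖u‖ ^ (1 + γ) := by
  have hq1 : (2⁻¹ : ℝ) ^ γ < 1 := Real.rpow_lt_one (by norm_num) (by norm_num) hγ
  have hq0 : 0 < 1 - (2⁻¹ : ℝ) ^ γ := by linarith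
  refine ⟨C / (1 - (2⁻¹ : ℝ) ^ γ), by positivity, fun x u => ?_⟩
  set d : ℕ → G := fun m => (2 : ℝ) ^ m • (F (x + (2⁻¹ : ℝ) ^ m • u) - F x) with hd
  have hstep : ∀ m, dist (d m) (d (m + 1)) ≤ C * ‖u‖ ^ (1 + γ) * ((2⁻¹ : ℝ) ^ γ) ^ m := by
    intro m
    set w := (2⁻¹ : ℝ) ^ (m + 1) • u with hw
    have e0 : (2⁻¹ : ℝ) ^ m • u = w + w := by
      rw [hw, ← two_smul ℝ, smul_smul, pow_succ]; congr 1; ring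
    have e : d m - d (m + 1) = (2 : ℝ) ^ m • secDiff F w (x + w) := by
      simp only [hd, ← hw, e0, secDiff]
      rw [add_sub_cancel_right, ← add_assoc, pow_succ]
      module
    rw [dist_eq_norm, e, norm_smul, Real.norm_of_nonneg (by positivity)]
    have a := h2 w (x + w)
    have b : ‖w‖ = 2⁻¹ ^ (m + 1) * ‖u‖ := by
      rw [hw, norm_smul, Real.norm_of_nonneg (by positivity)]
    calc (2 : ℝ) ^ m * ‖secDiff F w (x + w)‖ ≤ 2 ^ m * (C * (2⁻¹ ^ m * ‖u‖) ^ (1 + γ)) := by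
          gcongr
          refine a.trans ?_
          rw [b]
          gcongr ?_ * ?_ ^ _
          gcongr ?_ * _
          exact pow_le_pow_of_le_one (by norm_num) (by norm_num) (by omega)
      _ = _ := by
          rw [Real.mul_rpow (by positivity) (by positivity), Real.rpow_add (by positivity),
            Real.rpow_one, ← Real.rpow_natCast_mul (by norm_num), mul_comm (m : ℝ) γ,
            Real.rpow_mul_natCast (by norm_num)]
          have : (2 : ℝ) ^ m * 2⁻¹ ^ m = 1 := by rw [← mul_pow]; norm_num
          linear_combination (C * ((2⁻¹ : ℝ) ^ γ) ^ m * ‖u‖ ^ (1 + γ)) * this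
  obtain ⟨D, hD⟩ := cauchySeq_tendsto_of_complete (cauchySeq_of_le_geometric _ _ hq1 hstep)
  refine ⟨D, hD, ?_⟩
  have := dist_le_of_le_geometric_of_tendsto₀ _ _ hq1 hstep hD
  rw [dist_eq_norm] at this
  simp only [hd, pow_zero, one_smul] at this
  calc _ ≤ _ := this
    _ = _ := by ring

theorem exists_hasFDerivAt_holder_of_secDiff [CompleteSpace G] {F : E → G} {C γ L : ℝ} (hγ : 0 < γ)
    (hC : 0 ≤ C) (hL : ∀ x y, ‖F x - F y‖ ≤ L * ‖x - y‖)
    (h2 : ∀ h x, ‖secDiff F h x‖ ≤ C * ‖h‖ ^ (1 + γ)) :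
    ∃ D : E → E →L[ℝ] G, ∃ C' : ℝ, (∀ x, HasFDerivAt F (D x) x) ∧
      ∀ x y, ‖D x - D y‖ ≤ C' * ‖x - y‖ ^ γ := by
  obtain ⟨C', hC', hD⟩ := exists_dirDeriv_of_secDiff hγ hC h2
  choose D hDt hDb using hD
  have hhalf : Tendsto (fun m : ℕ => (2⁻¹ : ℝ) ^ m) atTop (𝓝 0) :=
    tendsto_pow_atTop_nhds_zero_of_lt_one (by norm_num) (by norm_num)
  have hpow : ∀ m : ℕ, (2 : ℝ) ^ m * 2⁻¹ ^ m = 1 := fun m => by rw [← mul_pow]; norm_num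
  have hDL : ∀ x u, ‖D x u‖ ≤ L * ‖u‖ := by
    intro x u
    refine le_of_tendsto (hDt x u).norm (Eventually.of_forall fun m => ?_)
    rw [norm_smul, Real.norm_of_nonneg (by positivity)]
    have := hL (x + (2⁻¹ : ℝ) ^ m • u) x
    rw [add_sub_cancel_left, norm_smul, Real.norm_of_nonneg (by positivity)] at this
    calc _ ≤ 2 ^ m * (L * (2⁻¹ ^ m * ‖u‖)) := by gcongr
      _ = L * ‖u‖ := by linear_combination (L * ‖u‖) * hpow m
  have hlim0 : ∀ B r : ℝ, 0 ≤ r → Tendsto (fun m : ℕ => B * (2 ^ m * (2⁻¹ ^ m * r) ^ (1 + γ))) atTop (𝓝 0) := by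
    intro B r hr
    have hq1 : (2⁻¹ : ℝ) ^ γ < 1 := Real.rpow_lt_one (by norm_num) (by norm_num) hγ
    have : ∀ m : ℕ, B * (2 ^ m * (2⁻¹ ^ m * r) ^ (1 + γ)) = B * r ^ (1 + γ) * ((2⁻¹ : ℝ) ^ γ) ^ m := by
      intro m
      rw [Real.mul_rpow (by positivity) hr, Real.rpow_add (by positivity),
          Real.rpow_one, ← Real.rpow_natCast_mul (by norm_num), mul_comm (m : ℝ) γ,
          Real.rpow_mul_natCast (by norm_num)]
      linear_combination (B * ((2⁻¹ : ℝ) ^ γ) ^ m * r ^ (1 + γ)) * hpow m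
    simp only [this]
    simpa using (tendsto_pow_atTop_nhds_zero_of_lt_one (by positivity) hq1).const_mul (B * r ^ (1 + γ))
  have hadd : ∀ x u w, D x (u + w) = D x u + D x w := by
    intro x u w
    have t := ((hDt x (u + w)).sub (hDt x u)).sub (hDt x w)
    have t0 : Tendsto (fun m : ℕ => (2 : ℝ) ^ m • (F (x + (2⁻¹ : ℝ) ^ m • (u + w)) - F x) -
        (2 : ℝ) ^ m • (F (x + (2⁻¹ : ℝ) ^ m • u) - F x) -
        (2 : ℝ) ^ m • (F (x + (2⁻¹ : ℝ) ^ m • w) - F x)) atTop (𝓝 0) := by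
      refine squeeze_zero_norm (fun m => ?_) (hlim0 (2 * C) (max ‖u‖ ‖w‖)
        ((norm_nonneg u).trans (le_max_left _ _)))
      have e : (2 : ℝ) ^ m • (F (x + (2⁻¹ : ℝ) ^ m • (u + w)) - F x) -
        (2 : ℝ) ^ m • (F (x + (2⁻¹ : ℝ) ^ m • u) - F x) -
        (2 : ℝ) ^ m • (F (x + (2⁻¹ : ℝ) ^ m • w) - F x) = (2 : ℝ) ^ m •
          (F (x + (2⁻¹ : ℝ) ^ m • u + (2⁻¹ : ℝ) ^ m • w) - F (x + (2⁻¹ : ℝ) ^ m • u)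
            - F (x + (2⁻¹ : ℝ) ^ m • w) + F x) := by
        rw [smul_add, ← add_assoc]; module
      rw [e, norm_smul, Real.norm_of_nonneg (by positivity)]
      have := norm_parallelogram_le_of_secDiff hγ hC h2 (r := 2⁻¹ ^ m * max ‖u‖ ‖w‖)
        (u := (2⁻¹ : ℝ) ^ m • u) (w := (2⁻¹ : ℝ) ^ m • w)
        (by rw [norm_smul, Real.norm_of_nonneg (by positivity)]; gcongr; exact le_max_left _ _)
        (by rw [norm_smul, Real.norm_of_nonneg (by positivity)]; gcongr; exact le_max_right _ _) x
      calc _ ≤ 2 ^ m * (2 * C * (2⁻¹ ^ m * max ‖u‖ ‖w‖) ^ (1 + γ)) := by gcongr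
        _ = _ := by ring
    have := tendsto_nhds_unique t t0
    rw [sub_sub, sub_eq_zero] at this
    exact this
  have hDcont : ∀ x, Continuous (D x) := by
    intro x
    have : ∀ u w, ‖D x u - D x w‖ ≤ L * ‖u - w‖ := by
      intro u w
      have e := hadd x (u - w) w
      rw [sub_add_cancel] at e
      rw [e, add_sub_cancel_right]
      exact hDL x _
    exact (LipschitzWith.of_dist_le' (K := L) fun u w => by
      rw [dist_eq_norm, dist_eq_norm]; exact this u w).continuous
  let DA : E → E →L[ℝ] G := fun x => (AddMonoidHom.mk' (D x) (hadd x)).toRealLinearMap (hDcont x)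
  have hDA : ∀ x u, DA x u = D x u := fun x u => rfl
  refine ⟨DA, 2 * C' + 2 * C, fun x => ?_, fun x y => ?_⟩
  · rw [hasFDerivAt_iff_isLittleO_nhds_zero]
    have hO : (fun h => F (x + h) - F x - DA x h) =O[𝓝 0] fun h => ‖h‖ ^ (1 + γ) := by
      refine Asymptotics.IsBigO.of_bound C' (Eventually.of_forall fun h => ?_)
      rw [hDA, Real.norm_of_nonneg (by positivity)]
      exact hDb x h
    refine hO.trans_isLittleO ?_
    have ht : Tendsto (fun h : E => ‖h‖ ^ γ) (𝓝 0) (𝓝 0) := by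
      have : ContinuousAt (fun h : E => ‖h‖ ^ γ) 0 :=
        continuousAt_id.norm.rpow_const (Or.inr hγ.le)
      simpa [ContinuousAt, Real.zero_rpow hγ.ne'] using this
    refine Asymptotics.isLittleO_iff.2 fun c hc => ?_
    filter_upwards [ht.eventually_lt_const hc] with h hh
    rw [Real.norm_of_nonneg (by positivity), Real.rpow_add' (norm_nonneg _) (by positivity),
      Real.rpow_one, mul_comm]
    gcongr
  · rcases eq_or_ne x y with rfl | hxy
    · simp [Real.zero_rpow hγ.ne']
    set r := ‖x - y‖ with hr
    have hr0 : 0 < r := norm_pos_iff.2 (sub_ne_zero.2 hxy)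
    refine ContinuousLinearMap.opNorm_le_bound _ (by positivity) fun u => ?_
    rcases eq_or_ne u 0 with rfl | hu
    · simp
    have hu0 : 0 < ‖u‖ := norm_pos_iff.2 hu
    set w := (r / ‖u‖) • u with hw
    have hwr : ‖w‖ = r := by
      rw [hw, norm_smul, Real.norm_of_nonneg (by positivity)]; field_simp
    have huw : u = (‖u‖ / r) • w := by
      rw [hw, smul_smul, div_mul_div_cancel₀ hr0.ne', div_self hu0.ne', one_smul]
    have p := norm_parallelogram_le_of_secDiff hγ hC h2 (r := r) (u := x - y) (w := w) le_rfl
      hwr.le y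
    rw [add_sub_cancel] at p
    have b1 := hDb x w
    have b2 := hDb y w
    rw [hwr] at b1 b2
    have key : ‖D x w - D y w‖ ≤ (2 * C' + 2 * C) * r ^ (1 + γ) := by
      have e : D x w - D y w = (F (x + w) - F x - F (y + w) + F y) - (F (x + w) - F x - D x w) +
        (F (y + w) - F y - D y w) := by abel
      rw [e]
      refine (norm_add_le _ _).trans ?_
      have := norm_sub_le (F (x + w) - F x - F (y + w) + F y) (F (x + w) - F x - D x w)
      linarith
    have e : (DA x - DA y) u = (‖u‖ / r) • (D x w - D y w) := by
      conv_lhs => rw [huw]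
      rw [map_smul, sub_apply, hDA, hDA]
    rw [e, norm_smul, Real.norm_of_nonneg (by positivity)]
    calc _ ≤ ‖u‖ / r * ((2 * C' + 2 * C) * r ^ (1 + γ)) := by gcongr
      _ = _ := by
        rw [Real.rpow_add hr0, Real.rpow_one]; field_simp
end Deriv

end

section

open Filter Topology

theorem exists_countable_measure_diff_biUnion_eq_zero {α ι : Type*} [MeasurableSpace α]
    (μ : Measure α) [IsFiniteMeasure μ] (G : ι → Set α) (hG : ∀ i, MeasurableSet (G i)) (I : Set ι) :
    ∃ Θ ⊆ I, Θ.Countable ∧ ∀ θ ∈ I, μ (G θ \ ⋃ i ∈ Θ, G i) = 0 := by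
  set S : Set ENNReal := {r | ∃ Θ ⊆ I, Θ.Countable ∧ μ (⋃ i ∈ Θ, G i) = r} with hS
  have hne : S.Nonempty := ⟨_, ∅, empty_subset _, countable_empty, rfl⟩
  obtain ⟨u, -, hu, huS⟩ := exists_seq_tendsto_sSup hne (OrderTop.bddAbove S)
  choose Θ hΘI hΘc hΘu using huS
  have hc : (⋃ m, Θ m).Countable := countable_iUnion hΘc
  have hsub : (⋃ m, Θ m) ⊆ I := iUnion_subset hΘI
  have hmax : sSup S ≤ μ (⋃ i ∈ ⋃ m, Θ m, G i) := by
    refine le_of_tendsto hu (Eventually.of_forall fun m => ?_)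
    rw [← hΘu m]
    exact measure_mono (biUnion_subset_biUnion_left (subset_iUnion Θ m))
  refine ⟨_, hsub, hc, fun θ hθ => ?_⟩
  have hle : μ (⋃ i ∈ insert θ (⋃ m, Θ m), G i) ≤ sSup S :=
    le_sSup ⟨_, insert_subset hθ hsub, hc.insert θ, rfl⟩
  rw [biUnion_insert, ← sdiff_union_self,
    measure_union disjoint_sdiff_left (MeasurableSet.biUnion hc fun i _ => hG i)] at hle
  have := hle.trans hmax
  by_contra h
  exact absurd this (not_le.2 (by
    rw [add_comm]
    exact ENNReal.lt_add_right (measure_ne_top _ _) h))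

/-- If `ρ · x` is differentiable with derivative vanishing off the slices of `F`, and each `ρ s` is
measurable on the corresponding slice, then measurability of `ρ 0` propagates. -/
theorem aemeasurable_of_deriv_eq_zero_off_of_isFiniteMeasure {α : Type*} [MeasurableSpace α]
    {μ : Measure α} [IsFiniteMeasure μ] {ρ : ℝ → α → ℝ} {F : Set (ℝ × α)} (hF : MeasurableSet F)
    (hmeas : ∀ s, AEMeasurable (ρ s) (μ.restrict {x | (s, x) ∈ F})) {ρ' : ℝ → α → ℝ}
    (hder : ∀ x s, HasDerivAt (fun s => ρ s x) (ρ' s x) s)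
    (hzero : ∀ x s, (s, x) ∉ F → ρ' s x = 0) (h0 : AEMeasurable (ρ 0) μ) {t : ℝ} (ht : 0 ≤ t) :
    AEMeasurable (ρ t) μ := by
  classical
  have hslice : ∀ s, MeasurableSet {x | (s, x) ∈ F} := fun s => measurable_prodMk_left hF
  choose Θ hΘI hΘc hΘ using fun pq : ℚ × ℚ =>
    exists_countable_measure_diff_biUnion_eq_zero μ (fun s => {x | (s, x) ∈ F}) hslice
      (Ioo (pq.1 : ℝ) pq.2 ∩ Icc 0 t)
  have hTc : (insert 0 (⋃ pq, Θ pq)).Countable := (countable_iUnion hΘc).insert 0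
  obtain ⟨θ, hθ⟩ := hTc.exists_eq_range (insert_nonempty _ _)
  have hθt : ∀ m, θ m ∈ Icc 0 t := by
    intro m
    have : θ m ∈ insert 0 (⋃ pq, Θ pq) := hθ ▸ mem_range_self m
    rcases this with h | h
    · rw [h]; exact ⟨le_rfl, ht⟩
    · obtain ⟨pq, h⟩ := mem_iUnion.1 h
      exact (hΘI pq h).2
  -- the last time in the slices among the first `m` elements of the sequence
  let a : ℕ → α → ℝ := fun m => Nat.rec (motive := fun _ => α → ℝ) (fun _ => 0)
    (fun m (am : α → ℝ) x => if (θ m, x) ∈ F ∧ am x < θ m then θ m else am x) m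
  have ha0 : ∀ x, a 0 x = 0 := fun x => rfl
  have haS : ∀ m x, a (m + 1) x =
    if (θ m, x) ∈ F ∧ a m x < θ m then θ m else a m x := fun m x => rfl
  have ham : ∀ m, Measurable (a m) := by
    intro m
    induction m with
    | zero => exact measurable_const
    | succ m ih =>
      refine Measurable.ite ((hslice _).inter (measurableSet_lt ih measurable_const))
        measurable_const ih
  have hgm : ∀ m, AEMeasurable (fun x => ρ (a m x) x) μ := by
    intro m
    induction m with
    | zero => exact h0
    | succ m ih =>
      set S := {x | (θ m, x) ∈ F ∧ a m x < θ m} with hS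
      have hSm : MeasurableSet S := (hslice _).inter (measurableSet_lt (ham m) measurable_const)
      rw [← Measure.restrict_univ (μ := μ), ← union_compl_self S, aemeasurable_union_iff]
      constructor
      · refine ((hmeas (θ m)).mono_set fun x hx => hx.1).congr ?_
        filter_upwards [ae_restrict_mem hSm] with x hx
        have hx' : (θ m, x) ∈ F ∧ a m x < θ m := hx
        rw [haS, if_pos hx']
      · refine ih.restrict.congr ?_
        filter_upwards [ae_restrict_mem hSm.compl] with x hx
        have hx' : ¬((θ m, x) ∈ F ∧ a m x < θ m) := hx
        rw [haS, if_neg hx']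
  have hat : ∀ m x, a m x ∈ Icc 0 t := by
    intro m x
    induction m with
    | zero => exact ⟨le_rfl, ht⟩
    | succ m ih =>
      rw [haS]; split_ifs
      exacts [hθt m, ih]
  have hmono : ∀ x, Monotone fun m => a m x := fun x => monotone_nat_of_le_succ fun m => by
    rw [haS]; split_ifs with h
    exacts [h.2.le, le_rfl]
  have hbdd : ∀ x, BddAbove (range fun m => a m x) := fun x =>
    ⟨t, by rintro _ ⟨m, rfl⟩; exact (hat m x).2⟩
  have hgood : ∀ᵐ x ∂μ, ∀ pq : ℚ × ℚ, (x ∈ ⋃ s ∈ Θ pq, {x | (s, x) ∈ F}) ∨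
      ∀ᵐ s, s ∈ Ioo (pq.1 : ℝ) pq.2 ∩ Icc 0 t → (s, x) ∉ F := by
    refine ae_all_iff.2 fun pq => ?_
    set W := ⋃ s ∈ Θ pq, {x | (s, x) ∈ F} with hW
    have hWm : MeasurableSet W := MeasurableSet.biUnion (hΘc pq) fun s _ => hslice s
    have h1 : ∀ᵐ s : ℝ, ∀ᵐ x ∂μ, (s ∈ Ioo (pq.1 : ℝ) pq.2 ∩ Icc 0 t ∧ (s, x) ∈ F) → x ∈ W := by
      refine Eventually.of_forall fun s => ?_
      by_cases hs : s ∈ Ioo (pq.1 : ℝ) pq.2 ∩ Icc 0 t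
      · have := hΘ pq s hs
        rw [← compl_mem_ae_iff] at this
        filter_upwards [this] with x hx hx'
        by_contra hxW
        exact hx ⟨hx'.2, hxW⟩
      · exact Eventually.of_forall fun x hx => absurd hx.1 hs
    have hm : MeasurableSet {z : ℝ × α |
        (z.1 ∈ Ioo (pq.1 : ℝ) pq.2 ∩ Icc 0 t ∧ (z.1, z.2) ∈ F) → z.2 ∈ W} := by
      have : {z : ℝ × α | (z.1 ∈ Ioo (pq.1 : ℝ) pq.2 ∩ Icc 0 t ∧ (z.1, z.2) ∈ F) → z.2 ∈ W} =
        ((Prod.fst ⁻¹' (Ioo (pq.1 : ℝ) pq.2 ∩ Icc 0 t)) ∩ F)ᶜ ∪ Prod.snd ⁻¹' W := by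
        ext z; simp only [mem_ofPred_eq, mem_union, mem_compl_iff, mem_inter_iff, mem_preimage]
        tauto
      rw [this]
      exact ((measurable_fst (measurableSet_Ioo.inter measurableSet_Icc)).inter hF).compl.union
        (measurable_snd hWm)
    have h2 := (Measure.ae_ae_comm (μ := (volume : Measure ℝ)) (ν := μ) hm).1 h1
    filter_upwards [h2] with x hx
    by_cases hxW : x ∈ W
    · exact Or.inl hxW
    · right
      filter_upwards [hx] with s hs hsI hsF
      exact hxW (hs ⟨hsI, hsF⟩)
  refine aemeasurable_of_tendsto_metrizable_ae atTop hgm ?_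
  filter_upwards [hgood] with x hx
  set b := ⨆ m, a m x with hb
  have hbt : Tendsto (fun m => a m x) atTop (𝓝 b) := tendsto_atTop_ciSup (hmono x) (hbdd x)
  have hb0 : 0 ≤ b := ge_of_tendsto' hbt fun m => (hat m x).1
  have hbt' : b ≤ t := le_of_tendsto' hbt fun m => (hat m x).2
  have hθb : ∀ m, (θ m, x) ∈ F → θ m ≤ b := by
    intro m hm
    refine le_trans ?_ (le_ciSup (hbdd x) (m + 1))
    show θ m ≤ a (m + 1) x
    rw [haS]; split_ifs with h
    · exact le_rfl
    · simp only [hm, true_and, not_lt] at h; exact h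
  have hnull : ∀ᵐ s : ℝ, ∀ pq : ℚ × ℚ, b ≤ pq.1 →
      s ∈ Ioo (pq.1 : ℝ) pq.2 ∩ Icc 0 t → (s, x) ∉ F := by
    refine ae_all_iff.2 fun pq => ?_
    by_cases hp : b ≤ pq.1
    · rcases hx pq with h | h
      · exfalso
        obtain ⟨s, hs, hsx⟩ := mem_iUnion₂.1 h
        have : s ∈ insert 0 (⋃ pq, Θ pq) := Or.inr (mem_iUnion.2 ⟨pq, hs⟩)
        rw [hθ] at this
        obtain ⟨m, rfl⟩ := this
        exact absurd (hθb m hsx) (not_le.2 (hp.trans_lt (hΘI pq hs).1.1))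
      · filter_upwards [h] with s hs _ using hs
    · exact Eventually.of_forall fun s h => absurd h hp
  have hdz : ∀ᵐ s ∂volume.restrict (uIoc b t), ρ' s x = 0 := by
    rw [uIoc_of_le hbt', ← restrict_Ioo_eq_restrict_Ioc, ae_restrict_iff' measurableSet_Ioo]
    filter_upwards [hnull] with s hs hsI
    obtain ⟨p, hp1, hp2⟩ := exists_rat_btwn hsI.1
    obtain ⟨q, hq1, -⟩ := exists_rat_btwn hsI.2
    exact hzero x s (hs (p, q) hp1.le ⟨⟨hp2, hq1⟩, hb0.trans hsI.1.le, hsI.2.le⟩)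
  have hinte : IntervalIntegrable (fun s => ρ' s x) volume b t := by
    rw [intervalIntegrable_iff]
    exact (integrable_zero ℝ ℝ _).congr (hdz.mono fun s hs => hs.symm)
  have hz := integral_eq_sub_of_hasDerivAt (fun s _ => hder x s) hinte
  rw [intervalIntegral.integral_zero_ae
    ((ae_restrict_iff' measurableSet_uIoc).1 hdz)] at hz
  have : ρ t x = ρ b x := by linarith
  rw [this]
  exact (hder x b).continuousAt.tendsto.comp hbt

theorem aemeasurable_of_deriv_eq_zero_off {α : Type*} [MeasurableSpace α]
    {μ : Measure α} [SFinite μ] {ρ : ℝ → α → ℝ} {F : Set (ℝ × α)} (hF : MeasurableSet F)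
    (hmeas : ∀ s, AEMeasurable (ρ s) (μ.restrict {x | (s, x) ∈ F})) {ρ' : ℝ → α → ℝ}
    (hder : ∀ x s, HasDerivAt (fun s => ρ s x) (ρ' s x) s)
    (hzero : ∀ x s, (s, x) ∉ F → ρ' s x = 0) (h0 : AEMeasurable (ρ 0) μ) {t : ℝ} (ht : 0 ≤ t) :
    AEMeasurable (ρ t) μ := by
  refine (aemeasurable_of_deriv_eq_zero_off_of_isFiniteMeasure (μ := μ.toFinite) hF (fun s => ?_)
    hder hzero (h0.mono_ac (toFinite_absolutelyContinuous μ)) ht).mono_ac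
    (absolutelyContinuous_toFinite μ)
  exact (hmeas s).mono_ac ((toFinite_absolutelyContinuous μ).restrict _)

end

section

open Filter Topology

theorem aemeasurable_restrict_of_convVel_ne_zero {n : ℕ} {k : Euc n → Euc n} (hk : IsHomKernel k)
    {r : Euc n → ℝ} {x : Euc n} (h : convVel k r x ≠ 0) :
    AEMeasurable r (volume.restrict {y | k (x - y) ≠ 0}) := by
  have hi : Integrable (fun y => r y • k (x - y)) := by
    by_contra hi
    exact h (integral_undef hi)
  have hkm : Measurable fun y => k (x - y) := hk.measurable.comp (measurable_const.sub measurable_id)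
  have hm : AEMeasurable (fun y => inner ℝ (r y • k (x - y)) (k (x - y)) / ‖k (x - y)‖ ^ 2) volume :=
    (hi.aestronglyMeasurable.aemeasurable.inner hkm.aemeasurable).div (hkm.norm.pow_const 2).aemeasurable
  refine hm.restrict.congr ?_
  have hs : MeasurableSet {y | k (x - y) ≠ 0} := hkm (measurableSet_singleton 0).compl
  filter_upwards [ae_restrict_mem hs] with y hy
  have : ‖k (x - y)‖ ≠ 0 := norm_ne_zero_iff.2 hy
  rw [real_inner_smul_left, real_inner_self_eq_norm_sq]
  field_simp

theorem isClosed_setOf_aemeasurable_translate {n : ℕ} {U : Set (Euc n)} (hU : IsOpen U)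
    {ρ : ℝ → Euc n → ℝ} (hρ : ∀ x, Continuous fun s => ρ s x) :
    IsClosed {p : ℝ × Euc n | AEMeasurable (ρ p.1) (volume.restrict {y | p.2 - y ∈ U})} := by
  refine IsSeqClosed.isClosed fun p q hp hpq => ?_
  have h1 : Tendsto (fun j => (p j).1) atTop (𝓝 q.1) := (continuous_fst.tendsto q).comp hpq
  have h2 : Tendsto (fun j => (p j).2) atTop (𝓝 q.2) := (continuous_snd.tendsto q).comp hpq
  set W : ℕ → Set (Euc n) := fun m => {y | ∀ j, (p (j + m)).2 - y ∈ U} with hW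
  have hsub : {y | q.2 - y ∈ U} ⊆ ⋃ m, W m := by
    intro y hy
    have : ∀ᶠ j in atTop, (p j).2 - y ∈ U := (h2.sub_const y).eventually (hU.mem_nhds hy)
    obtain ⟨m, hm⟩ := eventually_atTop.1 this
    exact mem_iUnion.2 ⟨m, fun j => hm _ (by omega)⟩
  refine (aemeasurable_iUnion_iff.2 fun m => ?_).mono_set hsub
  refine aemeasurable_of_tendsto_metrizable_ae atTop (f := fun j => ρ (p (j + m)).1)
    (fun j => (hp (j + m)).mono_set fun y hy => hy j) (Eventually.of_forall fun y => ?_)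
  exact ((hρ y).tendsto q.1).comp (h1.comp (tendsto_add_atTop_nat m))

theorem aemeasurable_of_aemeasurable_translates {n : ℕ} {U : Set (Euc n)} (hU : IsOpen U)
    (hne : U.Nonempty) (hcone : ∀ c : ℝ, 0 < c → ∀ z ∈ U, c • z ∈ U) {r : Euc n → ℝ}
    {S : Set (Euc n)} (hS : MeasurableSet S)
    (hr : ∀ x ∈ S, AEMeasurable r (volume.restrict {y | x - y ∈ U})) :
    AEMeasurable r (volume.restrict S) := by
  have hop : ∀ x : Euc n, IsOpen {y | x - y ∈ U} := fun x =>
    hU.preimage (continuous_const.sub continuous_id)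
  obtain ⟨T, hTS, hTc, hT⟩ := TopologicalSpace.isOpen_biUnion_countable S
    (fun x => {y | x - y ∈ U}) fun x _ => hop x
  set O := ⋃ x ∈ S, {y | x - y ∈ U} with hO
  have hOo : IsOpen O := isOpen_biUnion fun x _ => hop x
  have hrO : AEMeasurable r (volume.restrict O) := by
    rw [← hT, biUnion_eq_iUnion]
    have := hTc.to_subtype
    exact aemeasurable_iUnion_iff.2 fun x => hr x (hTS x.2)
  have hnull : volume (S \ O) = 0 := by
    obtain ⟨e, he⟩ := hne
    refine Measure.addHaar_eq_zero_of_disjoint_translates volume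
      (fun m : ℕ => (1 / ((m : ℝ) + 1)) • e) ?_ ?_ (hS.diff hOo.measurableSet)
    · refine isBounded_iff_forall_norm_le.2 ⟨‖e‖, ?_⟩
      rintro _ ⟨m, rfl⟩
      rw [norm_smul, Real.norm_of_nonneg (by positivity)]
      refine mul_le_of_le_one_left (norm_nonneg _) ?_
      rw [div_le_one (by positivity)]
      linarith [(Nat.cast_nonneg m : (0 : ℝ) ≤ m)]
    · refine (pairwise_disjoint_on _).2 fun i j hij => ?_
      refine disjoint_left.2 fun y hyi hyj => ?_
      obtain ⟨a, ha, hay⟩ := by simpa only [singleton_add, mem_image] using hyi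
      obtain ⟨b, hb, hby⟩ := by simpa only [singleton_add, mem_image] using hyj
      have hlt : 1 / ((j : ℝ) + 1) < 1 / ((i : ℝ) + 1) :=
        one_div_lt_one_div_of_lt (by positivity) (by exact_mod_cast Nat.succ_lt_succ hij)
      refine ha.2 (mem_biUnion hb.1 ?_)
      have : b - a = (1 / ((i : ℝ) + 1) - 1 / ((j : ℝ) + 1)) • e := by
        rw [sub_smul, sub_eq_sub_iff_add_eq_add, add_comm, hby, ← hay]
      show b - a ∈ U
      rw [this]
      exact hcone _ (by linarith) e he
  have hSO : S ⊆ O ∪ S \ O := fun x hx => by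
    by_cases h : x ∈ O
    exacts [Or.inl h, Or.inr ⟨hx, h⟩]
  refine (aemeasurable_union_iff.2 ⟨hrO, ?_⟩).mono_set hSO
  rw [Measure.restrict_eq_zero.2 hnull]
  exact aemeasurable_zero_measure

theorem IsHomKernel.aemeasurable_of_transport {n : ℕ} {k : Euc n → Euc n} (hk : IsHomKernel k)
    {ρ ρ' : ℝ → Euc n → ℝ} (hder : ∀ x s, HasDerivAt (fun s => ρ s x) (ρ' s x) s)
    (hzero : ∀ x s, convVel k (ρ s) x = 0 → ρ' s x = 0) (h0 : AEMeasurable (ρ 0) volume)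
    {t : ℝ} (ht : 0 ≤ t) : AEMeasurable (ρ t) volume := by
  set U := {z : Euc n | k z ≠ 0} with hU
  have hUo : IsOpen U := by
    have : U = {(0 : Euc n)}ᶜ ∩ k ⁻¹' {(0 : Euc n)}ᶜ := by
      ext z
      simp only [hU, mem_inter_iff, mem_compl_iff, mem_singleton_iff, mem_preimage]
      refine ⟨fun h => ⟨?_, h⟩, fun h => h.2⟩
      rintro rfl
      exact h hk.zero
    rw [this]
    exact hk.smooth.continuousOn.isOpen_inter_preimage isOpen_compl_singleton isOpen_compl_singleton
  rcases U.eq_empty_or_nonempty with hUe | hUn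
  · have hk0 : ∀ z, k z = 0 := fun z => by
      by_contra h
      have : z ∈ U := h
      simp [hUe] at this
    refine aemeasurable_of_deriv_eq_zero_off (F := ∅) MeasurableSet.empty (fun s => ?_) hder
      (fun x s _ => hzero x s ?_) h0 ht
    · simp
    · simp [convVel, hk0]
  · set F := {p : ℝ × Euc n | AEMeasurable (ρ p.1) (volume.restrict {y | p.2 - y ∈ U})} with hF
    have hFc : IsClosed F := isClosed_setOf_aemeasurable_translate hUo fun x =>
      continuous_iff_continuousAt.2 fun s => (hder x s).continuousAt
    refine aemeasurable_of_deriv_eq_zero_off (F := F) hFc.measurableSet (fun s => ?_) hder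
      (fun x s hx => hzero x s ?_) h0 ht
    · refine aemeasurable_of_aemeasurable_translates hUo hUn (fun c hc z hz => ?_)
        (measurable_prodMk_left hFc.measurableSet) fun x hx => hx
      show k (c • z) ≠ 0
      rw [hk.map_smul hc]
      exact smul_ne_zero (Real.rpow_pos_of_pos hc _).ne' hz
    · by_contra h
      exact hx (aemeasurable_restrict_of_convVel_ne_zero hk h)

end

section

open Filter Topology

/-- Osgood-type double exponential estimate -/
theorem log_one_add_log_le_of_deriv_le {E : Type*} [NormedAddCommGroup E] [InnerProductSpace ℝ E]
    {Y Y' : ℝ → E} {J : Set ℝ} (hJ : Convex ℝ J) {C : ℝ} (hC : 0 ≤ C)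
    (hY : ∀ t ∈ J, HasDerivAt Y (Y' t) t)
    (hY' : ∀ t ∈ J, ‖Y' t‖ ≤ C * ((1 + ‖Y t‖) * (1 + Real.log (1 + ‖Y t‖))))
    {s t : ℝ} (hs : s ∈ J) (ht : t ∈ J) :
    Real.log (1 + Real.log (1 + ‖Y t‖ ^ 2)) ≤
      Real.log (1 + Real.log (1 + ‖Y s‖ ^ 2)) + 6 * C * |t - s| := by
  have hu : ∀ t, 1 ≤ 1 + ‖Y t‖ ^ 2 := fun t => by nlinarith [norm_nonneg (Y t)]
  have hl : ∀ t, 0 ≤ Real.log (1 + ‖Y t‖ ^ 2) := fun t => Real.log_nonneg (hu t)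
  have hd : ∀ t ∈ J, HasDerivAt (fun t => Real.log (1 + Real.log (1 + ‖Y t‖ ^ 2)))
      (2 * inner ℝ (Y t) (Y' t) / (1 + ‖Y t‖ ^ 2) / (1 + Real.log (1 + ‖Y t‖ ^ 2))) t := by
    intro t ht
    have h1 : HasDerivAt (fun t => 1 + ‖Y t‖ ^ 2) (2 * inner ℝ (Y t) (Y' t)) t :=
      (hY t ht).norm_sq.const_add 1
    exact ((h1.log (by linarith [hu t])).const_add 1).log (by linarith [hl t])
  have hb : ∀ t ∈ J, ‖2 * inner ℝ (Y t) (Y' t) / (1 + ‖Y t‖ ^ 2) / (1 + Real.log (1 + ‖Y t‖ ^ 2))‖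
      ≤ 6 * C := by
    intro t ht
    have l0 := hl t
    have u0 := hu t
    rw [norm_div, norm_div, Real.norm_of_nonneg (by linarith : 0 ≤ 1 + Real.log (1 + ‖Y t‖ ^ 2)),
      Real.norm_of_nonneg (by linarith : 0 ≤ 1 + ‖Y t‖ ^ 2), div_div, div_le_iff₀ (by positivity),
      norm_mul, Real.norm_ofNat]
    have a1 : ‖inner ℝ (Y t) (Y' t)‖ ≤ ‖Y t‖ * ‖Y' t‖ := norm_inner_le_norm _ _
    have a2 := hY' t ht
    have n0 := norm_nonneg (Y t)
    have lg : Real.log (1 + ‖Y t‖) ≤ 1 + Real.log (1 + ‖Y t‖ ^ 2) := by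
      calc Real.log (1 + ‖Y t‖) ≤ Real.log (2 * (1 + ‖Y t‖ ^ 2)) :=
            Real.log_le_log (by positivity) (by nlinarith [sq_nonneg (‖Y t‖ - 1)])
        _ = Real.log 2 + Real.log (1 + ‖Y t‖ ^ 2) := Real.log_mul (by norm_num) (by positivity)
        _ ≤ _ := by linarith [Real.log_two_lt_d9]
    have a3 : 2 * (‖Y t‖ * (1 + ‖Y t‖)) ≤ 3 * (1 + ‖Y t‖ ^ 2) := by
      nlinarith [sq_nonneg (‖Y t‖ - 1)]
    have l1 : 0 ≤ Real.log (1 + ‖Y t‖) := Real.log_nonneg (by linarith)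
    calc 2 * ‖inner ℝ (Y t) (Y' t)‖ ≤ 2 * (‖Y t‖ * (C * ((1 + ‖Y t‖) * (1 + Real.log (1 + ‖Y t‖))))) := by
          gcongr; exact a1.trans (by gcongr)
      _ = C * (2 * (‖Y t‖ * (1 + ‖Y t‖)) * (1 + Real.log (1 + ‖Y t‖))) := by ring
      _ ≤ C * (3 * (1 + ‖Y t‖ ^ 2) * (2 * (1 + Real.log (1 + ‖Y t‖ ^ 2)))) := by
          gcongr; linarith
      _ = _ := by ring
  have := hJ.norm_image_sub_le_of_norm_hasDerivWithin_le
    (fun t ht => (hd t ht).hasDerivWithinAt) hb hs ht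
  rw [Real.norm_eq_abs, Real.norm_eq_abs] at this
  linarith [le_abs_self (Real.log (1 + Real.log (1 + ‖Y t‖ ^ 2)) -
    Real.log (1 + Real.log (1 + ‖Y s‖ ^ 2)))]

section Frame
variable {n : ℕ} {v X : ℝ → Euc n → Euc n} {K : ℝ}

/-- the linear map sending the `i`-th basis vector to `X t (α i) - X t α₀` -/
def frameMap (X : ℝ → Euc n → Euc n) (α₀ : Euc n) (α : Fin n → Euc n) (t : ℝ) :
    Euc n →L[ℝ] Euc n :=
  ∑ i, (EuclideanSpace.proj i : Euc n →L[ℝ] ℝ).smulRight (X t (α i) - X t α₀)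

theorem frameMap_apply (α₀ : Euc n) (α : Fin n → Euc n) (t : ℝ) (y : Euc n) :
    frameMap X α₀ α t y = ∑ i, y i • (X t (α i) - X t α₀) := by
  simp [frameMap]

theorem hasDerivAt_frameMap (hflow : ∀ t α, HasDerivAt (fun s => X s α) (v t (X t α)) t)
    (α₀ : Euc n) (α : Fin n → Euc n) (t : ℝ) :
    HasDerivAt (frameMap X α₀ α) (∑ i, (EuclideanSpace.proj i : Euc n →L[ℝ] ℝ).smulRight
      (v t (X t (α i)) - v t (X t α₀))) t := by
  unfold frameMap
  refine HasDerivAt.fun_sum fun i _ => ?_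
  have h := ((hflow t (α i)).sub (hflow t α₀))
  exact ((ContinuousLinearMap.smulRightL ℝ (Euc n) (Euc n)
    (EuclideanSpace.proj i : Euc n →L[ℝ] ℝ)).hasFDerivAt.comp_hasDerivAt t h)

theorem norm_velocity_defect_le (hK0 : 0 ≤ K) {w : Euc n → Euc n}
    (hZ : ∀ h x, ‖secDiff w h x‖ ≤ K * ‖h‖) {a b : ℝ} (hb : 0 ≤ b)
    (hab : ∀ x, ‖w x‖ ≤ a + b * ‖x‖) (L : Euc n →L[ℝ] Euc n) (hL : ‖L‖ ≤ 2) (p : Euc n) (Y : Euc n) :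
    ‖w (p + L Y) - w p - ∑ i, Y i • (w (p + L (EuclideanSpace.single i 1)) - w p)‖ ≤
      (n ^ 2 + 3 * n) * (2 * K) * ((1 + ‖Y‖) * (1 + Real.log (1 + ‖Y‖))) := by
  set M : Euc n →L[ℝ] Euc n := ∑ i, (EuclideanSpace.proj i : Euc n →L[ℝ] ℝ).smulRight
    (w (p + L (EuclideanSpace.single i 1)) - w p) with hM
  have hMa : ∀ y, M y = ∑ i, y i • (w (p + L (EuclideanSpace.single i 1)) - w p) := fun y => by
    simp [hM]
  have key := norm_le_of_zygmund (f := fun y => w (p + L y) - w p - M y) (K := 2 * K)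
    (a := a + b * ‖p‖ + ‖w p‖) (b := b * 2 + ‖M‖) (by positivity) (by positivity) ?_ ?_ ?_ ?_ Y
  · simpa only [hMa] using key
  · intro h x
    have e : secDiff (fun y => w (p + L y) - w p - M y) h x = secDiff w (L h) (p + L x) := by
      simp only [secDiff, map_add, map_sub]
      rw [← add_assoc p, ← add_sub_assoc p]
      module
    rw [e]
    calc _ ≤ K * ‖L h‖ := hZ _ _
      _ ≤ K * (2 * ‖h‖) := by gcongr; exact (L.le_opNorm h).trans (by gcongr)
      _ = _ := by ring
  · intro y
    have h1 : ‖w (p + L y)‖ ≤ a + b * (‖p‖ + 2 * ‖y‖) := (hab _).trans (by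
      gcongr
      exact (norm_add_le _ _).trans (by gcongr; exact (L.le_opNorm y).trans (by gcongr)))
    have h2 := M.le_opNorm y
    have h3 := norm_sub_le (w (p + L y) - w p) (M y)
    have h4 := norm_sub_le (w (p + L y)) (w p)
    calc _ ≤ a + b * (‖p‖ + 2 * ‖y‖) + ‖w p‖ + ‖M‖ * ‖y‖ := by linarith
      _ = _ := by ring
  · simp
  · intro i
    simp [hMa]

theorem exists_flow_bound_near (hK0 : 0 ≤ K)
    (hZ : ∀ t, 0 ≤ t → ∀ h x, ‖secDiff (v t) h x‖ ≤ K * ‖h‖)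
    (hlin : ∀ t, 0 ≤ t → ∃ a b, 0 ≤ b ∧ ∀ x, ‖v t x‖ ≤ a + b * ‖x‖)
    (hflow : ∀ t α, HasDerivAt (fun s => X s α) (v t (X t α)) t)
    (hsurj : ∀ t, Function.Surjective (X t)) (t₀ : ℝ) :
    ∃ δ > 0, ∀ R, ∃ R', ∀ s t, 0 ≤ s → 0 ≤ t → |s - t₀| < δ → |t - t₀| < δ →
      ∀ β, ‖X s β‖ ≤ R → ‖X t β‖ ≤ R' := by
  obtain ⟨α₀, hα₀⟩ := hsurj t₀ 0
  choose α hα using fun i : Fin n => hsurj t₀ (EuclideanSpace.single i 1)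
  set A := frameMap X α₀ α with hA
  have hA' := hasDerivAt_frameMap hflow α₀ α
  have hA0 : A t₀ = 1 := by
    ext y j
    simp [hA, frameMap_apply, hα, hα₀, Pi.single_apply]
  have hAc : ∀ᶠ t in 𝓝 t₀, ‖A t - 1‖ < 1 / 2 := by
    have : Tendsto (fun t => ‖A t - 1‖) (𝓝 t₀) (𝓝 0) := by
      have := ((hA' t₀).continuousAt.sub (continuousAt_const (y := (1 : Euc n →L[ℝ] Euc n)))).norm
      simpa [ContinuousAt, ← hA, hA0] using this
    exact this.eventually_lt_const (by norm_num)
  have hpc : ∀ᶠ t in 𝓝 t₀, ‖X t α₀‖ < 1 := by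
    have : Tendsto (fun t => ‖X t α₀‖) (𝓝 t₀) (𝓝 0) := by
      simpa [ContinuousAt, hα₀] using (hflow t₀ α₀).continuousAt.norm
    exact this.eventually_lt_const (by norm_num)
  obtain ⟨δ, hδ, hball⟩ := Metric.eventually_nhds_iff.1 (hAc.and hpc)
  refine ⟨δ, hδ, fun R => ?_⟩
  set C := 2 * ((n ^ 2 + 3 * n) * (2 * K)) with hC
  set q : ℝ → ℝ := fun r => Real.log (1 + Real.log (1 + r ^ 2)) with hq
  set Q := q (2 * (R + 1)) + 6 * C * (2 * δ) with hQ
  refine ⟨2 * (1 + Real.exp (Real.exp Q)) + 1, fun s t hs0 ht0 hs ht β hβ => ?_⟩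
  set J := Ioo (t₀ - δ) (t₀ + δ) ∩ Ici 0 with hJ
  have hJc : Convex ℝ J := (convex_Ioo _ _).inter (convex_Ici 0)
  have hJm : ∀ t, t ∈ J ↔ |t - t₀| < δ ∧ 0 ≤ t := by
    intro t
    rw [hJ, mem_inter_iff, mem_Ioo, mem_Ici, abs_lt]
    constructor <;> rintro ⟨⟨h1, h2⟩, h3⟩ <;> refine ⟨⟨?_, ?_⟩, h3⟩ <;> linarith
  have hJA : ∀ t, |t - t₀| < δ → ‖A t - 1‖ < 1 / 2 ∧ ‖X t α₀‖ < 1 := fun t ht =>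
    hball (by rwa [Real.dist_eq])
  have hunit : ∀ t, |t - t₀| < δ → IsUnit (A t) := fun t ht => by
    have h : ‖1 - A t‖ < 1 := by rw [norm_sub_rev]; linarith [(hJA t ht).1]
    have := (Units.oneSub (1 - A t) h).isUnit
    simpa using this
  have hA2 : ∀ t, |t - t₀| < δ → ‖A t‖ ≤ 2 := fun t ht => by
    have h1 : ‖(1 : Euc n →L[ℝ] Euc n)‖ ≤ 1 := ContinuousLinearMap.norm_id_le
    have := norm_le_norm_add_norm_sub' (A t) 1
    linarith [(hJA t ht).1]
  have hAlow : ∀ t, |t - t₀| < δ → ∀ y, ‖y‖ ≤ 2 * ‖A t y‖ := fun t ht y => by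
    have h1 : ‖A t y - y‖ ≤ 1 / 2 * ‖y‖ := by
      have := (A t - 1).le_of_opNorm_le (hJA t ht).1.le y
      simpa using this
    have := norm_le_norm_add_norm_sub (A t y) y
    linarith
  set Y : ℝ → Euc n := fun t => (Ring.inverse (A t)) (X t β - X t α₀) with hY
  have hAY : ∀ t, |t - t₀| < δ → A t (Y t) = X t β - X t α₀ := fun t ht => by
    have := Ring.mul_inverse_cancel _ (hunit t ht)
    exact DFunLike.congr_fun this (X t β - X t α₀)
  have hYd : ∀ t, |t - t₀| < δ → DifferentiableAt ℝ Y t := fun t ht =>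
    ((hA' t).differentiableAt.inverse (hunit t ht)).clm_apply
      ((hflow t β).sub (hflow t α₀)).differentiableAt
  have hY' : ∀ t ∈ J, ‖deriv Y t‖ ≤ C * ((1 + ‖Y t‖) * (1 + Real.log (1 + ‖Y t‖))) := by
    intro t ht
    obtain ⟨a, b, hb, hab⟩ := hlin t ((hJm t).1 ht).2
    have hd := norm_velocity_defect_le hK0 (hZ t ((hJm t).1 ht).2) hb hab (A t) (hA2 t ((hJm t).1 ht).1)
      (X t α₀) (Y t)
    have e : ∀ i, X t α₀ + A t (EuclideanSpace.single i 1) = X t (α i) := fun i => by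
      simp [hA, frameMap_apply]
    simp only [e] at hd
    rw [hAY t ((hJm t).1 ht).1, add_sub_cancel] at hd
    have h1 := (hA' t).clm_apply (hYd t ((hJm t).1 ht).1).hasDerivAt
    have h2 : HasDerivAt (fun t => A t (Y t)) (v t (X t β) - v t (X t α₀)) t := by
      refine ((hflow t β).sub (hflow t α₀)).congr_of_eventuallyEq ?_
      filter_upwards [(continuous_abs.comp (continuous_id.sub
        continuous_const)).continuousAt.eventually_lt_const ((hJm t).1 ht).1] with r hr
      exact hAY r hr
    have h3 := h1.unique h2
    rw [← eq_sub_iff_add_eq'] at h3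
    have h4 : (∑ i, (EuclideanSpace.proj i : Euc n →L[ℝ] ℝ).smulRight
      (v t (X t (α i)) - v t (X t α₀))) (Y t) = ∑ i, Y t i • (v t (X t (α i)) - v t (X t α₀)) := by
      simp
    rw [h4] at h3
    have h5 := hAlow t ((hJm t).1 ht).1 (deriv Y t)
    rw [show A t (deriv Y t) = _ from h3] at h5
    refine h5.trans ((mul_le_mul_of_nonneg_left hd zero_le_two).trans_eq ?_)
    rw [hC]; ring
  have hsJ : s ∈ J := (hJm s).2 ⟨hs, hs0⟩
  have htJ : t ∈ J := (hJm t).2 ⟨ht, ht0⟩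
  have hC0 : 0 ≤ C := by positivity
  have hO := log_one_add_log_le_of_deriv_le hJc hC0
    (fun t ht => (hYd t ((hJm t).1 ht).1).hasDerivAt) hY' hsJ htJ
  have hYs : ‖Y s‖ ≤ 2 * (R + 1) := by
    refine (hAlow s hs _).trans ?_
    rw [hAY s hs]
    have := norm_sub_le (X s β) (X s α₀)
    linarith [(hJA s hs).2]
  have hqmono : q ‖Y s‖ ≤ q (2 * (R + 1)) := by
    have l0 : 0 ≤ Real.log (1 + ‖Y s‖ ^ 2) := Real.log_nonneg (by nlinarith [norm_nonneg (Y s)])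
    refine Real.log_le_log (by linarith) ?_
    gcongr
  have hts : |t - s| ≤ 2 * δ := by
    have := abs_sub_le t t₀ s
    rw [abs_sub_comm t₀ s] at this
    linarith
  have hqt : q ‖Y t‖ ≤ Q := by
    have : 6 * C * |t - s| ≤ 6 * C * (2 * δ) := by gcongr
    calc q ‖Y t‖ ≤ q ‖Y s‖ + 6 * C * |t - s| := hO
      _ ≤ Q := by linarith
  have hYt : ‖Y t‖ ^ 2 ≤ Real.exp (Real.exp Q) := by
    have l0 : 0 ≤ Real.log (1 + ‖Y t‖ ^ 2) := Real.log_nonneg (by nlinarith [norm_nonneg (Y t)])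
    have h1 := (Real.log_le_iff_le_exp (by linarith)).1 hqt
    have h2 := (Real.log_le_iff_le_exp (by positivity)).1 (by linarith :
      Real.log (1 + ‖Y t‖ ^ 2) ≤ Real.exp Q)
    linarith
  have hYt' : ‖Y t‖ ≤ 1 + Real.exp (Real.exp Q) := by nlinarith [norm_nonneg (Y t)]
  have hX : X t β = A t (Y t) + X t α₀ := by rw [hAY t ht, sub_add_cancel]
  rw [hX]
  refine (norm_add_le _ _).trans (add_le_add ?_ (hJA t ht).2.le)
  exact ((A t).le_opNorm _).trans (mul_le_mul (hA2 t ht) hYt' (norm_nonneg _) (by norm_num))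

theorem exists_flow_bound (hK0 : 0 ≤ K)
    (hZ : ∀ t, 0 ≤ t → ∀ h x, ‖secDiff (v t) h x‖ ≤ K * ‖h‖)
    (hlin : ∀ t, 0 ≤ t → ∃ a b, 0 ≤ b ∧ ∀ x, ‖v t x‖ ≤ a + b * ‖x‖)
    (hflow : ∀ t α, HasDerivAt (fun s => X s α) (v t (X t α)) t)
    (hsurj : ∀ t, Function.Surjective (X t)) (hX0 : ∀ α, X 0 α = α) (T R : ℝ) :
    ∃ R', ∀ t, 0 ≤ t → t ≤ T → ∀ β, ‖β‖ ≤ R → ‖X t β‖ ≤ R' := by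
  let P : ℝ → Prop := fun T => ∀ R, ∃ R', ∀ t, 0 ≤ t → t ≤ T → ∀ β, ‖β‖ ≤ R → ‖X t β‖ ≤ R'
  suffices h : P T from h R
  by_contra hPT
  have hdown : ∀ a b, a ≤ b → P b → P a := fun a b hab hb R => by
    obtain ⟨R', h⟩ := hb R
    exact ⟨R', fun t h0 ht => h t h0 (ht.trans hab)⟩
  have hP0 : P 0 := fun R => ⟨R, fun t h0 ht β hβ => by
    rw [le_antisymm ht h0, hX0]; exact hβ⟩
  set S := {T | P T} with hS
  have hSb : BddAbove S := ⟨T, fun s hs => by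
    by_contra h
    exact hPT (hdown _ _ (not_le.1 h).le hs)⟩
  have ht₀ : 0 ≤ sSup S := le_csSup hSb hP0
  set t₀ := sSup S with ht₀'
  obtain ⟨δ, hδ, hnear⟩ := exists_flow_bound_near hK0 hZ hlin hflow hsurj t₀
  obtain ⟨s, hsS, hs⟩ := exists_lt_of_lt_csSup (s := S) ⟨0, hP0⟩ (show t₀ - δ < sSup S by linarith)
  have hPm : P (max s 0) := by
    rcases max_choice s 0 with h | h <;> rw [h] <;> assumption
  have hst : max s 0 ≤ t₀ := le_csSup hSb hPm
  have hmem : P (t₀ + δ / 2) := by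
    intro R
    obtain ⟨R₁, h₁⟩ := hPm R
    obtain ⟨R₂, h₂⟩ := hnear R₁
    refine ⟨max R₁ R₂, fun t ht0 ht β hβ => ?_⟩
    rcases le_total t (max s 0) with h | h
    · exact (h₁ t ht0 h β hβ).trans (le_max_left _ _)
    · have hs1 : s ≤ max s 0 := le_max_left _ _
      refine (h₂ (max s 0) t (le_max_right _ _) ht0 ?_ ?_ β
        (h₁ _ (le_max_right _ _) le_rfl β hβ)).trans (le_max_right _ _) <;>
      rw [abs_lt] <;> constructor <;> linarith
  have := le_csSup hSb hmem
  linarith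

end Frame

end

section

open Filter Topology

theorem norm_le_exp_mul_of_norm_deriv_le {E : Type*} [NormedAddCommGroup E] [InnerProductSpace ℝ E]
    {z z' : ℝ → E} {lam Lam : ℝ → ℝ} {T : ℝ} (hz : ∀ t, HasDerivAt z (z' t) t)
    (hL : ∀ t, HasDerivAt Lam (lam t) t) (hL0 : Lam 0 = 0)
    (hb : ∀ t, 0 ≤ t → t ≤ T → ‖z' t‖ ≤ lam t * ‖z t‖) {t : ℝ} (h0 : 0 ≤ t) (ht : t ≤ T) :
    ‖z t‖ ≤ Real.exp (Lam t) * ‖z 0‖ ∧ ‖z 0‖ ≤ Real.exp (Lam t) * ‖z t‖ := by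
  have hd : ∀ (ε : ℝ) t, HasDerivAt (fun t => Real.exp (ε * (2 * Lam t)) * ‖z t‖ ^ 2)
      (Real.exp (ε * (2 * Lam t)) * (ε * (2 * lam t) * ‖z t‖ ^ 2 + 2 * inner ℝ (z t) (z' t))) t := by
    intro ε t
    have := ((((hL t).const_mul 2).const_mul ε).exp).mul (hz t).norm_sq
    refine this.congr_deriv ?_
    ring1
  have hin : ∀ s, 0 ≤ s → s ≤ T → |2 * inner ℝ (z s) (z' s)| ≤ 2 * lam s * ‖z s‖ ^ 2 := by
    intro s hs hsT
    rw [abs_mul, abs_two]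
    have h1 : |inner ℝ (z s) (z' s)| ≤ ‖z s‖ * ‖z' s‖ := abs_real_inner_le_norm _ _
    have h2 : ‖z s‖ * ‖z' s‖ ≤ ‖z s‖ * (lam s * ‖z s‖) := by gcongr; exact hb s hs hsT
    nlinarith
  have hm : t ∈ Icc 0 T := ⟨h0, ht⟩
  have hm0 : (0 : ℝ) ∈ Icc 0 T := ⟨le_rfl, h0.trans ht⟩
  have hc : ∀ ε : ℝ, ContinuousOn (fun t => Real.exp (ε * (2 * Lam t)) * ‖z t‖ ^ 2) (Icc 0 T) :=
    fun ε t _ => (hd ε t).continuousAt.continuousWithinAt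
  have hexp : Real.exp (2 * Lam t) = Real.exp (Lam t) ^ 2 := by rw [two_mul, Real.exp_add, sq]
  constructor
  · have := antitoneOn_of_deriv_nonpos (convex_Icc 0 T) (hc (-1))
      (fun s _ => (hd (-1) s).differentiableAt.differentiableWithinAt) (fun s hs => by
        rw [interior_Icc] at hs
        rw [(hd (-1) s).deriv]
        have := le_of_abs_le (hin s hs.1.le hs.2.le)
        exact mul_nonpos_of_nonneg_of_nonpos (Real.exp_pos _).le (by linarith)) hm0 hm h0
    simp only [hL0, mul_zero, Real.exp_zero, one_mul, neg_mul, Real.exp_neg, hexp] at this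
    rw [inv_mul_le_iff₀ (by positivity), ← mul_pow] at this
    exact (pow_le_pow_iff_left₀ (norm_nonneg _) (by positivity) two_ne_zero).1 this
  · have := monotoneOn_of_deriv_nonneg (convex_Icc 0 T) (hc 1)
      (fun s _ => (hd 1 s).differentiableAt.differentiableWithinAt) (fun s hs => by
        rw [interior_Icc] at hs
        rw [(hd 1 s).deriv]
        have := neg_le_of_abs_le (hin s hs.1.le hs.2.le)
        exact mul_nonneg (Real.exp_pos _).le (by linarith)) hm0 hm h0
    simp only [hL0, mul_zero, Real.exp_zero, one_mul, hexp, ← mul_pow] at this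
    exact (pow_le_pow_iff_left₀ (norm_nonneg _) (by positivity) two_ne_zero).1 this

/-- Flows of log-Lipschitz fields have Hölder inverses. -/
theorem sq_le_of_logLipschitz {E : Type*} [NormedAddCommGroup E] [InnerProductSpace ℝ E]
    {z z' : ℝ → E} {B T : ℝ} (hB : 0 ≤ B) (hz : ∀ t, HasDerivAt z (z' t) t) (hne : ∀ t, z t ≠ 0)
    (hb : ∀ t, 0 ≤ t → t ≤ T → ‖z' t‖ ≤ B * (‖z t‖ * (1 + Real.log (1 + 1 / ‖z t‖))))
    {t : ℝ} (h0 : 0 ≤ t) (ht : t ≤ T) :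
    min ‖z 0‖ 1 ^ 2 ≤ 2 * Real.exp 1 * ‖z t‖ ^ (2 * Real.exp (-(18 * B * T))) := by
  have hpos : ∀ t, 0 < ‖z t‖ := fun t => norm_pos_iff.2 (hne t)
  set Y : ℝ → E := fun t => (‖z t‖ ^ 2)⁻¹ • z t with hY
  have hYn : ∀ t, ‖Y t‖ = 1 / ‖z t‖ := fun t => by
    have := hpos t
    rw [hY, norm_smul, Real.norm_of_nonneg (by positivity)]
    field_simp
  have hYd : ∀ t, HasDerivAt Y ((‖z t‖ ^ 2)⁻¹ • z' t +
      (-(2 * inner ℝ (z t) (z' t)) / (‖z t‖ ^ 2) ^ 2) • z t) t := fun t =>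
    ((hz t).norm_sq.inv (by have := hpos t; positivity)).smul (hz t)
  have hO := log_one_add_log_le_of_deriv_le (convex_Icc 0 T) (C := 3 * B) (by positivity)
    (fun t _ => hYd t) (fun t ht => by
      have p := hpos t
      rw [hYn]
      have h1 : ‖(‖z t‖ ^ 2)⁻¹ • z' t‖ = ‖z' t‖ / ‖z t‖ ^ 2 := by
        rw [norm_smul, Real.norm_of_nonneg (by positivity)]; field_simp
      have h2 : ‖(-(2 * inner ℝ (z t) (z' t)) / (‖z t‖ ^ 2) ^ 2) • z t‖ ≤
          2 * (‖z' t‖ / ‖z t‖ ^ 2) := by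
        rw [norm_smul, norm_div, norm_neg, norm_mul, Real.norm_ofNat,
          Real.norm_of_nonneg (by positivity : (0:ℝ) ≤ (‖z t‖ ^ 2) ^ 2)]
        have : ‖inner ℝ (z t) (z' t)‖ ≤ ‖z t‖ * ‖z' t‖ := norm_inner_le_norm _ _
        calc _ ≤ 2 * (‖z t‖ * ‖z' t‖) / (‖z t‖ ^ 2) ^ 2 * ‖z t‖ := by gcongr
          _ = _ := by field_simp
      have h3 : ‖z' t‖ / ‖z t‖ ^ 2 ≤ B * (1 / ‖z t‖ * (1 + Real.log (1 + 1 / ‖z t‖))) := by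
        rw [div_le_iff₀ (by positivity)]
        refine (hb t ht.1 ht.2).trans_eq ?_
        field_simp
      have l0 : 0 ≤ Real.log (1 + 1 / ‖z t‖) := Real.log_nonneg (by
        have : 0 < 1 / ‖z t‖ := by positivity
        linarith)
      calc _ ≤ ‖z' t‖ / ‖z t‖ ^ 2 + 2 * (‖z' t‖ / ‖z t‖ ^ 2) := (norm_add_le _ _).trans (by linarith)
        _ ≤ 3 * (B * (1 / ‖z t‖ * (1 + Real.log (1 + 1 / ‖z t‖)))) := by linarith
        _ ≤ 3 * (B * ((1 + 1 / ‖z t‖) * (1 + Real.log (1 + 1 / ‖z t‖)))) := by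
          gcongr; linarith
        _ = _ := by ring)
    (s := 0) (t := t) ⟨le_rfl, h0.trans ht⟩ ⟨h0, ht⟩
  rw [hYn, hYn, sub_zero, abs_of_nonneg h0] at hO
  set κ := Real.exp (18 * B * T) with hκ
  have hκ0 : 0 < κ := Real.exp_pos _
  set a := 1 + (1 / ‖z 0‖) ^ 2 with ha
  set b := 1 + (1 / ‖z t‖) ^ 2 with hb'
  have p0 := hpos 0
  have pt := hpos t
  have ha1 : 1 < a := by have : 0 < (1 / ‖z 0‖) ^ 2 := by positivity
                         linarith
  have hb1 : 1 < b := by have : 0 < (1 / ‖z t‖) ^ 2 := by positivity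
                         linarith
  have hla : 0 < Real.log a := Real.log_pos ha1
  have hlb : 0 < Real.log b := Real.log_pos hb1
  have h1 : 1 + Real.log b ≤ (1 + Real.log a) * κ := by
    have h2 : Real.log (1 + Real.log b) ≤ Real.log (1 + Real.log a) + 18 * B * T := by
      have : 6 * (3 * B) * t ≤ 6 * (3 * B) * T := by gcongr
      linarith
    have := Real.exp_le_exp.2 h2
    rwa [Real.exp_add, Real.exp_log (by linarith), Real.exp_log (by linarith)] at this
  -- `b ≤ (e a) ^ κ`
  have h2 : Real.log b * κ⁻¹ ≤ 1 + Real.log a := by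
    rw [← div_eq_mul_inv, div_le_iff₀ hκ0]; linarith
  have h3 : b ^ κ⁻¹ ≤ Real.exp 1 * a := by
    rw [Real.rpow_def_of_pos (by linarith)]
    refine (Real.exp_le_exp.2 h2).trans_eq ?_
    rw [Real.exp_add, Real.exp_log (by linarith)]
  have h4 : (1 / ‖z t‖ ^ 2) ^ κ⁻¹ ≤ Real.exp 1 * a := by
    refine le_trans ?_ h3
    gcongr
    rw [hb', div_pow, one_pow]; linarith
  have h5 : (‖z t‖ ^ 2) ^ κ⁻¹ = ‖z t‖ ^ (2 * Real.exp (-(18 * B * T))) := by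
    rw [Real.exp_neg, ← hκ, Real.rpow_mul (norm_nonneg _), Real.rpow_two]
  rw [Real.div_rpow zero_le_one (by positivity), Real.one_rpow, h5] at h4
  set P := ‖z t‖ ^ (2 * Real.exp (-(18 * B * T))) with hP
  have hPp : 0 < P := by positivity
  rw [div_le_iff₀ hPp] at h4
  set m := min ‖z 0‖ 1 with hm
  have hm0 : 0 < m := lt_min p0 one_pos
  have hma : m ^ 2 * a ≤ 2 := by
    have e1 : m ^ 2 ≤ 1 := by
      have : m ≤ 1 := min_le_right _ _
      nlinarith
    have e2 : m ^ 2 * (1 / ‖z 0‖) ^ 2 ≤ 1 := by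
      rw [← mul_pow]
      have : m * (1 / ‖z 0‖) ≤ 1 := by
        rw [mul_one_div, div_le_one p0]; exact min_le_left _ _
      exact pow_le_one₀ (by positivity) this
    rw [ha]; linarith
  calc m ^ 2 = m ^ 2 * 1 := by ring
    _ ≤ m ^ 2 * (Real.exp 1 * a * P) := by gcongr
    _ = m ^ 2 * a * Real.exp 1 * P := by ring
    _ ≤ 2 * Real.exp 1 * P := by gcongr

end

section

open Filter Topology

/-- A bounded, compactly supported Hölder density transported by the flow of its own velocity. -/
structure TransportData {n : ℕ} (k : Euc n → Euc n) (γ A H R₀ : ℝ) (ρ₀ : Euc n → ℝ)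
    (ρ : ℝ → Euc n → ℝ) (X : ℝ → Euc n → Euc n) : Prop where
  kernel : IsHomKernel k
  exp_pos : 0 < γ
  exp_lt_one : γ < 1
  holder_nonneg : 0 ≤ H
  radius_pos : 0 < R₀
  bound : ∀ α, |ρ₀ α| ≤ A
  holder : ∀ α β, |ρ₀ α - ρ₀ β| ≤ H * ‖α - β‖ ^ γ
  support : ∀ α, ρ₀ α ≠ 0 → ‖α‖ ≤ R₀
  aemeas : ∀ t, 0 ≤ t → AEMeasurable (ρ t) volume
  transp : ∀ t α, ρ t (X t α) = ρ₀ α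
  bij : ∀ t, Function.Bijective (X t)
  flow : ∀ t α, HasDerivAt (fun s => X s α) (convVel k (ρ t) (X t α)) t
  flow_zero : ∀ α, X 0 α = α

/-- Both the flow map at time `t` and its inverse are Lipschitz with constant `exp a`. -/
def Distort {n : ℕ} (X : ℝ → Euc n → Euc n) (t a : ℝ) : Prop :=
  ∀ α β, ‖α - β‖ ≤ Real.exp a * ‖X t α - X t β‖ ∧ ‖X t α - X t β‖ ≤ Real.exp a * ‖α - β‖

namespace TransportData

variable {n : ℕ} {k : Euc n → Euc n} {γ A H R₀ : ℝ} {ρ₀ : Euc n → ℝ}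
    {ρ : ℝ → Euc n → ℝ} {X : ℝ → Euc n → Euc n}

theorem bound_nonneg (d : TransportData k γ A H R₀ ρ₀ ρ X) : 0 ≤ A :=
  (abs_nonneg _).trans (d.bound 0)

theorem abs_le (d : TransportData k γ A H R₀ ρ₀ ρ X) (t : ℝ) (y : Euc n) : |ρ t y| ≤ A := by
  obtain ⟨α, rfl⟩ := (d.bij t).2 y
  rw [d.transp]
  exact d.bound α

theorem holder_min (d : TransportData k γ A H R₀ ρ₀ ρ X) (α β : Euc n) :
    |ρ₀ α - ρ₀ β| ≤ (H + 2 * A) * min ‖α - β‖ 1 ^ γ := by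
  have hA := d.bound_nonneg
  have hH := d.holder_nonneg
  rcases le_total ‖α - β‖ 1 with h | h
  · rw [min_eq_left h]
    refine (d.holder α β).trans ?_
    gcongr
    linarith
  · rw [min_eq_right h, Real.one_rpow, mul_one]
    have h1 := abs_sub (ρ₀ α) (ρ₀ β)
    have h2 := d.bound α
    have h3 := d.bound β
    linarith

theorem distort_of_lipschitz (d : TransportData k γ A H R₀ ρ₀ ρ X) {lam Lam : ℝ → ℝ} {T : ℝ}
    (hL : ∀ t, HasDerivAt Lam (lam t) t) (hL0 : Lam 0 = 0)
    (hb : ∀ t, 0 ≤ t → t ≤ T → ∀ x y,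
      ‖convVel k (ρ t) x - convVel k (ρ t) y‖ ≤ lam t * ‖x - y‖)
    {t : ℝ} (h0 : 0 ≤ t) (ht : t ≤ T) : Distort X t (Lam t) := by
  intro α β
  have := norm_le_exp_mul_of_norm_deriv_le (z := fun s => X s α - X s β)
    (fun s => (d.flow s α).fun_sub (d.flow s β)) hL hL0 (fun s h1 h2 => hb s h1 h2 _ _) h0 ht
  simp only [d.flow_zero] at this
  exact ⟨this.2, this.1⟩

theorem exists_lipschitz_on (d : TransportData k γ A H R₀ ρ₀ ρ X) (T : ℝ) :
    ∃ L, 0 ≤ L ∧ ∀ t, 0 ≤ t → t ≤ T → ∀ x y,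
      ‖convVel k (ρ t) x - convVel k (ρ t) y‖ ≤ L * ‖x - y‖ := by
  have hA := d.bound_nonneg
  have hH := d.holder_nonneg
  obtain ⟨C₁, hC₁, h₁⟩ := d.kernel.exists_norm_convVel_le
  obtain ⟨C₂, hC₂, h₂⟩ := d.kernel.exists_norm_secDiff_convVel_le
  have hZ : ∀ t, 0 ≤ t → ∀ h x, ‖secDiff (convVel k (ρ t)) h x‖ ≤ C₂ * A * ‖h‖ := fun t ht =>
    h₂ (ρ t) A (d.aemeas t ht) (d.abs_le t)
  have hK0 : 0 ≤ C₂ * A := by positivity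
  obtain ⟨R', hR'⟩ := exists_flow_bound (v := fun t => convVel k (ρ t)) hK0 hZ
    (fun t ht => d.kernel.exists_norm_convVel_le_linear (d.aemeas t ht) (d.abs_le t)) d.flow
    (fun t => (d.bij t).2) d.flow_zero T R₀
  set V := C₁ * A * (|R'| + 1) with hV
  have hV0 : 0 ≤ V := by positivity
  have hVb : ∀ t, 0 ≤ t → t ≤ T → ∀ x, ‖convVel k (ρ t) x‖ ≤ V := fun t h0 hT =>
    h₁ (ρ t) A (d.abs_le t) 0 (|R'| + 1) (by positivity) (fun y hy => by
      obtain ⟨α, rfl⟩ := (d.bij t).2 y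
      rw [d.transp] at hy
      rw [mem_closedBall_zero_iff]
      have := hR' t h0 hT α (d.support α hy)
      linarith [le_abs_self R'])
  set B := 2 * V + C₂ * A with hB
  have hB0 : 0 ≤ B := by positivity
  have hlog : ∀ t, 0 ≤ t → t ≤ T → ∀ x y, x ≠ y →
      ‖convVel k (ρ t) x - convVel k (ρ t) y‖ ≤
        B * (‖x - y‖ * (1 + Real.log (1 + 1 / ‖x - y‖))) := fun t h0 hT x y hxy => by
    have := norm_incr_le_log (hZ t h0) hK0 (hVb t h0 hT) one_pos y (x - y) (sub_ne_zero.2 hxy)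
    rw [add_sub_cancel] at this
    refine this.trans ?_
    have hl : 0 ≤ Real.log (1 + 1 / ‖x - y‖) := Real.log_nonneg (by
      have : 0 ≤ 1 / ‖x - y‖ := by positivity
      linarith)
    rw [mul_left_comm B]
    refine mul_le_mul_of_nonneg_left ?_ (norm_nonneg _)
    rw [hB, div_one]
    nlinarith [mul_nonneg hV0 hl]
  set p := Real.exp (-(18 * B * |T|)) with hp
  have hp0 : 0 < p := Real.exp_pos _
  have hp1 : p ≤ 1 := Real.exp_le_one_iff.2 (by
    have : 0 ≤ 18 * B * |T| := by positivity
    linarith)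
  set H' := (H + 2 * A) * (2 * Real.exp 1) ^ (γ / 2) with hH'
  have hH'0 : 0 ≤ H' := by positivity
  have hγp0 : 0 < γ * p := mul_pos d.exp_pos hp0
  have hγp1 : γ * p < 1 := by nlinarith [d.exp_pos, d.exp_lt_one]
  have hhol : ∀ t, 0 ≤ t → t ≤ T → ∀ x y, |ρ t x - ρ t y| ≤ H' * ‖x - y‖ ^ (γ * p) := by
    intro t h0 hT x y
    obtain ⟨α, rfl⟩ := (d.bij t).2 x
    obtain ⟨β, rfl⟩ := (d.bij t).2 y
    rcases eq_or_ne α β with rfl | hne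
    · simp only [sub_self, abs_zero, norm_zero]; positivity
    rw [d.transp, d.transp]
    have hz : ∀ s, X s α - X s β ≠ 0 := fun s => sub_ne_zero.2 ((d.bij s).1.ne hne)
    have h3 := sq_le_of_logLipschitz (z := fun s => X s α - X s β) (T := |T|) hB0
      (fun s => (d.flow s α).fun_sub (d.flow s β)) hz
      (fun s hs hsT => hlog s hs (hsT.trans_eq (abs_of_nonneg (h0.trans hT))) _ _
        ((d.bij s).1.ne hne)) h0 (hT.trans (le_abs_self T))
    simp only [d.flow_zero] at h3
    rw [← hp] at h3
    refine (d.holder_min α β).trans ?_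
    rw [hH', mul_assoc]
    gcongr
    have h4 := Real.rpow_le_rpow (by positivity) h3 (z := γ / 2) (by linarith [d.exp_pos])
    have hm : 0 ≤ min ‖α - β‖ 1 := le_min (norm_nonneg _) zero_le_one
    rw [← Real.rpow_two, ← Real.rpow_mul hm, Real.mul_rpow (by positivity) (by positivity),
      ← Real.rpow_mul (norm_nonneg _)] at h4
    rw [show (2 : ℝ) * (γ / 2) = γ by ring, show 2 * p * (γ / 2) = γ * p by ring] at h4
    exact h4
  obtain ⟨C₃, hC₃, h₃⟩ := d.kernel.exists_norm_secDiff_convVel_le_of_holder hγp0 hγp1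
  refine ⟨max 0 (C₃ * H' / (2 * (2 ^ (γ * p) - 1)) * 1 ^ (γ * p) + 2 * V / 1 +
    C₂ * A * (1 / 2 + Real.log (1 + 2 * 1 / 1))), le_max_left _ _, fun t h0 hT x y => ?_⟩
  have := norm_incr_le_interpolate hγp0 (hZ t h0) hK0 (hVb t h0 hT) one_pos
    (by positivity : 0 ≤ C₃ * H')
    (h₃ (ρ t) A H' (d.aemeas t h0) (d.abs_le t) (hhol t h0 hT) hH'0) one_pos y (x - y)
  rw [add_sub_cancel, mul_comm] at this
  refine this.trans ?_
  gcongr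
  exact le_max_right _ _

theorem holder_of_distort (d : TransportData k γ A H R₀ ρ₀ ρ X) {t a : ℝ} (h : Distort X t a)
    (x y : Euc n) : |ρ t x - ρ t y| ≤ H * Real.exp (γ * a) * ‖x - y‖ ^ γ := by
  obtain ⟨α, rfl⟩ := (d.bij t).2 x
  obtain ⟨β, rfl⟩ := (d.bij t).2 y
  have hH := d.holder_nonneg
  have hγ := d.exp_pos
  rw [d.transp, d.transp]
  refine (d.holder α β).trans ?_
  rw [mul_assoc]
  gcongr
  refine (Real.rpow_le_rpow (norm_nonneg _) (h α β).1 hγ.le).trans_eq ?_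
  rw [Real.mul_rpow (Real.exp_pos _).le (norm_nonneg _), ← Real.exp_mul, mul_comm a γ]

theorem support_of_distort (d : TransportData k γ A H R₀ ρ₀ ρ X) {t a : ℝ} (h : Distort X t a)
    (y : Euc n) (hy : ρ t y ≠ 0) : y ∈ closedBall (X t 0) (R₀ * Real.exp a) := by
  obtain ⟨α, rfl⟩ := (d.bij t).2 y
  rw [d.transp] at hy
  rw [mem_closedBall_iff_norm, mul_comm]
  refine (h α 0).2.trans ?_
  rw [sub_zero]
  gcongr
  exact d.support α hy

theorem exists_lipschitz_of_distort (d : TransportData k γ A H R₀ ρ₀ ρ X) :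
    ∃ C, 0 < C ∧ ∀ t a, 0 ≤ t → 0 ≤ a → Distort X t a → ∀ x y,
      ‖convVel k (ρ t) x - convVel k (ρ t) y‖ ≤ C * (1 + a) * ‖x - y‖ := by
  have hA := d.bound_nonneg
  have hH := d.holder_nonneg
  have hγ := d.exp_pos
  have hR := d.radius_pos
  obtain ⟨C₁, hC₁, h₁⟩ := d.kernel.exists_norm_convVel_le
  obtain ⟨C₂, hC₂, h₂⟩ := d.kernel.exists_norm_secDiff_convVel_le
  obtain ⟨C₃, hC₃, h₃⟩ := d.kernel.exists_norm_secDiff_convVel_le_of_holder hγ d.exp_lt_one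
  have hq : 0 < (2 : ℝ) ^ γ - 1 := by
    have := Real.one_lt_rpow one_lt_two hγ
    linarith
  have hl : 0 ≤ Real.log (1 + 2 * R₀) := Real.log_nonneg (by linarith)
  set c₁ := C₃ * H / (2 * (2 ^ γ - 1)) with hc₁
  have hc₁0 : 0 ≤ c₁ := by positivity
  refine ⟨c₁ + 2 * (C₁ * A) + C₂ * A * (3 + Real.log (1 + 2 * R₀)) + 1, by positivity,
    fun t a ht ha h x y => ?_⟩
  have hE : 0 < Real.exp a := Real.exp_pos a
  have key := norm_incr_le_interpolate hγ (h₂ (ρ t) A (d.aemeas t ht) (d.abs_le t))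
    (by positivity) (h₁ (ρ t) A (d.abs_le t) (X t 0) (R₀ * Real.exp a) (by positivity)
      (d.support_of_distort h)) (by positivity : 0 < R₀ * Real.exp a)
    (by positivity) (h₃ (ρ t) A _ (d.aemeas t ht) (d.abs_le t) (d.holder_of_distort h)
      (by positivity)) (Real.exp_pos (-a)) y (x - y)
  rw [add_sub_cancel] at key
  refine key.trans ?_
  rw [mul_comm]
  refine mul_le_mul_of_nonneg_right ?_ (norm_nonneg _)
  have e1 : C₃ * (H * Real.exp (γ * a)) / (2 * (2 ^ γ - 1)) * Real.exp (-a) ^ γ = c₁ := by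
    rw [← Real.exp_mul, show -a * γ = -(γ * a) by ring, Real.exp_neg, hc₁]
    have := Real.exp_pos (γ * a)
    field_simp
  have e2 : 2 * (C₁ * A * (R₀ * Real.exp a)) / (R₀ * Real.exp a) = 2 * (C₁ * A) := by
    field_simp
  have e3 : Real.log (1 + 2 * (R₀ * Real.exp a) / Real.exp (-a)) ≤
      Real.log (1 + 2 * R₀) + 2 * a := by
    have h1 : 1 ≤ Real.exp (2 * a) := Real.one_le_exp (by linarith)
    calc _ = Real.log (1 + 2 * R₀ * Real.exp (2 * a)) := by
          rw [Real.exp_neg, two_mul a, Real.exp_add, div_inv_eq_mul]; ring_nf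
      _ ≤ Real.log ((1 + 2 * R₀) * Real.exp (2 * a)) := by
          apply Real.log_le_log (by positivity)
          nlinarith
      _ = _ := by rw [Real.log_mul (by positivity) (by positivity), Real.log_exp]
  rw [e1, e2]
  have e4 : C₂ * A * (1 / 2 + Real.log (1 + 2 * (R₀ * Real.exp a) / Real.exp (-a))) ≤
      C₂ * A * (3 + Real.log (1 + 2 * R₀)) * (1 + a) := by
    rw [mul_assoc (C₂ * A)]
    gcongr
    nlinarith
  have e5 : (c₁ + 2 * (C₁ * A)) * 1 ≤ (c₁ + 2 * (C₁ * A)) * (1 + a) := by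
    gcongr
    linarith
  nlinarith

theorem exists_lipschitz_exp (d : TransportData k γ A H R₀ ρ₀ ρ X) :
    ∃ C, 0 < C ∧ ∀ t, 0 ≤ t → Distort X t (3 * Real.exp (C * t) - 1) ∧ ∀ x y,
      ‖convVel k (ρ t) x - convVel k (ρ t) y‖ ≤ C * (3 * Real.exp (C * t)) * ‖x - y‖ := by
  obtain ⟨C, hC, hCd⟩ := d.exists_lipschitz_of_distort
  have mono : ∀ {t a b : ℝ}, a ≤ b → Distort X t a → Distort X t b := fun hab h α β =>
    ⟨(h α β).1.trans (by gcongr), (h α β).2.trans (by gcongr)⟩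
  have hexp : ∀ t, 0 ≤ t → 1 ≤ Real.exp (2 * C * t) := fun t ht => Real.one_le_exp (by positivity)
  have step : ∀ T B, 1 ≤ B →
      (∀ t, 0 ≤ t → t ≤ T → Distort X t (B * Real.exp (2 * C * t) - 1)) →
      ∀ t, 0 ≤ t → t ≤ T → Distort X t ((1 + B / 2) * Real.exp (2 * C * t) - 1) := by
    intro T B hB h t h0 hT
    have hL : ∀ s, HasDerivAt (fun s => B / 2 * (Real.exp (2 * C * s) - 1))
        (C * (B * Real.exp (2 * C * s))) s := fun s => by
      have := ((((hasDerivAt_id s).const_mul (2 * C)).exp).sub_const 1).const_mul (B / 2)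
      refine this.congr_deriv ?_
      simp only [id_eq]
      ring
    refine mono ?_ (d.distort_of_lipschitz (T := T) hL (by simp) (fun s hs hsT x y => ?_) h0 hT)
    · have := hexp t h0
      nlinarith
    · have h1 := hexp s hs
      refine (hCd s _ hs (by nlinarith) (h s hs hsT) x y).trans_eq ?_
      ring
  have main : ∀ t, 0 ≤ t → Distort X t (3 * Real.exp (2 * C * t) - 1) := by
    intro T hT0
    obtain ⟨L, hL0, hL⟩ := d.exists_lipschitz_on T
    have iter : ∀ m : ℕ, ∀ t, 0 ≤ t → t ≤ T →
        Distort X t ((2 + L * T / 2 ^ m) * Real.exp (2 * C * t) - 1) := by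
      intro m
      induction m with
      | zero =>
        intro t h0 hT
        refine mono ?_ (d.distort_of_lipschitz (lam := fun _ => L) (Lam := fun s => L * s) (T := T)
          (fun s => by simpa using (hasDerivAt_id s).const_mul L) (by simp) hL h0 hT)
        have h1 := hexp t h0
        have h2 : L * t ≤ L * T := by gcongr
        have h3 : 0 ≤ L * t := by positivity
        simp only [pow_zero, div_one]
        nlinarith
      | succ m ih =>
        intro t h0 hT
        have h3 : 0 ≤ L * T / 2 ^ m := by positivity
        have := step T _ (by linarith) ih t h0 hT
        rw [pow_succ]
        convert this using 3
        field_simp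
        ring
    obtain ⟨m, hm⟩ := pow_unbounded_of_one_lt (L * T) one_lt_two
    refine mono ?_ (iter m T hT0 le_rfl)
    have : L * T / 2 ^ m ≤ 1 := (div_le_one (by positivity)).2 hm.le
    gcongr
    linarith
  refine ⟨2 * C, by positivity, fun t ht => ⟨main t ht, fun x y => ?_⟩⟩
  have h1 := hexp t ht
  refine (hCd t _ ht (by linarith) (main t ht) x y).trans ?_
  gcongr ?_ * _
  nlinarith [mul_pos hC (Real.exp_pos (2 * C * t))]

end TransportData

end

section

open Filter Topology

theorem abs_apply_single_le {n : ℕ} (D : Euc n →L[ℝ] Euc n) (i j : Fin n) :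
    |D (EuclideanSpace.single j 1) i| ≤ ‖D‖ := by
  refine (PiLp.norm_apply_le (D (EuclideanSpace.single j 1)) i).trans ?_
  refine (D.le_opNorm _).trans_eq ?_
  rw [PiLp.norm_single, norm_one, mul_one]

theorem pd_apply_eq {n : ℕ} {F : Euc n → Euc n} {D : Euc n →L[ℝ] Euc n} {x : Euc n}
    (h : HasFDerivAt F D x) (i j : Fin n) :
    pd j (fun y => F y i) x = D (EuclideanSpace.single j 1) i := by
  have h1 : HasFDerivAt (fun y => F y i)
      ((EuclideanSpace.proj i : Euc n →L[ℝ] ℝ).comp D) x :=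
    (EuclideanSpace.proj i : Euc n →L[ℝ] ℝ).hasFDerivAt.comp x h
  rw [pd, h1.fderiv]
  rfl

theorem abs_pd_le_of_lipschitz {n : ℕ} {F : Euc n → Euc n} {L : ℝ} (hL0 : 0 ≤ L)
    (hL : ∀ x y, ‖F x - F y‖ ≤ L * ‖x - y‖) (i j : Fin n) (x : Euc n) :
    |pd j (fun y => F y i) x| ≤ L := by
  have h1 : LipschitzWith ⟨L, hL0⟩ fun y => F y i := LipschitzWith.of_dist_le_mul fun x y => by
    rw [dist_eq_norm, dist_eq_norm]
    exact (PiLp.norm_apply_le (F x - F y) i).trans (hL x y)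
  have h2 := norm_fderiv_le_of_lipschitz ℝ h1 (x₀ := x)
  refine ((fderiv ℝ (fun y => F y i) x).le_opNorm (EuclideanSpace.single j 1)).trans ?_
  rw [PiLp.norm_single, norm_one, mul_one]
  exact h2

theorem gradSupR_le_of_lipschitz {n : ℕ} {F : Euc n → Euc n} {L : ℝ} (hL0 : 0 ≤ L)
    (hL : ∀ x y, ‖F x - F y‖ ≤ L * ‖x - y‖) : gradSupR F ≤ L :=
  Real.iSup_le (fun q => abs_pd_le_of_lipschitz hL0 hL q.1.1 q.1.2 q.2) hL0

theorem gradSupR_nonneg {n : ℕ} (F : Euc n → Euc n) : 0 ≤ gradSupR F :=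
  Real.iSup_nonneg fun _ => abs_nonneg _

theorem ciSup_comp_denseRange {ι β κ : Type*} [TopologicalSpace β] {e : κ → β} (he : DenseRange e)
    {φ : ι → β → ℝ} (hφ : ∀ i, Continuous (φ i)) (hp : ∀ i b, 0 ≤ φ i b) {M : ℝ}
    (hM : ∀ i b, φ i b ≤ M) :
    ⨆ q : ι × β, φ q.1 q.2 = ⨆ q : ι × κ, φ q.1 (e q.2) := by
  have b2 : BddAbove (range fun q : ι × κ => φ q.1 (e q.2)) :=
    ⟨M, by rintro _ ⟨q, rfl⟩; exact hM _ _⟩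
  have b1 : BddAbove (range fun q : ι × β => φ q.1 q.2) :=
    ⟨M, by rintro _ ⟨q, rfl⟩; exact hM _ _⟩
  refine le_antisymm (Real.iSup_le (fun q => ?_) (Real.iSup_nonneg fun q => hp _ _))
    (Real.iSup_le (fun q => le_ciSup b1 (q.1, e q.2)) (Real.iSup_nonneg fun q => hp _ _))
  exact he.induction_on (p := fun b => φ q.1 b ≤ _) q.2
    (isClosed_le (hφ q.1) continuous_const) fun a => le_ciSup b2 (q.1, a)

/-- The gradient sup norm of a time-dependent field is measurable in time. -/
theorem measurable_gradSupR {n : ℕ} {w : ℝ → Euc n → Euc n} (hw : ∀ x, Continuous fun s => w s x)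
    {D : ℝ → Euc n → Euc n →L[ℝ] Euc n} (hD : ∀ s x, HasFDerivAt (w s) (D s x) x)
    (hDc : ∀ s, Continuous (D s)) {M : ℝ} (hM : ∀ s x, ‖D s x‖ ≤ M) :
    Measurable fun s => gradSupR (w s) := by
  have e : ∀ s, gradSupR (w s) = ⨆ q : (Fin n × Fin n) × ℕ,
      |D s (TopologicalSpace.denseSeq (Euc n) q.2) (EuclideanSpace.single q.1.2 1) q.1.1| := by
    intro s
    rw [← ciSup_comp_denseRange (TopologicalSpace.denseRange_denseSeq (Euc n))
      (φ := fun (i : Fin n × Fin n) x => |D s x (EuclideanSpace.single i.2 1) i.1|)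
      (fun i => ?_) (fun _ _ => abs_nonneg _)
      (fun i x => (abs_apply_single_le _ _ _).trans (hM s x))]
    · exact iSup_congr fun q => by rw [pd_apply_eq (hD s q.2)]
    · have := (EuclideanSpace.proj i.1 : Euc n →L[ℝ] ℝ).continuous.comp
        ((hDc s).clm_apply (continuous_const (y := (EuclideanSpace.single i.2 1 : Euc n))))
      exact this.abs
  simp_rw [e]
  refine Measurable.iSup fun q => ?_
  set x := TopologicalSpace.denseSeq (Euc n) q.2
  set u : Euc n := EuclideanSpace.single q.1.2 1
  have hm : Measurable fun s => D s x u := by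
    refine measurable_of_tendsto_metrizable
      (f := fun (m : ℕ) s => (m : ℝ) • (w s (x + (m : ℝ)⁻¹ • u) - w s x)) (fun m => ?_) ?_
    · exact (((hw (x + (m : ℝ)⁻¹ • u)).sub (hw x)).const_smul (m : ℝ)).measurable
    · rw [tendsto_pi_nhds]
      intro s
      refine (hD s x).lim u ?_
      simp only [Real.norm_natCast]
      exact tendsto_natCast_atTop_atTop
  have := (EuclideanSpace.proj q.1.1 : Euc n →L[ℝ] ℝ).continuous.measurable.comp hm
  exact continuous_abs.measurable.comp this

theorem continuous_of_holder {E F : Type*} [NormedAddCommGroup E] [NormedAddCommGroup F]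
    {f : E → F} {C γ : ℝ} (hγ : 0 < γ) (h : ∀ x y, ‖f x - f y‖ ≤ C * ‖x - y‖ ^ γ) :
    Continuous f := by
  rw [continuous_iff_continuousAt]
  intro x
  rw [ContinuousAt, tendsto_iff_norm_sub_tendsto_zero]
  refine squeeze_zero (fun _ => norm_nonneg _) (fun y => h y x) ?_
  have : Continuous fun y => C * ‖y - x‖ ^ γ :=
    ((continuous_id.sub continuous_const).norm.rpow_const fun _ => Or.inr hγ.le).const_mul C
  simpa [Real.zero_rpow hγ.ne'] using this.tendsto x

theorem secDiff_apply_sub {E F : Type*} [AddCommGroup E] [AddCommGroup F] [Module ℝ F]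
    (f : E → F) (x p q : E) :
    f (x + p) + f (x + q) - (2 : ℝ) • f x = secDiff f p x + (f (x + q) - f (x - p)) := by
  simp only [secDiff]; abel

/-- The flow of a field with bounded `C^{1,γ}` second differences inherits that regularity. -/
theorem exists_norm_secDiff_flow_le {E : Type*} [NormedAddCommGroup E] [NormedSpace ℝ E]
    {w X : ℝ → E → E} {L C M γ T : ℝ} (hγ : 0 < γ) (hL0 : 0 < L) (hC0 : 0 ≤ C) (hM0 : 0 ≤ M)
    (hL : ∀ t, 0 ≤ t → t ≤ T → ∀ x y, ‖w t x - w t y‖ ≤ L * ‖x - y‖)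
    (hC : ∀ t, 0 ≤ t → t ≤ T → ∀ h x, ‖secDiff (w t) h x‖ ≤ C * ‖h‖ ^ (1 + γ))
    (hM : ∀ t, 0 ≤ t → t ≤ T → ∀ α β, ‖X t α - X t β‖ ≤ M * ‖α - β‖)
    (hX : ∀ t α, HasDerivAt (fun s => X s α) (w t (X t α)) t) (hX0 : ∀ α, X 0 α = α)
    (hT : 0 ≤ T) :
    ∃ C', 0 ≤ C' ∧ ∀ h α, ‖secDiff (X T) h α‖ ≤ C' * ‖h‖ ^ (1 + γ) := by
  have hexp : 0 ≤ Real.exp (L * T) - 1 := by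
    have := Real.one_le_exp (by positivity : 0 ≤ L * T)
    linarith
  refine ⟨C * M ^ (1 + γ) / L * (Real.exp (L * T) - 1), by positivity, fun h α => ?_⟩
  have hd : ∀ t, HasDerivAt (fun s => secDiff (X s) h α)
      (w t (X t (α + h)) + w t (X t (α - h)) - (2 : ℝ) • w t (X t α)) t := fun t =>
    ((hX t (α + h)).fun_add (hX t (α - h))).fun_sub ((hX t α).fun_const_smul (2 : ℝ))
  have := norm_le_gronwallBound_of_norm_deriv_right_le (δ := 0) (K := L)
    (ε := C * M ^ (1 + γ) * ‖h‖ ^ (1 + γ)) (a := 0) (b := T)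
    (fun t _ => (hd t).continuousAt.continuousWithinAt) (fun t _ => (hd t).hasDerivWithinAt)
    (by simp [secDiff, hX0, two_smul]) (fun t ht => ?_) T ⟨hT, le_rfl⟩
  · simp only [gronwallBound_of_K_ne_0 hL0.ne', sub_zero, zero_mul, zero_add] at this
    refine this.trans_eq ?_
    ring
  · set p := X t (α + h) - X t α with hp
    set q := X t (α - h) - X t α with hq
    have e := secDiff_apply_sub (w t) (X t α) p q
    rw [hp, hq, add_sub_cancel, add_sub_cancel, ← hp] at e
    rw [e]
    have b1 : ‖p‖ ≤ M * ‖h‖ := by simpa using hM t ht.1 ht.2.le (α + h) α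
    have b2 : ‖p‖ ^ (1 + γ) ≤ M ^ (1 + γ) * ‖h‖ ^ (1 + γ) := by
      rw [← Real.mul_rpow hM0 (norm_nonneg _)]
      exact Real.rpow_le_rpow (norm_nonneg _) b1 (by linarith)
    have b3 := hL t ht.1 ht.2.le (X t (α - h)) (X t α - p)
    have b4 : X t (α - h) - (X t α - p) = secDiff (X t) h α := by
      simp only [secDiff, hp, two_smul]; abel
    rw [b4] at b3
    have b5 := hC t ht.1 ht.2.le p (X t α)
    calc _ ≤ C * (M ^ (1 + γ) * ‖h‖ ^ (1 + γ)) + L * ‖secDiff (X t) h α‖ :=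
          (norm_add_le _ _).trans (add_le_add (b5.trans (by gcongr)) b3)
      _ = _ := by ring

end

section

open Filter Topology

namespace TransportData

variable {n : ℕ} {k : Euc n → Euc n} {γ A H R₀ : ℝ} {ρ₀ : Euc n → ℝ}
    {ρ : ℝ → Euc n → ℝ} {X : ℝ → Euc n → Euc n}

theorem exists_secDiff_le_of_distort (d : TransportData k γ A H R₀ ρ₀ ρ X) :
    ∃ C, 0 ≤ C ∧ ∀ t a, 0 ≤ t → Distort X t a → ∀ h x,
      ‖secDiff (convVel k (ρ t)) h x‖ ≤ C * Real.exp (γ * a) * ‖h‖ ^ (1 + γ) := by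
  have hH := d.holder_nonneg
  obtain ⟨C, hC, h⟩ := d.kernel.exists_norm_secDiff_convVel_le_of_holder d.exp_pos d.exp_lt_one
  refine ⟨C * H, by positivity, fun t a ht ha h' x => ?_⟩
  rw [mul_assoc C]
  exact h (ρ t) A _ (d.aemeas t ht) (d.abs_le t) (d.holder_of_distort ha) (by positivity) h' x

theorem continuous_convVel (d : TransportData k γ A H R₀ ρ₀ ρ X)
    (hρ : ∀ y, Continuous fun s => ρ s y) {T : ℝ} {τ : ℝ → ℝ} (hτ : Continuous τ)
    (hτT : ∀ s, 0 ≤ τ s ∧ τ s ≤ T) {a : ℝ} (ha : ∀ s, Distort X (τ s) a) (x : Euc n) :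
    Continuous fun s => convVel k (ρ (τ s)) x := by
  obtain ⟨R, hR⟩ := isCompact_Icc.exists_bound_of_continuousOn (s := Icc 0 T) (f := fun s => X s 0)
    (fun s _ => (d.flow s 0).continuousAt.continuousWithinAt)
  set R' := |R| + R₀ * Real.exp a with hR'
  have hR0 := d.radius_pos
  have hA := d.bound_nonneg
  obtain ⟨C, -, hC⟩ := d.kernel.exists_integral_closedBall_le
  have hi := ((hC x 0 R' (by positivity)).1.norm.const_mul A)
  refine continuous_of_dominated
    (bound := (closedBall (0 : Euc n) R').indicator fun y => A * ‖k (x - y)‖)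
    (fun s => d.kernel.aestronglyMeasurable_smul (d.aemeas _ (hτT s).1) x)
    (fun s => Eventually.of_forall fun y => ?_) ?_
    (Eventually.of_forall fun y => ((hρ y).comp hτ).smul continuous_const)
  · by_cases hy : ρ (τ s) y = 0
    · rw [hy, zero_smul, norm_zero]
      exact indicator_nonneg (fun _ _ => by positivity) y
    · have h1 := d.support_of_distort (ha s) y hy
      have h2 := hR (τ s) (hτT s)
      rw [mem_closedBall_iff_norm] at h1
      have h3 : y ∈ closedBall (0 : Euc n) R' := by
        rw [mem_closedBall_zero_iff]
        have := norm_le_norm_sub_add y (X (τ s) 0)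
        linarith [le_abs_self R]
      rw [indicator_of_mem h3, norm_smul]
      gcongr
      exact d.abs_le _ y
  · exact (integrable_indicator_iff measurableSet_closedBall).2 hi

theorem exists_apriori_bound (d : TransportData k γ A H R₀ ρ₀ ρ X)
    (hρ : ∀ y, Continuous fun s => ρ s y) :
    ∃ c C : ℝ, 0 < c ∧ 0 < C ∧ ∀ t : ℝ, 0 ≤ t →
      gradSupR (convVel k (ρ t)) ≤ C * Real.exp (c * t) ∧
      IntervalIntegrable (fun s => gradSupR (convVel k (ρ s))) volume 0 t ∧
      BddAbove (Set.range fun q : (Fin n × Fin n) × Euc n =>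
        |pd q.1.2 (fun y => X t y q.1.1) q.2|) ∧
      BddAbove (Set.range fun q : (Fin n × Fin n) × {p : Euc n × Euc n // p.1 ≠ p.2} =>
        |pd q.1.2 (fun y => X t y q.1.1) q.2.1.1 - pd q.1.2 (fun y => X t y q.1.1) q.2.1.2| /
          ‖q.2.1.1 - q.2.1.2‖ ^ γ) := by
  have hγ := d.exp_pos
  obtain ⟨C, hC, hCd⟩ := d.exists_lipschitz_exp
  obtain ⟨S, hS, hSd⟩ := d.exists_secDiff_le_of_distort
  refine ⟨C, C * 3, hC, by positivity, fun T hT => ?_⟩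
  set a := 3 * Real.exp (C * T) - 1 with ha
  set L := C * (3 * Real.exp (C * T)) with hLdef
  have hL0 : 0 < L := by positivity
  have hdist : ∀ t, 0 ≤ t → t ≤ T → Distort X t a := fun t h0 ht α β => by
    have hm : 3 * Real.exp (C * t) - 1 ≤ a := by rw [ha]; gcongr
    obtain ⟨h1, h2⟩ := (hCd t h0).1 α β
    exact ⟨h1.trans (by gcongr), h2.trans (by gcongr)⟩
  have hLip : ∀ t, 0 ≤ t → t ≤ T → ∀ x y,
      ‖convVel k (ρ t) x - convVel k (ρ t) y‖ ≤ L * ‖x - y‖ := fun t h0 ht x y =>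
    ((hCd t h0).2 x y).trans (by rw [hLdef]; gcongr)
  have hsec : ∀ t, 0 ≤ t → t ≤ T → ∀ h x,
      ‖secDiff (convVel k (ρ t)) h x‖ ≤ S * Real.exp (γ * a) * ‖h‖ ^ (1 + γ) := fun t h0 ht =>
    hSd t a h0 (hdist t h0 ht)
  refine ⟨?_, ?_, ?_, ?_⟩
  · rw [mul_assoc]
    exact gradSupR_le_of_lipschitz hL0.le (hCd T hT).2
  · set τ : ℝ → ℝ := fun s => max 0 (min s T) with hτ
    have hτc : Continuous τ := by fun_prop
    have hτT : ∀ s, 0 ≤ τ s ∧ τ s ≤ T := fun s =>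
      ⟨le_max_left _ _, max_le hT (min_le_right _ _)⟩
    choose D C' hD hDh using fun s => exists_hasFDerivAt_holder_of_secDiff hγ
      (by positivity : 0 ≤ S * Real.exp (γ * a)) (hLip _ (hτT s).1 (hτT s).2)
      (hsec _ (hτT s).1 (hτT s).2)
    have hDL : ∀ s x, ‖D s x‖ ≤ L := fun s x => by
      have h1 : LipschitzWith ⟨L, hL0.le⟩ (convVel k (ρ (τ s))) :=
        LipschitzWith.of_dist_le_mul fun x y => by
          rw [dist_eq_norm, dist_eq_norm]
          exact hLip _ (hτT s).1 (hτT s).2 x y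
      exact (hD s x).le_of_lipschitz h1
    have hmeas := measurable_gradSupR
      (d.continuous_convVel hρ hτc hτT fun s => hdist _ (hτT s).1 (hτT s).2)
      hD (fun s => continuous_of_holder hγ (hDh s)) hDL
    have hτe : ∀ s ∈ uIoc 0 T, τ s = s := fun s hs => by
      rw [uIoc_of_le hT] at hs
      rw [hτ]
      simp only [min_eq_left hs.2, max_eq_right hs.1.le]
    have hae : (fun s => gradSupR (convVel k (ρ (τ s)))) =ᵐ[volume.restrict (uIoc 0 T)]
        fun s => gradSupR (convVel k (ρ s)) :=
      (ae_restrict_iff' measurableSet_uIoc).2 (Eventually.of_forall fun s hs => by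
        simp only [hτe s hs])
    refine (intervalIntegrable_const (c := L)).mono_fun (hmeas.aestronglyMeasurable.congr hae) ?_
    refine (ae_restrict_iff' measurableSet_uIoc).2 (Eventually.of_forall fun s hs => ?_)
    rw [uIoc_of_le hT] at hs
    simp only [Real.norm_of_nonneg (gradSupR_nonneg _), Real.norm_of_nonneg hL0.le]
    exact gradSupR_le_of_lipschitz hL0.le (hLip s hs.1.le hs.2)
  · refine ⟨Real.exp a, ?_⟩
    rintro _ ⟨q, rfl⟩
    exact abs_pd_le_of_lipschitz (Real.exp_pos a).le (fun x y => (hdist T hT le_rfl x y).2) _ _ _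
  · obtain ⟨C₁, hC₁, h₁⟩ := exists_norm_secDiff_flow_le (w := fun t => convVel k (ρ t)) hγ hL0
      (by positivity) (Real.exp_pos a).le hLip hsec (fun t h0 ht α β => (hdist t h0 ht α β).2)
      d.flow d.flow_zero hT
    obtain ⟨D, C', hD, hDh⟩ := exists_hasFDerivAt_holder_of_secDiff hγ hC₁
      (fun x y => (hdist T hT le_rfl x y).2) h₁
    refine ⟨C', ?_⟩
    rintro _ ⟨⟨⟨i, j⟩, ⟨⟨x, y⟩, hxy⟩⟩, rfl⟩
    have hpos : 0 < ‖x - y‖ := norm_pos_iff.2 (sub_ne_zero.2 hxy)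
    simp only
    rw [div_le_iff₀ (by positivity), pd_apply_eq (hD x), pd_apply_eq (hD y)]
    exact (abs_apply_single_le (D x - D y) i j).trans (hDh x y)

end TransportData

end

theorem stmt18 (n : ℕ) (hn : 0 < n) (γ : ℝ) (hγ0 : 0 < γ) (hγ1 : γ < 1)
    (k : Euc n → Euc n) (hk : ContDiffOn ℝ 2 k {(0 : Euc n)}ᶜ)
    (hkh : ∀ c : ℝ, 0 < c → ∀ x : Euc n, x ≠ 0 → k (c • x) = c ^ ((1 : ℝ) - n) • k x)
    (ρ₀ : Euc n → ℝ) (hρc : HasCompactSupport ρ₀)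
    (hρb : BddAbove (Set.range fun x => |ρ₀ x|))
    (hρh : BddAbove (Set.range fun p : {p : Euc n × Euc n // p.1 ≠ p.2} =>
      |ρ₀ p.1.1 - ρ₀ p.1.2| / ‖p.1.1 - p.1.2‖ ^ γ))
    (ρ : ℝ → Euc n → ℝ) (v : ℝ → Euc n → Euc n) (X : ℝ → Euc n → Euc n)
    (hinit : ρ 0 = ρ₀)
    (hPDE : ∀ t : ℝ, ∀ x : Euc n,
      HasDerivAt (fun s => ρ s x) (-(fderiv ℝ (ρ t) x (v t x))) t)
    (hconv : ∀ t : ℝ, ∀ x : Euc n, v t x = ∫ y, ρ t y • k (x - y))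
    (hflow0 : ∀ α : Euc n, X 0 α = α)
    (hflow : ∀ t : ℝ, ∀ α : Euc n, HasDerivAt (fun s => X s α) (v t (X t α)) t)
    (hbij : ∀ t : ℝ, Function.Bijective (X t))
    (htransp : ∀ t : ℝ, ρ t = ρ₀ ∘ Function.invFun (X t))
    (hBv : ∀ t : ℝ, BddAbove (Set.range fun q : (Fin n × Fin n) × Euc n =>
      |pd q.1.2 (fun y => v t y q.1.1) q.2|)) :
    ∃ c C : ℝ, 0 < c ∧ 0 < C ∧ ∀ t : ℝ, 0 ≤ t →
      -- the a priori exponential bound on the velocity gradient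
      gradSupR (v t) ≤ C * Real.exp (c * t) ∧
      -- consequently `∫_0^t ‖∇v(·,s)‖_{L^∞} ds < ∞`
      IntervalIntegrable (fun s => gradSupR (v s)) volume 0 t ∧
      -- and `|X(·,t)|_{1,γ}` is finite
      BddAbove (Set.range fun q : (Fin n × Fin n) × Euc n =>
        |pd q.1.2 (fun y => X t y q.1.1) q.2|) ∧
      BddAbove (Set.range fun q : (Fin n × Fin n) × {p : Euc n × Euc n // p.1 ≠ p.2} =>
        |pd q.1.2 (fun y => X t y q.1.1) q.2.1.1 - pd q.1.2 (fun y => X t y q.1.1) q.2.1.2| /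
          ‖q.2.1.1 - q.2.1.2‖ ^ γ) := by
  have hne : Nonempty (Fin n) := ⟨⟨0, hn⟩⟩
  set k₀ : Euc n → Euc n := fun x => if x = 0 then 0 else k x with hk₀
  have hk₀e : ∀ x, x ≠ 0 → k₀ x = k x := fun x hx => if_neg hx
  have hker : IsHomKernel k₀ :=
    { pos := hn
      smooth := hk.congr fun x hx => hk₀e x hx
      zero := if_pos rfl
      homog := fun c hc x hx => by
        rw [hk₀e x hx, hk₀e _ (smul_ne_zero hc.ne' hx)]
        exact hkh c hc x hx }
  have hv : ∀ t x, v t x = convVel k₀ (ρ t) x := fun t x => by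
    rw [hconv, convVel]
    refine integral_congr_ae ?_
    filter_upwards [compl_mem_ae_iff.2 (measure_singleton (μ := volume) x)] with y hy
    rw [hk₀e _ (sub_ne_zero.2 fun h => hy h.symm)]
  have hvf : ∀ t, v t = convVel k₀ (ρ t) := fun t => funext (hv t)
  obtain ⟨A, hA⟩ := hρb
  obtain ⟨H, hH⟩ := hρh
  have hhol : ∀ α β, |ρ₀ α - ρ₀ β| ≤ max H 0 * ‖α - β‖ ^ γ := fun α β => by
    rcases eq_or_ne α β with rfl | hne
    · simp [Real.zero_rpow hγ0.ne']
    · have hpos : 0 < ‖α - β‖ := norm_pos_iff.2 (sub_ne_zero.2 hne)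
      rw [← div_le_iff₀ (by positivity)]
      exact (hH ⟨⟨(α, β), hne⟩, rfl⟩).trans (le_max_left _ _)
  obtain ⟨R, hR⟩ := hρc.isCompact.isBounded.subset_closedBall 0
  have d : TransportData k₀ γ A (max H 0) (|R| + 1) ρ₀ ρ X :=
    { kernel := hker
      exp_pos := hγ0
      exp_lt_one := hγ1
      holder_nonneg := le_max_right _ _
      radius_pos := by positivity
      bound := fun α => hA ⟨α, rfl⟩
      holder := hhol
      support := fun α hα => by
        have := mem_closedBall_zero_iff.1 (hR (subset_tsupport _ hα))
        linarith [le_abs_self R]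
      aemeas := fun t ht => hker.aemeasurable_of_transport
        (ρ' := fun t x => -(fderiv ℝ (ρ t) x (v t x))) (fun x s => hPDE s x)
        (fun x s h => by rw [hv, h, map_zero, neg_zero])
        (by rw [hinit]; exact (continuous_of_holder hγ0 hhol).measurable.aemeasurable) ht
      transp := fun t α => by
        rw [htransp, Function.comp_apply, Function.leftInverse_invFun (hbij t).1]
      bij := hbij
      flow := fun t α => by rw [← hv]; exact hflow t α
      flow_zero := hflow0 }
  simp only [hvf]
  exact d.exists_apriori_bound fun y =>
    continuous_iff_continuousAt.2 fun t => (hPDE t y).continuousAt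

end
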